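/- Let G be a finite group with |G| = |L₃(23)| = 2⁵·3·7·11²·23³·79 and degree pattern D(G) = D(L₃(23)) = (3,2,1,3,2,1), i.e., deg_G(2)=3, deg_G(3)=2, deg_G(7)=1, deg_G(11)=3, deg_G(23)=2, deg_G(79)=1. Then G is isomorphic to L₃(23). -/

import Mathlib

open scoped MatrixGroups

/-- Two distinct primes `p` and `q` dividing `|G|` are adjacent in the prime graph `Γ(G)`
of a finite group `G` iff `G` has an element of order `p * q`. -/
def primeGraphAdj (G : Type*) [Group G] (p q : ℕ) : Prop :=
  p ≠ q ∧ p.Prime ∧ q.Prime ∧ p ∣ Nat.card G ∧ q ∣ Nat.card G ∧ ∃ g : G, orderOf g = p * q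

open scoped Classical in
/-- The degree of a vertex `p` in the prime graph of `G`: the number of primes dividing `|G|`
that are adjacent to `p`. -/
noncomputable def primeGraphDeg (G : Type*) [Group G] (p : ℕ) : ℕ :=
  ((Nat.card G).primeFactors.filter (fun r => primeGraphAdj G p r)).card

set_option linter.all false
set_option linter.style.haveILetI false
set_option linter.unusedSectionVars false
set_option linter.unusedVariables false
namespace OD

instance fact23 : Fact (Nat.Prime 23) := ⟨by norm_num⟩
instance fact11 : Fact (Nat.Prime 11) := ⟨by norm_num⟩
instance fact79 : Fact (Nat.Prime 79) := ⟨by norm_num⟩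
instance fact7 : Fact (Nat.Prime 7) := ⟨by norm_num⟩

section general
variable {G : Type*} [Group G] [Finite G]

open Subgroup MulAction

/-- An element of prime order normalizing a subgroup of order not 1 mod `r` centralizes
a nontrivial element. -/
theorem fix_exists {r : ℕ} (hr : r.Prime) (A : Subgroup G) (g : G) (hg : orderOf g = r)
    (hn : g ∈ normalizer (A : Set G)) (hA : ¬ (Nat.card A ≡ 1 [MOD r])) :
    ∃ a ∈ A, a ≠ 1 ∧ Commute a g := by
  classical
  haveI : Fact r.Prime := ⟨hr⟩
  let H := zpowers g
  have hH : H ≤ normalizer (A : Set G) := by rwa [zpowers_le]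
  letI act : MulAction H A :=
    { smul := fun h a => ⟨h * a * h⁻¹, (mem_normalizer_iff.1 (hH h.2) a).1 a.2⟩
      one_smul := fun a => by ext; change (1:G) * a * 1⁻¹ = a; simp
      mul_smul := fun h k a => by
        ext; change ((h:G) * k) * a * ((h:G)*k)⁻¹ = h * (k * a * (k:G)⁻¹) * (h:G)⁻¹; group }
  have hp : IsPGroup r H := IsPGroup.of_card (n := 1) (by rw [Nat.card_zpowers, hg, pow_one])
  have h1 := hp.card_modEq_card_fixedPoints A
  by_contra hcon
  push Not at hcon
  apply hA
  refine h1.trans ?_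
  have : Nat.card (fixedPoints H A) = 1 := by
    rw [Nat.card_eq_one_iff_unique]
    constructor
    · constructor
      have key : ∀ x : fixedPoints H A, ((x : A) : G) = 1 := by
        intro x
        by_contra hx
        refine hcon _ x.1.2 hx ?_
        have := x.2 ⟨g, mem_zpowers g⟩
        have h2 : g * ((x:A):G) * g⁻¹ = ((x:A):G) := congrArg Subtype.val this
        rw [Commute, SemiconjBy, ← mul_inv_eq_iff_eq_mul.1 h2.symm.symm] 
      intro x y
      apply Subtype.ext; apply Subtype.ext
      rw [key x, key y]
    · refine ⟨⟨1, ?_⟩⟩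
      intro h
      apply Subtype.ext
      change (h:G) * 1 * (h:G)⁻¹ = 1
      simp
  rw [this]

theorem exists_order_mul {p r : ℕ} (hp : p.Prime) (hr : r.Prime) (hpr : p ≠ r) {a g : G}
    (hpa : p ∣ orderOf a) (hg : r ∣ orderOf g) (hc : Commute a g) :
    ∃ x : G, orderOf x = p * r := by
  obtain ⟨k, hk⟩ := hpa
  obtain ⟨l, hl⟩ := hg
  have hk0 : k ≠ 0 := by rintro rfl; exact (orderOf_pos a).ne' (by simpa using hk)
  have hl0 : l ≠ 0 := by rintro rfl; exact (orderOf_pos g).ne' (by simpa using hl)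
  refine ⟨a ^ k * g ^ l, ?_⟩
  have h1 : orderOf (a ^ k) = p := by
    rw [orderOf_pow_of_dvd hk0 (by rw [hk]; exact Dvd.intro_left _ rfl), hk]
    exact Nat.mul_div_cancel _ (Nat.pos_of_ne_zero hk0)
  have h2 : orderOf (g ^ l) = r := by
    rw [orderOf_pow_of_dvd hl0 (by rw [hl]; exact Dvd.intro_left _ rfl), hl]
    exact Nat.mul_div_cancel _ (Nat.pos_of_ne_zero hl0)
  rw [(hc.pow_pow k l).orderOf_mul_eq_mul_orderOf_of_coprime, h1, h2]
  rw [h1, h2]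
  exact (Nat.coprime_primes hp hr).2 hpr

/-- adjacency from commuting elements -/
theorem adj_of_commute {p r : ℕ} (hp : p.Prime) (hr : r.Prime) (hpr : p ≠ r) {a g : G}
    (hpa : p ∣ orderOf a) (hg : r ∣ orderOf g) (hc : Commute a g) :
    primeGraphAdj G p r :=
  ⟨hpr, hp, hr, hpa.trans (orderOf_dvd_natCard a), hg.trans (orderOf_dvd_natCard g),
    exists_order_mul hp hr hpr hpa hg hc⟩

theorem dvd_orderOf_of_pgroup {p : ℕ} [Fact p.Prime] {A : Subgroup G} (hA : IsPGroup p A) {a : G}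
    (ha : a ∈ A) (h1 : a ≠ 1) : p ∣ orderOf a := by
  obtain ⟨k, hk⟩ := (IsPGroup.iff_orderOf.1 hA) ⟨a, ha⟩
  rw [Subgroup.orderOf_mk] at hk
  rcases k with _ | k
  · rw [pow_zero, orderOf_eq_one_iff] at hk; exact absurd hk h1
  · rw [hk]; exact dvd_pow_self _ (by simp)

/-- FIX + ADJ -/
theorem adj_of_normalizes {p r : ℕ} [Fact p.Prime] (hr : r.Prime) (hpr : p ≠ r)
    {A N : Subgroup G} (hA : IsPGroup p A) (hN : N ≤ normalizer (A : Set G))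
    (hrN : r ∣ Nat.card N) (hcA : ¬ (Nat.card A ≡ 1 [MOD r])) : primeGraphAdj G p r := by
  haveI : Fact r.Prime := ⟨hr⟩
  obtain ⟨g, hg⟩ := exists_prime_orderOf_dvd_card' r hrN
  have hg' : orderOf (g : G) = r := by rw [Subgroup.orderOf_coe, hg]
  obtain ⟨a, haA, ha1, hc⟩ := fix_exists hr A (g:G) hg' (hN g.2) hcA
  exact adj_of_commute (Fact.out) hr hpr (dvd_orderOf_of_pgroup hA haA ha1) (by rw [hg']) hc

theorem adj_symm {p r : ℕ} (h : primeGraphAdj G p r) : primeGraphAdj G r p := by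
  obtain ⟨a, b, c, d, e, g, hg⟩ := h
  exact ⟨a.symm, c, b, e, d, g, by rw [hg, mul_comm]⟩

end general

/-- divisors of numbers with explicit exponents -/
theorem dvd_form {d : ℕ} {a b c e f : ℕ} (h : d ∣ 2 ^ a * 3 ^ b * 7 ^ c * 11 ^ e * 23 ^ f) :
    ∃ a' ≤ a, ∃ b' ≤ b, ∃ c' ≤ c, ∃ e' ≤ e, ∃ f' ≤ f,
      d = 2 ^ a' * 3 ^ b' * 7 ^ c' * 11 ^ e' * 23 ^ f' := by
  obtain ⟨x, y, hx, hy, rfl⟩ := (Nat.dvd_mul).1 h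
  obtain ⟨x1, z, hx1, hz, rfl⟩ := (Nat.dvd_mul).1 hx
  obtain ⟨x2, w, hx2, hw, rfl⟩ := (Nat.dvd_mul).1 hx1
  obtain ⟨x3, v, hx3, hv, rfl⟩ := (Nat.dvd_mul).1 hx2
  obtain ⟨a', ha, rfl⟩ := (Nat.dvd_prime_pow (by norm_num)).1 hx3
  obtain ⟨b', hb, rfl⟩ := (Nat.dvd_prime_pow (by norm_num)).1 hv
  obtain ⟨c', hc, rfl⟩ := (Nat.dvd_prime_pow (by norm_num)).1 hw
  obtain ⟨d', hd, rfl⟩ := (Nat.dvd_prime_pow (by norm_num)).1 hz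
  obtain ⟨e', he, rfl⟩ := (Nat.dvd_prime_pow (by norm_num)).1 hy
  exact ⟨a', ha, b', hb, c', hc, d', hd, e', he, rfl⟩

section step0
variable {G : Type*} [Group G] [Finite G]

open Subgroup MulAction
open scoped Classical in
/-- the set of neighbours -/
noncomputable def nb (G : Type*) [Group G] (p : ℕ) : Finset ℕ :=
  (Nat.card G).primeFactors.filter (fun r => primeGraphAdj G p r)

theorem mem_nb {p r : ℕ} : r ∈ nb G p ↔ primeGraphAdj G p r := by
  classical
  unfold nb
  rw [Finset.mem_filter]
  constructor
  · exact fun h => h.2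
  · intro h
    refine ⟨?_, h⟩
    obtain ⟨a, b, c, d, e, g, hg⟩ := h
    exact Nat.mem_primeFactors.2 ⟨c, e, Nat.card_pos.ne'⟩

theorem deg_eq (p : ℕ) : primeGraphDeg G p = (nb G p).card := by
  unfold primeGraphDeg nb
  rfl

theorem primeFactors_card : (2 ^ 5 * 3 * 7 * 11 ^ 2 * 23 ^ 3 * 79 : ℕ).primeFactors =
    {2, 3, 7, 11, 23, 79} := by
  rw [Nat.primeFactors_mul (by norm_num) (by norm_num), Nat.primeFactors_mul (by norm_num) (by norm_num),
    Nat.primeFactors_mul (by norm_num) (by norm_num),Nat.primeFactors_mul (by norm_num) (by norm_num),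
    Nat.primeFactors_mul (by norm_num) (by norm_num), Nat.primeFactors_pow _ (by norm_num),
    Nat.primeFactors_pow _ (by norm_num), Nat.primeFactors_pow _ (by norm_num),
    Nat.Prime.primeFactors (by norm_num), Nat.Prime.primeFactors (by norm_num),
    Nat.Prime.primeFactors (by norm_num), Nat.Prime.primeFactors (by norm_num),
    Nat.Prime.primeFactors (by norm_num), Nat.Prime.primeFactors (by norm_num)]
  decide

theorem n79_cases' : ∀ (a : Fin 6) (b : Fin 2) (c : Fin 2) (e : Fin 3) (f : Fin 4),
    (2 ^ a.1 * 3 ^ b.1 * 7 ^ c.1 * 11 ^ e.1 * 23 ^ f.1) % 79 = 1 →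
    (a.1 = 5 ∧ b.1 = 0 ∧ c.1 = 0 ∧ e.1 = 2 ∧ f.1 = 3) ∨
    (c.1 = 0 ∧ e.1 < 2) ∨ (c.1 = 0 ∧ f.1 < 3) ∨ (e.1 < 2 ∧ f.1 < 3) := by
  decide +kernel

theorem n79_cases (a : ℕ) (ha : a < 6) (b : ℕ) (hb : b < 2) (c : ℕ) (hc : c < 2)
    (e : ℕ) (he : e < 3) (f : ℕ) (hf : f < 4)
    (h : (2 ^ a * 3 ^ b * 7 ^ c * 11 ^ e * 23 ^ f) % 79 = 1) :
    (a = 5 ∧ b = 0 ∧ c = 0 ∧ e = 2 ∧ f = 3) ∨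
    (c = 0 ∧ e < 2) ∨ (c = 0 ∧ f < 3) ∨ (e < 2 ∧ f < 3) :=
  n79_cases' ⟨a, ha⟩ ⟨b, hb⟩ ⟨c, hc⟩ ⟨e, he⟩ ⟨f, hf⟩ h

theorem card79 (hcard : Nat.card G = 2 ^ 5 * 3 * 7 * 11 ^ 2 * 23 ^ 3 * 79)
    (hdeg79 : primeGraphDeg G 79 = 1) (P : Sylow 79 G) :
    Nat.card (normalizer (P : Set G)) = 1659 ∧ primeGraphAdj G 79 7 := by
  have hP : Nat.card P = 79 := by
    rw [P.card_eq_multiplicity, hcard]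
    have : (2 ^ 5 * 3 * 7 * 11 ^ 2 * 23 ^ 3 * 79 : ℕ).factorization 79 = 1 := by
      rw [Nat.factorization_eq_of_coprime_right (by norm_num) (by simp)]
      simp [Nat.Prime.factorization_self (show Nat.Prime 79 by norm_num)]
    rw [this, pow_one]
  have hidx : Nat.card (Sylow 79 G) = (normalizer (P : Set G)).index := P.card_eq_index_normalizer
  have h1 : Nat.card (Sylow 79 G) ≡ 1 [MOD 79] := card_sylow_modEq_one 79 G
  have hdvd : Nat.card (Sylow 79 G) ∣ 2 ^ 5 * 3 ^ 1 * 7 ^ 1 * 11 ^ 2 * 23 ^ 3 := by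
    refine (P.card_dvd_index).trans ?_
    have := (P : Subgroup G).card_mul_index
    rw [hP, hcard] at this
    have h2 : (P : Subgroup G).index = 2 ^ 5 * 3 ^ 1 * 7 ^ 1 * 11 ^ 2 * 23 ^ 3 := by omega
    rw [h2]
  obtain ⟨a, ha, b, hb, c, hc, e, he, f, hf, hn⟩ := dvd_form hdvd
  have hmul := (normalizer (P : Set G)).card_mul_index
  rw [← hidx, hcard, hn] at hmul
  rw [hn] at h1
  have hadj : ∀ r : ℕ, r.Prime → 79 ≠ r → ¬ (79 ≡ 1 [MOD r]) → 
      r ∣ Nat.card (normalizer (P : Set G)) → r ∈ nb G 79 := by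
    intro r hr h79 hr1 hrd
    exact mem_nb.2 (adj_of_normalizes hr h79 P.2 le_rfl hrd (by rw [show Nat.card (P : Subgroup G) = 79 from hP]; exact hr1))
  have hnb : (nb G 79).card = 1 := by rw [← deg_eq]; exact hdeg79
  rw [Finset.card_eq_one] at hnb
  obtain ⟨s, hs⟩ := hnb
  have u7 : c = 0 → 7 ∈ nb G 79 := by
    rintro rfl
    apply hadj 7 (by norm_num) (by norm_num) (by decide)
    have : 7 ∣ Nat.card (normalizer (P : Set G)) * (2 ^ a * 3 ^ b * 7 ^ 0 * 11 ^ e * 23 ^ f) := by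
      rw [hmul]; norm_num
    refine Nat.Coprime.dvd_of_dvd_mul_right ?_ this
    simp [Nat.coprime_mul_iff_right]
    refine ⟨⟨⟨?_, ?_⟩, ?_⟩, ?_⟩ <;> exact Nat.Coprime.pow_right _ (by norm_num)
  have u11 : e < 2 → 11 ∈ nb G 79 := by
    intro he2
    apply hadj 11 (by norm_num) (by norm_num) (by decide)
    by_contra hnd
    have : 11 ^ 2 ∣ Nat.card (normalizer (P : Set G)) * (2 ^ a * 3 ^ b * 7 ^ c * 11 ^ e * 23 ^ f) := by
      rw [hmul]; norm_num
    have hco : Nat.Coprime (11 ^ 2) (Nat.card (normalizer (P : Set G))) :=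
      Nat.Coprime.pow_left _ ((Nat.Prime.coprime_iff_not_dvd (by norm_num)).2 hnd)
    have h2 := hco.dvd_of_dvd_mul_left this
    have h3 : 11 ^ 2 ∣ 11 ^ e := by
      have e1 : 2 ^ a * 3 ^ b * 7 ^ c * 11 ^ e * 23 ^ f = (2 ^ a * 3 ^ b * 7 ^ c * 23 ^ f) * 11 ^ e := by ring
      rw [e1] at h2
      refine Nat.Coprime.dvd_of_dvd_mul_left ?_ h2
      simp only [Nat.coprime_mul_iff_right]
      refine ⟨⟨⟨?_, ?_⟩, ?_⟩, ?_⟩ <;> exact Nat.Coprime.pow _ _ (by norm_num)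
    have := (Nat.pow_dvd_pow_iff_le_right (by norm_num)).1 h3
    omega
  have u23 : f < 3 → 23 ∈ nb G 79 := by
    intro he2
    apply hadj 23 (by norm_num) (by norm_num) (by decide)
    by_contra hnd
    have : 23 ^ 3 ∣ Nat.card (normalizer (P : Set G)) * (2 ^ a * 3 ^ b * 7 ^ c * 11 ^ e * 23 ^ f) := by
      rw [hmul]; norm_num
    have hco : Nat.Coprime (23 ^ 3) (Nat.card (normalizer (P : Set G))) :=
      Nat.Coprime.pow_left _ ((Nat.Prime.coprime_iff_not_dvd (by norm_num)).2 hnd)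
    have h2 := hco.dvd_of_dvd_mul_left this
    have h3 : 23 ^ 3 ∣ 23 ^ f := by
      refine Nat.Coprime.dvd_of_dvd_mul_left ?_ h2
      simp only [Nat.coprime_mul_iff_right]
      refine ⟨⟨⟨?_, ?_⟩, ?_⟩, ?_⟩ <;> exact Nat.Coprime.pow _ _ (by norm_num)
    have := (Nat.pow_dvd_pow_iff_le_right (by norm_num)).1 h3
    omega
  rw [hs] at u7 u11 u23
  simp only [Finset.mem_singleton] at u7 u11 u23
  rcases n79_cases a (by omega) b (by omega) c (by omega) e (by omega) f (by omega) h1 with ⟨rfl, rfl, rfl, rfl, rfl⟩ | h | h | h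
  · refine ⟨by omega, ?_⟩
    rw [← mem_nb, hs, ← u7 rfl]; simp
  · have := u7 h.1; have := u11 h.2; omega
  · have := u7 h.1; have := u23 h.2; omega
  · have := u11 h.1; have := u23 h.2; omega

/-- the prime graph information we need -/
theorem graph_info (hcard : Nat.card G = 2 ^ 5 * 3 * 7 * 11 ^ 2 * 23 ^ 3 * 79)
    (hdeg2 : primeGraphDeg G 2 = 3)
    (hdeg3 : primeGraphDeg G 3 = 2)
    (hdeg7 : primeGraphDeg G 7 = 1)
    (hdeg11 : primeGraphDeg G 11 = 3)
    (hdeg23 : primeGraphDeg G 23 = 2)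
    (hdeg79 : primeGraphDeg G 79 = 1) :
    ¬ primeGraphAdj G 23 3 ∧ ¬ primeGraphAdj G 23 7 ∧ ¬ primeGraphAdj G 23 79 ∧
    primeGraphAdj G 23 2 ∧ ¬ primeGraphAdj G 79 2 ∧ ¬ primeGraphAdj G 79 11 := by
  classical
  obtain ⟨P⟩ : Nonempty (Sylow 79 G) := inferInstance
  have h797 := (card79 hcard hdeg79 P).2
  have hsub : ∀ p, nb G p ⊆ ({2, 3, 7, 11, 23, 79} : Finset ℕ).erase p := by
    intro p r hr
    have h1 := mem_nb.1 hr
    rw [Finset.mem_erase]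
    refine ⟨h1.1.symm, ?_⟩
    rw [← primeFactors_card, ← hcard]
    exact (Finset.mem_filter.1 hr).1
  have n79 : nb G 79 = {7} := by
    obtain ⟨s, hs⟩ := Finset.card_eq_one.1 ((deg_eq (G := G) 79).symm.trans hdeg79)
    have : 7 ∈ nb G 79 := mem_nb.2 h797
    rw [hs] at this ⊢
    rw [Finset.mem_singleton.1 this]
  have n7 : nb G 7 = {79} := by
    obtain ⟨s, hs⟩ := Finset.card_eq_one.1 ((deg_eq (G := G) 7).symm.trans hdeg7)
    have : 79 ∈ nb G 7 := mem_nb.2 (adj_symm h797)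
    rw [hs] at this ⊢
    rw [Finset.mem_singleton.1 this]
  have no79 : ∀ p, p ≠ 7 → ¬ primeGraphAdj G p 79 := by
    intro p hp h
    have := mem_nb.2 (adj_symm h)
    rw [n79] at this; simp at this; exact hp this
  have no7 : ∀ p, p ≠ 79 → ¬ primeGraphAdj G p 7 := by
    intro p hp h
    have := mem_nb.2 (adj_symm h)
    rw [n7] at this; simp at this; exact hp this
  have s2 : nb G 2 = {3, 11, 23} := by
    apply Finset.eq_of_subset_of_card_le
    · intro r hr
      have := hsub 2 hr
      have a1 : r ≠ 7 := by rintro rfl; exact no7 2 (by norm_num) (mem_nb.1 hr)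
      have a2 : r ≠ 79 := by rintro rfl; exact no79 2 (by norm_num) (mem_nb.1 hr)
      simp at this ⊢; omega
    · rw [← deg_eq, hdeg2]; decide
  have s11 : nb G 11 = {2, 3, 23} := by
    apply Finset.eq_of_subset_of_card_le
    · intro r hr
      have := hsub 11 hr
      have a1 : r ≠ 7 := by rintro rfl; exact no7 11 (by norm_num) (mem_nb.1 hr)
      have a2 : r ≠ 79 := by rintro rfl; exact no79 11 (by norm_num) (mem_nb.1 hr)
      simp at this ⊢; omega
    · rw [← deg_eq, hdeg11]; decide
  have a2 : primeGraphAdj G 23 2 := adj_symm (mem_nb.1 (by rw [s2]; decide))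
  have a11 : primeGraphAdj G 23 11 := adj_symm (mem_nb.1 (by rw [s11]; decide))
  have s23 : nb G 23 = {2, 11} := by
    symm
    apply Finset.eq_of_subset_of_card_le
    · intro r hr
      simp at hr
      rcases hr with rfl | rfl
      · exact mem_nb.2 a2
      · exact mem_nb.2 a11
    · rw [← deg_eq, hdeg23]; decide
  refine ⟨?_, ?_, ?_, a2, ?_, ?_⟩
  all_goals rw [← mem_nb]
  · rw [s23]; decide
  · rw [s23]; decide
  · rw [s23]; decide
  · rw [n79]; decide
  · rw [n79]; decide

/-- Lemma N -/
theorem lemmaN (hcard : Nat.card G = 2 ^ 5 * 3 * 7 * 11 ^ 2 * 23 ^ 3 * 79)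
    (hdeg79 : primeGraphDeg G 79 = 1) (M : Subgroup G) [M.Normal]
    (hM : Nat.Coprime M.index 1659) : M = ⊤ := by
  obtain ⟨P⟩ : Nonempty (Sylow 79 M) := inferInstance
  have hfr := Sylow.normalizer_sup_eq_top P
  have hPc : Nat.card P = 79 := by
    have hidx := M.card_mul_index
    have h79 : 79 ∣ Nat.card M := by
      have : Nat.Coprime 79 M.index := (hM.coprime_dvd_right (by norm_num)).symm
      refine this.dvd_of_dvd_mul_right ?_
      rw [hidx, hcard]; exact Dvd.intro_left _ rfl
    obtain ⟨k, hk⟩ := IsPGroup.iff_card.1 P.2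
    have h1 : 79 ∣ Nat.card P := P.dvd_card_of_dvd_card h79
    have h2 : Nat.card P ∣ Nat.card G := (Subgroup.card_subgroup_dvd_card _).trans (Subgroup.card_subgroup_dvd_card M)
    have hk1 : k = 1 := by
      rcases k with _ | _ | k
      · change Nat.card P = _ at hk
        rw [hk] at h1; norm_num at h1
      · rfl
      · exfalso
        change Nat.card P = _ at hk
        rw [hk, hcard] at h2
        have : 79 ^ 2 ∣ 2 ^ 5 * 3 * 7 * 11 ^ 2 * 23 ^ 3 * 79 := (pow_dvd_pow 79 (by omega)).trans h2
        norm_num at this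
    change Nat.card P = _ at hk
    rw [hk, hk1, pow_one]
  have hPc' : Nat.card ((P : Subgroup M).map M.subtype) = 79 := by
    refine Eq.trans ?_ hPc
    exact Nat.card_congr ((P : Subgroup M).equivMapOfInjective _ M.subtype_injective).symm.toEquiv
  obtain ⟨Q, hQ⟩ : ∃ Q : Sylow 79 G, (Q : Subgroup G) = (P : Subgroup M).map M.subtype := by
    obtain ⟨Q, hQ⟩ := IsPGroup.exists_le_sylow (IsPGroup.of_card (n := 1) (p := 79) (by rw [hPc', pow_one]))
    refine ⟨Q, ?_⟩
    have : Nat.card Q = 79 := by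
      rw [Q.card_eq_multiplicity, hcard]
      have : (2 ^ 5 * 3 * 7 * 11 ^ 2 * 23 ^ 3 * 79 : ℕ).factorization 79 = 1 := by
        rw [Nat.factorization_eq_of_coprime_right (by norm_num) (by simp)]
        simp [Nat.Prime.factorization_self (show Nat.Prime 79 by norm_num)]
      rw [this, pow_one]
    symm
    exact Subgroup.eq_of_le_of_card_ge hQ (by rw [hPc']; exact this.le)
  have hN : Nat.card (normalizer (((P : Subgroup M).map M.subtype : Subgroup G) : Set G)) = 1659 := by
    rw [← hQ]
    exact (card79 hcard hdeg79 Q).1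
  have hrel : M.relIndex (normalizer (((P : Subgroup M).map M.subtype : Subgroup G) : Set G)) = M.index := by
    rw [← Subgroup.relIndex_sup_right, hfr, Subgroup.relIndex_top_right]
  have hd : M.index ∣ 1659 := by
    rw [← hN, ← hrel]
    exact Subgroup.relIndex_dvd_card _ _
  rw [← Subgroup.index_eq_one]
  exact Nat.eq_one_of_dvd_coprimes hM dvd_rfl hd

end step0
end OD

namespace OD
open Subgroup MulAction

theorem dvd_form' {d : ℕ} {a e f : ℕ} (h : d ∣ 2 ^ a * 11 ^ e * 23 ^ f) :
    ∃ a' ≤ a, ∃ e' ≤ e, ∃ f' ≤ f, d = 2 ^ a' * 11 ^ e' * 23 ^ f' := by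
  obtain ⟨x, y, hx, hy, rfl⟩ := (Nat.dvd_mul).1 h
  obtain ⟨x1, z, hx1, hz, rfl⟩ := (Nat.dvd_mul).1 hx
  obtain ⟨a', ha, rfl⟩ := (Nat.dvd_prime_pow (by norm_num)).1 hx1
  obtain ⟨b', hb, rfl⟩ := (Nat.dvd_prime_pow (by norm_num)).1 hz
  obtain ⟨c', hc, rfl⟩ := (Nat.dvd_prime_pow (by norm_num)).1 hy
  exact ⟨a', ha, b', hb, c', hc, rfl⟩

theorem num1 : ∀ (a : Fin 6) (b : Fin 3), (2 ^ a.1 * 11 ^ b.1) % 23 = 1 →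
    (a.1 = 0 ∧ b.1 = 0) ∨ (a.1 = 2 ∧ b.1 = 2) := by decide +kernel

theorem num2 : ∀ (a : Fin 6) (b : Fin 2), (2 ^ a.1 * 23 ^ b.1) % 11 = 1 → a.1 = 0 := by
  decide +kernel

theorem card_sylow_of {G : Type*} [Group G] [Finite G] {p : ℕ} [Fact p.Prime] (P : Sylow p G)
    {m n : ℕ} (h : Nat.card G = m * p ^ n) (hm : ¬ p ∣ m) : Nat.card P = p ^ n := by
  rw [P.card_eq_multiplicity, h]
  congr 1
  have hp : p.Prime := Fact.out
  have hm0 : m ≠ 0 := by rintro rfl; simp at hm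
  rw [Nat.factorization_mul hm0 (pow_ne_zero _ hp.ne_zero)]
  simp [hp.factorization_self, Nat.factorization_eq_zero_of_not_dvd hm]

theorem not_dvd_211 (a b : ℕ) : ¬ 23 ∣ 2 ^ a * 11 ^ b := by
  intro h
  have h23 : Nat.Prime 23 := by norm_num
  rcases h23.dvd_mul.1 h with h | h
  · have := h23.dvd_of_dvd_pow h; norm_num at this
  · have := h23.dvd_of_dvd_pow h; norm_num at this

/-- number of Sylow 23 subgroups in a {2,11,23}-group of small order -/
theorem n23_of {L : Type*} [Group L] [Finite L] {a b c : ℕ} (ha : a ≤ 5) (hb : b ≤ 2)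
    (hc : Nat.card L = 2 ^ a * 11 ^ b * 23 ^ c) :
    Nat.card (Sylow 23 L) = 1 ∨ (Nat.card (Sylow 23 L) = 484 ∧ b = 2) := by
  obtain ⟨P⟩ : Nonempty (Sylow 23 L) := inferInstance
  have hP : Nat.card (P : Subgroup L) = 23 ^ c := card_sylow_of P hc (not_dvd_211 a b)
  have hd : Nat.card (Sylow 23 L) ∣ 2 ^ a * 11 ^ b * 23 ^ 0 := by
    refine P.card_dvd_index.trans ?_
    have h1 := (P : Subgroup L).card_mul_index
    rw [hP, hc, mul_comm] at h1
    have := Nat.eq_of_mul_eq_mul_right (by positivity) h1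
    rw [this, pow_zero, mul_one]
  obtain ⟨a', ha', b', hb', c', hc', hn⟩ := dvd_form' hd
  obtain rfl : c' = 0 := by omega
  rw [pow_zero, mul_one] at hn
  have h1 : Nat.card (Sylow 23 L) % 23 = 1 := card_sylow_modEq_one 23 L
  rw [hn] at h1
  have := num1 ⟨a', by omega⟩ ⟨b', by omega⟩ h1
  simp only at this
  rcases this with ⟨rfl, rfl⟩ | ⟨rfl, rfl⟩
  · left; rw [hn]; norm_num
  · right; exact ⟨by rw [hn]; norm_num, by omega⟩

theorem f1c1 {L : Type*} [Group L] [Finite L] {a b : ℕ} (ha : a ≤ 5) (hb : b ≤ 2)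
    (hc : Nat.card L = 2 ^ a * 11 ^ b * 23) : Subsingleton (Sylow 23 L) := by
  have hc' : Nat.card L = 2 ^ a * 11 ^ b * 23 ^ 1 := by rw [hc, pow_one]
  rcases n23_of ha hb hc' with h | ⟨hn, rfl⟩
  · exact (Nat.card_eq_one_iff_unique.1 h).1
  exfalso
  -- no commuting elements
  have key : ∀ y g : L, 11 ∣ orderOf y → orderOf g = 23 → Commute y g → False := by
    intro y g hy hg hcom
    have hcz : Nat.card (zpowers g) = 23 := by rw [Nat.card_zpowers, hg]
    obtain ⟨P, hP⟩ := IsPGroup.exists_le_sylow (IsPGroup.of_card (p := 23) (n := 1) (G := zpowers g)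
      (by rw [hcz, pow_one]))
    have hPc : Nat.card P = 23 := by rw [card_sylow_of P hc' (not_dvd_211 a 2), pow_one]
    have hPe : zpowers g = P := Subgroup.eq_of_le_of_card_ge hP (by rw [hcz]; exact hPc.le)
    have hyN : y ∈ normalizer (P : Set L) := by
      change y ∈ normalizer ((P : Subgroup L) : Set L)
      rw [← hPe]
      refine (Subgroup.centralizer_le_normalizer _) ?_
      rw [Subgroup.mem_centralizer_iff]
      rintro h ⟨k, rfl⟩
      exact (hcom.zpow_right k).eq.symm
    have h1 := P.card_eq_index_normalizer
    have h2 := (normalizer (P : Set L)).card_mul_index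
    rw [← h1, hn, hc] at h2
    have h3 : 11 ∣ Nat.card (normalizer (P : Set L)) := by
      have := orderOf_dvd_natCard (⟨y, hyN⟩ : normalizer (P : Set L))
      rw [Subgroup.orderOf_mk] at this
      exact hy.trans this
    obtain ⟨k, hk⟩ := h3
    have : 2 ^ a * 23 = 11 * (k * 4) := by rw [hk] at h2; omega
    have h11 : Nat.Prime 11 := by norm_num
    rcases h11.dvd_mul.1 (Dvd.intro _ this.symm) with h | h
    · have := h11.dvd_of_dvd_pow h; norm_num at this
    · norm_num at h
  obtain ⟨R⟩ : Nonempty (Sylow 11 L) := inferInstance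
  have h11m : ¬ 11 ∣ 2 ^ a * 23 := by
    intro h
    have h11 : Nat.Prime 11 := by norm_num
    rcases h11.dvd_mul.1 h with h | h
    · have := h11.dvd_of_dvd_pow h; norm_num at this
    · norm_num at h
  have hcR : ∀ R : Sylow 11 L, Nat.card (R : Subgroup L) = 121 := fun R => by
    have := card_sylow_of R (m := 2 ^ a * 23) (n := 2) (by rw [hc]; ring) h11m
    rw [this]; norm_num
  by_cases hs : Subsingleton (Sylow 11 L)
  · obtain ⟨g, hg⟩ := exists_prime_orderOf_dvd_card' (G := L) 23 (by rw [hc]; exact Dvd.intro_left _ rfl)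
    have hRn : (R : Subgroup L).Normal := R.normal_of_subsingleton
    obtain ⟨y, hy, hy1, hcm⟩ := fix_exists (by norm_num) (R : Subgroup L) g hg
      (by rw [Subgroup.normalizer_eq_top]; trivial) (by rw [hcR]; decide)
    exact key y g (dvd_orderOf_of_pgroup R.2 hy hy1) hg hcm
  · -- n_11 = 23
    have hcardlt : Nat.card (Sylow 11 L) ≤ 23 := by
      have hd : Nat.card (Sylow 11 L) ∣ 2 ^ a * 11 ^ 0 * 23 ^ 1 := by
        refine R.card_dvd_index.trans ?_
        have h1 := (R : Subgroup L).card_mul_index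
        rw [hcR, hc] at h1
        have : (R : Subgroup L).index = 2 ^ a * 23 := by omega
        rw [this]; simp
      obtain ⟨a', ha', b', hb', c', hc', hn⟩ := dvd_form' hd
      obtain rfl : b' = 0 := by omega
      rw [pow_zero, mul_one] at hn
      have h1 : Nat.card (Sylow 11 L) % 11 = 1 := card_sylow_modEq_one 11 L
      rw [hn] at h1
      have := num2 ⟨a', by omega⟩ ⟨c', by omega⟩ h1
      simp only at this
      rw [this] at hn
      rw [hn, pow_zero, one_mul]
      exact (Nat.pow_le_pow_right (by norm_num) hc')
    obtain ⟨R, R', hne⟩ := not_subsingleton_iff_nontrivial.1 hs |>.exists_pair_ne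
    obtain ⟨y, hyR, hyR', hy1⟩ : ∃ y ∈ (R : Subgroup L), y ∈ (R' : Subgroup L) ∧ y ≠ 1 := by
      by_contra hcon
      push Not at hcon
      have h1 : (normalizer (R' : Set L)).relIndex (R : Subgroup L) ≤ 23 := by
        refine le_trans ?_ hcardlt
        rw [R'.card_eq_index_normalizer]
        rw [← Subgroup.relIndex_top_right]
        exact Subgroup.relIndex_le_of_le_right le_top (by rw [Subgroup.relIndex_top_right]; exact Subgroup.index_ne_zero_of_finite)
      have h2 : (normalizer (R' : Set L)).subgroupOf (R : Subgroup L) = ⊥ := by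
        rw [Subgroup.subgroupOf_eq_bot, disjoint_iff, inf_comm]
        change (R : Subgroup L) ⊓ normalizer (R' : Set L) = ⊥
        rw [R.2.inf_normalizer_sylow]
        rw [eq_bot_iff]
        intro z hz
        exact hcon z hz.1 hz.2
      rw [Subgroup.relIndex, h2, Subgroup.index_bot, hcR] at h1
      norm_num at h1
    have hcen : ∀ R : Sylow 11 L, y ∈ (R : Subgroup L) → (R : Subgroup L) ≤ centralizer {y} := by
      intro R hy z hz
      have hcomm := IsPGroup.commutative_of_card_eq_prime_sq (p := 11) (G := (R : Subgroup L))
        (by rw [hcR]; norm_num)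
      rw [Subgroup.mem_centralizer_singleton_iff]
      have := hcomm ⟨z, hz⟩ ⟨y, hy⟩
      exact congrArg Subtype.val this
    by_cases h23 : 23 ∣ Nat.card (centralizer {y})
    · obtain ⟨g, hg⟩ := exists_prime_orderOf_dvd_card' 23 h23
      refine key y g (dvd_orderOf_of_pgroup R.2 hyR hy1) (by rw [Subgroup.orderOf_coe, hg]) ?_
      exact (Subgroup.mem_centralizer_singleton_iff.1 g.2).symm
    · apply hne
      apply Sylow.subtype_injective (hP := hcen R hyR) (hQ := hcen R' hyR')
      suffices h : Nat.card (Sylow 11 (centralizer {y})) = 1 from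
        (Nat.card_eq_one_iff_unique.1 h).1.elim _ _
      have hd1 : Nat.card (centralizer {y}) ∣ 2 ^ a * 11 ^ 2 := by
        have := Subgroup.card_subgroup_dvd_card (centralizer {y})
        rw [hc] at this
        exact Nat.Coprime.dvd_of_dvd_mul_right
          ((Nat.Prime.coprime_iff_not_dvd (by norm_num)).2 h23).symm this
      let S := R.subtype (hcen R hyR)
      have hSc : Nat.card (S : Subgroup (centralizer {y})) = 121 := by
        rw [Sylow.coe_subtype, ← hcR R]
        exact Nat.card_congr (Subgroup.subgroupOfEquivOfLe (hcen R hyR)).toEquiv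
      have hd : Nat.card (Sylow 11 (centralizer {y})) ∣ 2 ^ a * 11 ^ 0 * 23 ^ 0 := by
        refine S.card_dvd_index.trans ?_
        have h1 := (S : Subgroup (centralizer {y})).card_mul_index
        rw [← h1, hSc, mul_comm] at hd1
        simpa using Nat.dvd_of_mul_dvd_mul_right (by norm_num) hd1
      obtain ⟨a', ha', b', hb', c', hc', hn⟩ := dvd_form' hd
      obtain rfl : b' = 0 := by omega
      rw [pow_zero, mul_one] at hn
      have h1 : Nat.card (Sylow 11 (centralizer {y})) % 11 = 1 := card_sylow_modEq_one 11 _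
      rw [hn] at h1
      have := num2 ⟨a', by omega⟩ ⟨c', by omega⟩ h1
      simp only at this
      obtain rfl : c' = 0 := by omega
      rw [hn, this]; norm_num

theorem f1 {H : Type*} [Group H] [Finite H] (hc : Nat.card H ∣ 2 ^ 5 * 11 ^ 2 * 23 ^ 3) :
    Subsingleton (Sylow 23 H) := by
  obtain ⟨a, ha, b, hb, c, hc3, hc⟩ := dvd_form' hc
  by_contra hns
  obtain ⟨P, Q, hne⟩ := not_subsingleton_iff_nontrivial.1 hns |>.exists_pair_ne
  have hn : Nat.card (Sylow 23 H) ≤ 484 := by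
    rcases n23_of ha hb hc with h | h <;> omega
  have hcP : ∀ P : Sylow 23 H, Nat.card (P : Subgroup H) = 23 ^ c := fun P =>
    card_sylow_of P hc (not_dvd_211 a b)
  have hidx : ∀ P Q : Sylow 23 H, P ≠ Q →
      ((Q : Subgroup H).subgroupOf (P : Subgroup H)).index = 23 := by
    intro P Q hne
    have h0 : (normalizer (Q : Set H)).subgroupOf (P : Subgroup H) =
        (Q : Subgroup H).subgroupOf (P : Subgroup H) := by
      have := P.2.inf_normalizer_sylow Q
      rw [← Subgroup.inf_subgroupOf_left, this, Subgroup.inf_subgroupOf_left]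
    have h1 : (normalizer (Q : Set H)).relIndex (P : Subgroup H) ≤ 484 := by
      refine le_trans ?_ hn
      rw [Q.card_eq_index_normalizer]
      rw [← Subgroup.relIndex_top_right]
      exact Subgroup.relIndex_le_of_le_right le_top (by rw [Subgroup.relIndex_top_right]; exact Subgroup.index_ne_zero_of_finite)
    rw [Subgroup.relIndex, h0] at h1
    have hd : ((Q : Subgroup H).subgroupOf (P : Subgroup H)).index ∣ 23 ^ c := by
      rw [← hcP P]; exact Subgroup.index_dvd_card _
    obtain ⟨k, hk, hk2⟩ := (Nat.dvd_prime_pow (by norm_num)).1 hd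
    rw [hk2] at h1
    rcases k with _ | _ | k
    · exfalso
      rw [pow_zero, Subgroup.index_eq_one, Subgroup.subgroupOf_eq_top] at hk2
      exact hne (Sylow.ext (P.is_maximal' Q.2 hk2).symm)
    · simpa using hk2
    · exfalso
      have : 23 ^ 2 ≤ 23 ^ (k + 1 + 1) := Nat.pow_le_pow_right (by norm_num) (by omega)
      omega
  have hc0 : c ≠ 0 := by
    rintro rfl
    have h1 := hidx P Q hne
    have h2 := Subgroup.index_dvd_card ((Q : Subgroup H).subgroupOf (P : Subgroup H))
    rw [h1, hcP] at h2
    norm_num at h2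
  have hle : ∀ P Q : Sylow 23 H, P ≠ Q →
      (P : Subgroup H) ≤ normalizer (((P : Subgroup H) ⊓ Q : Subgroup H) : Set H) := by
    intro P Q hne
    have hn : ((Q : Subgroup H).subgroupOf (P : Subgroup H)).Normal := by
      apply Subgroup.normal_of_index_eq_minFac_card
      rw [hidx P Q hne, hcP, Nat.Prime.pow_minFac (by norm_num) hc0]
    rw [← Subgroup.inf_subgroupOf_left] at hn
    exact (Subgroup.normal_subgroupOf_iff_le_normalizer inf_le_left).1 hn
  set D : Subgroup H := (P : Subgroup H) ⊓ Q with hD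
  have hPD : (P : Subgroup H) ≤ normalizer (D : Set H) := hle P Q hne
  have hQD : (Q : Subgroup H) ≤ normalizer (D : Set H) := by
    have := hle Q P hne.symm
    rwa [inf_comm] at this
  have hDc : Nat.card D * 23 = 23 ^ c := by
    have h1 := ((Q : Subgroup H).subgroupOf (P : Subgroup H)).card_mul_index
    rw [hidx P Q hne, hcP] at h1
    rw [← h1, ← Subgroup.inf_subgroupOf_left]
    congr 1
    exact (Nat.card_congr (Subgroup.subgroupOfEquivOfLe inf_le_left).toEquiv).symm
  set N := normalizer (D : Set H) with hN
  let D' : Subgroup N := D.subgroupOf N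
  have hD'c : Nat.card D' = Nat.card D :=
    Nat.card_congr (Subgroup.subgroupOfEquivOfLe (Subgroup.le_normalizer)).toEquiv
  haveI : D'.Normal := Subgroup.normal_in_normalizer
  have hL : Nat.card (N ⧸ D') * Nat.card D = Nat.card N := by
    rw [← hD'c]; exact (Subgroup.card_eq_card_quotient_mul_card_subgroup D').symm
  have hcN : Nat.card N ∣ Nat.card H := Subgroup.card_subgroup_dvd_card N
  have hPN : Nat.card (P : Subgroup H) ∣ Nat.card N := Subgroup.card_dvd_of_le hPD
  have hDpos : 0 < Nat.card D := Nat.card_pos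
  have h23 : 23 ∣ Nat.card (N ⧸ D') := by
    rw [hcP, ← hDc, ← hL, mul_comm] at hPN
    exact Nat.dvd_of_mul_dvd_mul_right hDpos hPN
  have hLd : Nat.card (N ⧸ D') ∣ 2 ^ a * 11 ^ b * 23 ^ 1 := by
    rw [← hL, hc, ← hDc] at hcN
    apply Nat.dvd_of_mul_dvd_mul_right hDpos
    convert hcN using 1
    ring
  obtain ⟨a', ha', b', hb', c', hc', hn'⟩ := dvd_form' hLd
  have hc1 : c' = 1 := by
    by_contra h
    obtain rfl : c' = 0 := by omega
    rw [hn', pow_zero, mul_one] at h23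
    exact not_dvd_211 _ _ h23
  rw [hc1, pow_one] at hn'
  have hsub := f1c1 (by omega) (by omega) hn'
  obtain ⟨S⟩ : Nonempty (Sylow 23 (N ⧸ D')) := inferInstance
  have hDp : IsPGroup 23 D := P.2.to_le inf_le_left
  let T : Subgroup N := (S : Subgroup (N ⧸ D')).comap (QuotientGroup.mk' D')
  have hT : IsPGroup 23 T := by
    apply IsPGroup.comap_of_ker_isPGroup S.2
    rw [QuotientGroup.ker_mk']
    exact hDp.of_equiv (Subgroup.subgroupOfEquivOfLe (Subgroup.le_normalizer)).symm
  have hleT : ∀ R : Sylow 23 H, (hR : (R : Subgroup H) ≤ N) → (R.subtype hR : Subgroup N) = T := by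
    intro R hR
    symm
    refine (R.subtype hR).3 hT ?_
    rw [← Subgroup.map_le_iff_le_comap]
    obtain ⟨S', hS'⟩ := IsPGroup.exists_le_sylow ((R.subtype hR).2.map (QuotientGroup.mk' D'))
    rwa [Subsingleton.elim S' S] at hS'
  apply hne
  apply Sylow.subtype_injective (hP := hPD) (hQ := hQD)
  apply Sylow.ext
  rw [hleT P hPD, hleT Q hQD]

end OD

namespace OD
open Subgroup MulAction

section conj
variable {G : Type*} [Group G]

/-- conjugate of a subgroup -/
def cj (g : G) (V : Subgroup G) : Subgroup G := V.map (MulAut.conj g).toMonoidHom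

theorem mem_cj {g x : G} {V : Subgroup G} : x ∈ cj g V ↔ g⁻¹ * x * g ∈ V := by
  unfold cj
  rw [Subgroup.mem_map]
  constructor
  · rintro ⟨y, hy, rfl⟩
    simpa [mul_assoc] using hy
  · intro h
    exact ⟨_, h, by simp [mul_assoc]⟩

theorem mem_cj' {g x : G} {V : Subgroup G} (h : x ∈ V) : g * x * g⁻¹ ∈ cj g V := by
  rw [mem_cj]; simpa [mul_assoc] using h

theorem cj_one (V : Subgroup G) : cj 1 V = V := by ext; simp [mem_cj]

theorem cj_mul (g h : G) (V : Subgroup G) : cj (g * h) V = cj g (cj h V) := by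
  ext; simp [mem_cj, mul_assoc]

theorem cj_inv_cj (g : G) (V : Subgroup G) : cj g⁻¹ (cj g V) = V := by
  rw [← cj_mul, inv_mul_cancel, cj_one]

theorem cj_cj_inv (g : G) (V : Subgroup G) : cj g (cj g⁻¹ V) = V := by
  rw [← cj_mul, mul_inv_cancel, cj_one]

theorem cj_mono {g : G} {V W : Subgroup G} (h : V ≤ W) : cj g V ≤ cj g W := Subgroup.map_mono h

theorem cj_le_iff {g : G} {V W : Subgroup G} : cj g V ≤ cj g W ↔ V ≤ W := by
  refine ⟨fun h => ?_, cj_mono⟩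
  have := cj_mono (g := g⁻¹) h
  rwa [cj_inv_cj, cj_inv_cj] at this

theorem cj_inj {g : G} {V W : Subgroup G} : cj g V = cj g W ↔ V = W := by
  refine ⟨fun h => ?_, fun h => by rw [h]⟩
  have := congrArg (cj g⁻¹) h
  rwa [cj_inv_cj, cj_inv_cj] at this

theorem cj_inf (g : G) (V W : Subgroup G) : cj g (V ⊓ W) = cj g V ⊓ cj g W := by
  ext; simp [mem_cj]

theorem card_cj (g : G) (V : Subgroup G) : Nat.card (cj g V) = Nat.card V :=
  (Nat.card_congr (V.equivMapOfInjective _ (MulAut.conj g).injective).toEquiv).symm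

theorem cj_eq_self {g : G} {V : Subgroup G} : cj g V = V ↔ g ∈ normalizer (V : Set G) := by
  rw [Subgroup.mem_normalizer_iff'']
  constructor
  · intro h x
    constructor
    · intro hx
      rw [← h] at hx
      exact mem_cj.1 hx
    · intro hx
      rw [← h]
      exact mem_cj.2 hx
  · intro h
    ext x
    rw [mem_cj]
    exact (h x).symm

theorem cj_eq_self_of_mem {g : G} {V : Subgroup G} (h : g ∈ V) : cj g V = V :=
  cj_eq_self.2 (Subgroup.le_normalizer h)

theorem coe_smul_sylow {p : ℕ} (g : G) (P : Sylow p G) : ((g • P : Sylow p G) : Subgroup G) = cj g P := rfl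

/-- center of a subgroup, as subgroup of `G` -/
def Zs (P : Subgroup G) : Subgroup G := P ⊓ centralizer (P : Set G)

theorem mem_Zs {P : Subgroup G} {x : G} : x ∈ Zs P ↔ x ∈ P ∧ ∀ y ∈ P, y * x = x * y := by
  unfold Zs
  rw [Subgroup.mem_inf, Subgroup.mem_centralizer_iff]
  rfl

theorem Zs_le (P : Subgroup G) : Zs P ≤ P := inf_le_left

theorem Zs_cj (g : G) (P : Subgroup G) : Zs (cj g P) = cj g (Zs P) := by
  ext x
  rw [mem_cj, mem_Zs, mem_Zs, mem_cj]
  refine and_congr_right fun _ => ?_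
  constructor
  · intro h y hy
    have := h _ (mem_cj' (g := g) hy)
    calc y * (g⁻¹ * x * g) = g⁻¹ * ((g * y * g⁻¹) * x) * g := by group
      _ = g⁻¹ * (x * (g * y * g⁻¹)) * g := by rw [this]
      _ = _ := by group
  · intro h y hy
    have := h _ (mem_cj.1 hy)
    calc y * x = g * ((g⁻¹ * y * g) * (g⁻¹ * x * g)) * g⁻¹ := by group
      _ = g * ((g⁻¹ * x * g) * (g⁻¹ * y * g)) * g⁻¹ := by rw [this]
      _ = _ := by group

theorem normalizer_le_Zs (P : Subgroup G) : normalizer (P : Set G) ≤ normalizer (Zs P : Set G) := by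
  intro g hg
  rw [← cj_eq_self] at hg ⊢
  rw [← Zs_cj, hg]

theorem card_Zs (P : Subgroup G) : Nat.card (Zs P) = Nat.card (center P) := by
  have : (center P).map P.subtype = Zs P := by
    ext x
    rw [mem_Zs, Subgroup.mem_map]
    constructor
    · rintro ⟨y, hy, rfl⟩
      refine ⟨y.2, fun z hz => ?_⟩
      exact congrArg Subtype.val (Subgroup.mem_center_iff.1 hy ⟨z, hz⟩)
    · rintro ⟨hx, h⟩
      refine ⟨⟨x, hx⟩, Subgroup.mem_center_iff.2 fun z => ?_, rfl⟩
      exact Subtype.ext (h z z.2)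
  rw [← this]
  exact (Nat.card_congr ((center P).equivMapOfInjective _ P.subtype_injective).toEquiv).symm

end conj

section tools
variable {G : Type*} [Group G] [Finite G]

theorem orbit_ncard {p : ℕ} [Fact p.Prime] {X : Subgroup G} (hX : IsPGroup p X) (Q : Sylow p G) :
    (orbit X Q).ncard = (Q : Subgroup G).relIndex X := by
  rw [← MulAction.index_stabilizer, Subgroup.relIndex]
  congr 1
  ext x
  rw [MulAction.mem_stabilizer_iff, Subgroup.mem_subgroupOf]
  have h1 : x • Q = Q ↔ (x : G) ∈ normalizer (Q : Set G) := Sylow.smul_eq_iff_mem_normalizer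
  rw [h1]
  have h2 := hX.inf_normalizer_sylow Q
  have h3 := SetLike.ext_iff.1 h2 (x : G)
  simp only [Subgroup.mem_inf, x.2, true_and] at h3
  exact h3

theorem dvd_of_orbits {X α : Type*} [Group X] [MulAction X α] [Finite α] (T : Set α)
    (hT : ∀ x : X, ∀ a ∈ T, x • a ∈ T) (m : ℕ) (hm : ∀ a ∈ T, m ∣ (orbit X a).ncard) :
    m ∣ T.ncard := by
  classical
  haveI := Fintype.ofFinite α
  letI : Fintype (Quotient (orbitRel X α)) := Fintype.ofFinite _
  rw [Set.ncard_eq_toFinset_card' T]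
  rw [Finset.card_eq_sum_card_fiberwise (s := T.toFinset) (t := Finset.univ)
    (f := fun a => (Quotient.mk (orbitRel X α) a)) (by intro x hx; simp)]
  apply Finset.dvd_sum
  intro b _
  by_cases h : ∃ a ∈ T, Quotient.mk (orbitRel X α) a = b
  · obtain ⟨a, ha, rfl⟩ := h
    have : (T.toFinset.filter fun a' => Quotient.mk (orbitRel X α) a' = Quotient.mk (orbitRel X α) a)
        = (orbit X a).toFinset := by
      ext c
      simp only [Finset.mem_filter, Set.mem_toFinset]
      rw [Quotient.eq]
      constructor
      · exact fun h => h.2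
      · intro h
        refine ⟨?_, h⟩
        obtain ⟨x, rfl⟩ := h
        exact hT x a ha
    rw [this, ← Set.ncard_eq_toFinset_card']
    exact hm a ha
  · have : (T.toFinset.filter fun a' => Quotient.mk (orbitRel X α) a' = b) = ∅ := by
      rw [Finset.filter_eq_empty_iff]
      intro a ha hab
      exact h ⟨a, Set.mem_toFinset.1 ha, hab⟩
    rw [this]; simp

/-- packing lemma -/
theorem packing {ι : Type*} [Finite ι] (A : ι → Subgroup G) (V D : Subgroup G) (a : ℕ)
    (hA : ∀ i, Nat.card (A i) = a) (hAV : ∀ i, A i ≤ V) (hDA : ∀ i, D ≤ A i)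
    (hD : ∀ i j, i ≠ j → A i ⊓ A j ≤ D) (hDV : D ≤ V) :
    Nat.card ι * (a - Nat.card D) ≤ Nat.card V - Nat.card D ∧
    (Nat.card ι * (a - Nat.card D) = Nat.card V - Nat.card D → ∀ v ∈ V, v ∉ D → ∃ i, v ∈ A i) := by
  classical
  haveI := Fintype.ofFinite ι
  haveI := Fintype.ofFinite G
  have hdiff : ∀ H : Subgroup G, D ≤ H → ((H : Set G) \ (D : Set G)).ncard = Nat.card H - Nat.card D := by
    intro H hH
    rw [Set.ncard_diff hH (Set.toFinite _)]
    rfl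
  have hU : (⋃ i, ((A i : Set G) \ (D : Set G))).ncard = Nat.card ι * (a - Nat.card D) := by
    rw [Set.ncard_eq_toFinset_card']
    have : (⋃ i, ((A i : Set G) \ (D : Set G))).toFinset =
      Finset.univ.biUnion (fun i => ((A i : Set G) \ (D : Set G)).toFinset) := by
      ext x; simp
    rw [this, Finset.card_biUnion]
    · rw [Finset.sum_congr rfl (g := fun _ => a - Nat.card D)]
      · simp [Nat.card_eq_fintype_card]
      · intro i _
        rw [← Set.ncard_eq_toFinset_card', hdiff _ (hDA i), hA]
    · intro i _ j _ hij
      rw [Function.onFun, Finset.disjoint_left]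
      intro x hx hy
      simp only [Set.mem_toFinset] at hx hy
      exact hx.2 (hD i j hij ⟨hx.1, hy.1⟩)
  have hsub : (⋃ i, ((A i : Set G) \ (D : Set G))) ⊆ (V : Set G) \ (D : Set G) := by
    intro x hx
    obtain ⟨i, hi⟩ := Set.mem_iUnion.1 hx
    exact ⟨hAV i hi.1, hi.2⟩
  rw [← hU, ← hdiff V hDV]
  refine ⟨Set.ncard_le_ncard hsub (Set.toFinite _), ?_⟩
  intro heq v hv hvD
  have := Set.eq_of_subset_of_ncard_le hsub heq.ge (Set.toFinite _)
  have hv2 : v ∈ (V : Set G) \ (D : Set G) := ⟨hv, hvD⟩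
  rw [← this] at hv2
  obtain ⟨i, hi⟩ := Set.mem_iUnion.1 hv2
  exact ⟨i, hi.1⟩

end tools

/-- The hypotheses we really use. -/
structure Hyp (G : Type*) [Group G] : Prop where
  card : Nat.card G = 2 ^ 5 * 3 * 7 * 11 ^ 2 * 23 ^ 3 * 79
  n3 : ¬ primeGraphAdj G 23 3
  n7 : ¬ primeGraphAdj G 23 7
  n79 : ¬ primeGraphAdj G 23 79
  a2 : primeGraphAdj G 23 2
  n792 : ¬ primeGraphAdj G 79 2
  n7911 : ¬ primeGraphAdj G 79 11
  lemN : ∀ M : Subgroup G, M.Normal → Nat.Coprime M.index 1659 → M = ⊤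

theorem dvd_form79 {d : ℕ} {a b c e f : ℕ} (h : d ∣ 2 ^ a * 3 ^ b * 7 ^ c * 11 ^ e * 79 ^ f) :
    ∃ a' ≤ a, ∃ b' ≤ b, ∃ c' ≤ c, ∃ e' ≤ e, ∃ f' ≤ f,
      d = 2 ^ a' * 3 ^ b' * 7 ^ c' * 11 ^ e' * 79 ^ f' := by
  obtain ⟨x, y, hx, hy, rfl⟩ := (Nat.dvd_mul).1 h
  obtain ⟨x1, z, hx1, hz, rfl⟩ := (Nat.dvd_mul).1 hx
  obtain ⟨x2, w, hx2, hw, rfl⟩ := (Nat.dvd_mul).1 hx1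
  obtain ⟨x3, v, hx3, hv, rfl⟩ := (Nat.dvd_mul).1 hx2
  obtain ⟨a', ha, rfl⟩ := (Nat.dvd_prime_pow (by norm_num)).1 hx3
  obtain ⟨b', hb, rfl⟩ := (Nat.dvd_prime_pow (by norm_num)).1 hv
  obtain ⟨c', hc, rfl⟩ := (Nat.dvd_prime_pow (by norm_num)).1 hw
  obtain ⟨d', hd, rfl⟩ := (Nat.dvd_prime_pow (by norm_num)).1 hz
  obtain ⟨e', he, rfl⟩ := (Nat.dvd_prime_pow (by norm_num)).1 hy
  exact ⟨a', ha, b', hb, c', hc, d', hd, e', he, rfl⟩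

theorem num3 : ∀ (a : Fin 6) (b : Fin 2) (c : Fin 2) (e : Fin 3) (f : Fin 2),
    (2 ^ a.1 * 3 ^ b.1 * 7 ^ c.1 * 11 ^ e.1 * 79 ^ f.1) % 12167 = 1 →
    2 ^ a.1 * 3 ^ b.1 * 7 ^ c.1 * 11 ^ e.1 * 79 ^ f.1 = 1 := by
  decide +kernel

theorem num4 : ∀ (a : Fin 6) (e : Fin 3),
    (2 ^ a.1 * 3 * 7 * 11 ^ e.1 * 79) % 23 = 1 →
    2 ^ a.1 * 3 * 7 * 11 ^ e.1 * 79 = 13272 ∨ 2 ^ a.1 * 3 * 7 * 11 ^ e.1 * 79 = 6423648 := by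
  decide +kernel

section main
variable {G : Type*} [Group G] [Finite G]

theorem cent_card (h : Hyp G) {x : G} (hx : 23 ∣ orderOf x) :
    Nat.card (centralizer {x}) ∣ 2 ^ 5 * 11 ^ 2 * 23 ^ 3 := by
  have hco : ∀ r : ℕ, r.Prime → 23 ≠ r → ¬ primeGraphAdj G 23 r →
      Nat.Coprime (Nat.card (centralizer {x})) r := by
    intro r hr h23 hn
    rw [Nat.coprime_comm, hr.coprime_iff_not_dvd]
    intro hd
    haveI : Fact r.Prime := ⟨hr⟩
    obtain ⟨g, hg⟩ := exists_prime_orderOf_dvd_card' r hd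
    apply hn
    refine adj_of_commute (by norm_num) hr h23 (a := x) (g := (g : G)) hx
      (by rw [Subgroup.orderOf_coe, hg]) ?_
    exact (Subgroup.mem_centralizer_singleton_iff.1 g.2).symm
  have h3 := hco 3 (by norm_num) (by norm_num) h.n3
  have h7 := hco 7 (by norm_num) (by norm_num) h.n7
  have h79 := hco 79 (by norm_num) (by norm_num) h.n79
  have hd := Subgroup.card_subgroup_dvd_card (centralizer {x})
  rw [h.card] at hd
  have e : 2 ^ 5 * 3 * 7 * 11 ^ 2 * 23 ^ 3 * 79 = (2 ^ 5 * 11 ^ 2 * 23 ^ 3) * 3 * 7 * 79 := by norm_num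
  rw [e] at hd
  exact h3.dvd_of_dvd_mul_right (h7.dvd_of_dvd_mul_right (h79.dvd_of_dvd_mul_right hd))

theorem cent_unique (h : Hyp G) {x : G} (hx : 23 ∣ orderOf x) : Subsingleton (Sylow 23 (centralizer {x})) :=
  f1 (cent_card h hx)

theorem Zs_inj (h : Hyp G) {P Q : Sylow 23 G} {x : G} (hP : x ∈ Zs (P : Subgroup G)) (hQ : x ∈ Zs (Q : Subgroup G))
    (hx : x ≠ 1) : P = Q := by
  have h23 : 23 ∣ orderOf x := dvd_orderOf_of_pgroup P.2 hP.1 hx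
  haveI := cent_unique h h23
  have hle : ∀ P : Sylow 23 G, x ∈ Zs (P : Subgroup G) → (P : Subgroup G) ≤ centralizer {x} := by
    intro P hP y hy
    rw [Subgroup.mem_centralizer_singleton_iff]
    exact (mem_Zs.1 hP).2 y hy
  exact Sylow.subtype_injective (hP := hle P hP) (hQ := hle Q hQ) (Subsingleton.elim _ _)

theorem cardP (h : Hyp G) (P : Sylow 23 G) : Nat.card (P : Subgroup G) = 23 ^ 3 :=
  card_sylow_of P (m := 2 ^ 5 * 3 * 7 * 11 ^ 2 * 79) (by rw [h.card]; norm_num) (by norm_num)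

theorem n23_dvd (h : Hyp G) : Nat.card (Sylow 23 G) ∣ 2 ^ 5 * 3 ^ 1 * 7 ^ 1 * 11 ^ 2 * 79 ^ 1 := by
  obtain ⟨P⟩ : Nonempty (Sylow 23 G) := inferInstance
  refine P.card_dvd_index.trans ?_
  have h1 := (P : Subgroup G).card_mul_index
  rw [cardP h, h.card] at h1
  have : (P : Subgroup G).index = 2 ^ 5 * 3 ^ 1 * 7 ^ 1 * 11 ^ 2 * 79 ^ 1 := by omega
  rw [this]

theorem nonabelian (h : Hyp G) (P : Sylow 23 G) : ¬ (Zs (P : Subgroup G) = P) := by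
  intro hab
  have habQ : ∀ Q : Sylow 23 G, Zs (Q : Subgroup G) = Q := by
    intro Q
    obtain ⟨g, rfl⟩ := MulAction.exists_smul_eq G P Q
    rw [coe_smul_sylow, Zs_cj, hab]
  have hdvd : 23 ^ 3 ∣ ({Q | Q ≠ P} : Set (Sylow 23 G)).ncard := by
    apply dvd_of_orbits (X := P)
    · intro x Q hQ hxQ
      apply hQ
      have : x⁻¹ • (x • Q) = x⁻¹ • P := by rw [hxQ]
      rw [inv_smul_smul] at this
      rw [this]
      apply Sylow.smul_eq_iff_mem_normalizer.2
      exact Subgroup.le_normalizer (x⁻¹).2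
    · intro Q hQ
      have := orbit_ncard P.2 Q
      erw [this]
      have hb : (Q : Subgroup G).subgroupOf P = ⊥ := by
        rw [Subgroup.subgroupOf_eq_bot, disjoint_iff, eq_bot_iff]
        intro x hx
        by_contra hx1
        exact hQ (Zs_inj h (by rw [habQ]; exact hx.1) (by rw [habQ]; exact hx.2) hx1)
      rw [Subgroup.relIndex, hb, Subgroup.index_bot, cardP h]
  have hn : Nat.card (Sylow 23 G) = ({Q | Q ≠ P} : Set (Sylow 23 G)).ncard + 1 := by
    have h1 := Set.ncard_add_ncard_compl ({P} : Set (Sylow 23 G))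
    rw [Set.ncard_singleton] at h1
    rw [← h1, add_comm]; rfl
  obtain ⟨a', ha', b', hb', c', hc', e', he', f', hf', hn'⟩ := dvd_form79 (n23_dvd h)
  have hmod : Nat.card (Sylow 23 G) % 12167 = 1 := by
    obtain ⟨k, hk⟩ := hdvd
    rw [hn, hk]; omega
  rw [hn'] at hmod
  have h1 := num3 ⟨a', by omega⟩ ⟨b', by omega⟩ ⟨c', by omega⟩ ⟨e', by omega⟩ ⟨f', by omega⟩ hmod
  simp only at h1
  rw [h1] at hn'
  haveI : Subsingleton (Sylow 23 G) := (Nat.card_eq_one_iff_unique.1 hn').1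
  have hPn : (P : Subgroup G).Normal := P.normal_of_subsingleton
  apply h.n3
  refine adj_of_normalizes (by norm_num) (by norm_num) P.2 (N := ⊤) ?_ ?_ ?_
  · exact (Subgroup.normalizer_eq_top _).ge
  · rw [Subgroup.card_top, h.card]; norm_num
  · rw [cardP h]; decide

theorem cardZs (h : Hyp G) (P : Sylow 23 G) : Nat.card (Zs (P : Subgroup G)) = 23 := by
  obtain ⟨k, hk0, hk⟩ := IsPGroup.card_center_eq_prime_pow (p := 23) (cardP h P) (by norm_num)
  rw [card_Zs, hk]
  have hd : 23 ^ k ∣ 23 ^ 3 := by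
    rw [← hk, ← cardP h P]; exact Subgroup.card_subgroup_dvd_card _
  have hk3 := (Nat.pow_dvd_pow_iff_le_right (by norm_num)).1 hd
  have hnt : ¬ ∀ a b : (P : Subgroup G), a * b = b * a := by
    intro hc
    apply nonabelian h P
    apply le_antisymm (Zs_le _)
    intro x hx
    rw [mem_Zs]
    exact ⟨hx, fun y hy => congrArg Subtype.val (hc ⟨y, hy⟩ ⟨x, hx⟩)⟩
  interval_cases k
  · norm_num
  · exfalso
    apply hnt
    have hidx := (center (P : Subgroup G)).card_mul_index
    rw [hk, cardP h] at hidx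
    have h23 : Nat.card ((P : Subgroup G) ⧸ center (P : Subgroup G)) = 23 := by
      change (center (P : Subgroup G)).index = 23
      omega
    haveI := isCyclic_of_prime_card h23
    exact commutative_of_cyclic_center_quotient (QuotientGroup.mk' (center (P : Subgroup G)))
      (by rw [QuotientGroup.ker_mk'])
  · exfalso
    apply hnt
    have : center (P : Subgroup G) = ⊤ := Subgroup.eq_top_of_card_eq _ (by rw [hk, cardP h])
    intro a b
    have hb : b ∈ center (P : Subgroup G) := by rw [this]; trivial
    exact Subgroup.mem_center_iff.1 hb a

theorem n23_cases (h : Hyp G) : Nat.card (Sylow 23 G) = 13272 ∨ Nat.card (Sylow 23 G) = 6423648 := by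
  obtain ⟨P⟩ : Nonempty (Sylow 23 G) := inferInstance
  have hnd : ∀ r : ℕ, r.Prime → 23 ≠ r → ¬ primeGraphAdj G 23 r → ¬ (23 ≡ 1 [MOD r]) →
      ¬ r ∣ Nat.card (normalizer (P : Set G)) := by
    intro r hr h23 hn h1 hd
    exact hn (adj_of_normalizes hr h23 (P.2.to_le (Zs_le _)) (normalizer_le_Zs _) hd
      (by rw [cardZs h]; exact h1))
  have hmul := (normalizer (P : Set G)).card_mul_index
  rw [← P.card_eq_index_normalizer, h.card] at hmul
  have hdv : ∀ r : ℕ, r.Prime → 23 ≠ r → ¬ primeGraphAdj G 23 r → ¬ (23 ≡ 1 [MOD r]) →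
      r ∣ 2 ^ 5 * 3 * 7 * 11 ^ 2 * 23 ^ 3 * 79 → r ∣ Nat.card (Sylow 23 G) := by
    intro r hr h23 hn h1 hd
    rw [← hmul] at hd
    exact (hr.dvd_mul.1 hd).resolve_left (hnd r hr h23 hn h1)
  have d3 := hdv 3 (by norm_num) (by norm_num) h.n3 (by decide) (by norm_num)
  have d7 := hdv 7 (by norm_num) (by norm_num) h.n7 (by decide) (by norm_num)
  have d79 := hdv 79 (by norm_num) (by norm_num) h.n79 (by decide) (by norm_num)
  obtain ⟨a', ha', b', hb', c', hc', e', he', f', hf', hn'⟩ := dvd_form79 (n23_dvd h)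
  have hcop : ∀ r s k : ℕ, r.Prime → s.Prime → r ≠ s → ¬ r ∣ s ^ k := by
    intro r s k hr hs hne hd
    exact hne ((Nat.prime_dvd_prime_iff_eq hr hs).1 (hr.dvd_of_dvd_pow hd))
  have p3 : Nat.Prime 3 := by norm_num
  have p7 : Nat.Prime 7 := by norm_num
  have p79 : Nat.Prime 79 := by norm_num
  have p2 : Nat.Prime 2 := by norm_num
  have p11 : Nat.Prime 11 := by norm_num
  have hb1 : b' = 1 := by
    by_contra hb
    obtain rfl : b' = 0 := by omega
    rw [hn', p3.dvd_mul, p3.dvd_mul, p3.dvd_mul, p3.dvd_mul] at d3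
    rcases d3 with (((d | d) | d) | d) | d
    · exact hcop 3 2 _ p3 p2 (by norm_num) d
    · norm_num at d
    · exact hcop 3 7 _ p3 p7 (by norm_num) d
    · exact hcop 3 11 _ p3 p11 (by norm_num) d
    · exact hcop 3 79 _ p3 p79 (by norm_num) d
  have hc1 : c' = 1 := by
    by_contra hb
    obtain rfl : c' = 0 := by omega
    rw [hn', p7.dvd_mul, p7.dvd_mul, p7.dvd_mul, p7.dvd_mul] at d7
    rcases d7 with (((d | d) | d) | d) | d
    · exact hcop 7 2 _ p7 p2 (by norm_num) d
    · exact hcop 7 3 _ p7 p3 (by norm_num) d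
    · norm_num at d
    · exact hcop 7 11 _ p7 p11 (by norm_num) d
    · exact hcop 7 79 _ p7 p79 (by norm_num) d
  have hf1 : f' = 1 := by
    by_contra hb
    obtain rfl : f' = 0 := by omega
    rw [hn', p79.dvd_mul, p79.dvd_mul, p79.dvd_mul, p79.dvd_mul] at d79
    rcases d79 with (((d | d) | d) | d) | d
    · exact hcop 79 2 _ p79 p2 (by norm_num) d
    · exact hcop 79 3 _ p79 p3 (by norm_num) d
    · exact hcop 79 7 _ p79 p7 (by norm_num) d
    · exact hcop 79 11 _ p79 p11 (by norm_num) d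
    · norm_num at d
  rw [hb1, hc1, hf1, pow_one, pow_one, pow_one] at hn'
  have h1 : Nat.card (Sylow 23 G) % 23 = 1 := card_sylow_modEq_one 23 G
  rw [hn'] at h1 ⊢
  exact num4 ⟨a', by omega⟩ ⟨e', by omega⟩ h1

end main
end OD

namespace OD
open Subgroup MulAction

theorem quot_unique {H : Type*} [Group H] [Finite H] (D : Subgroup H) (hDp : IsPGroup 23 D)
    (P Q : Sylow 23 H) (hPD : (P : Subgroup H) ≤ normalizer (D : Set H))
    (hQD : (Q : Subgroup H) ≤ normalizer (D : Set H))
    [Subsingleton (Sylow 23 (normalizer (D : Set H) ⧸ D.subgroupOf (normalizer (D : Set H))))] :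
    P = Q := by
  set N := normalizer (D : Set H) with hN
  let D' : Subgroup N := D.subgroupOf N
  haveI : D'.Normal := Subgroup.normal_in_normalizer
  obtain ⟨S⟩ : Nonempty (Sylow 23 (N ⧸ D')) := inferInstance
  let T : Subgroup N := (S : Subgroup (N ⧸ D')).comap (QuotientGroup.mk' D')
  have hT : IsPGroup 23 T := by
    apply IsPGroup.comap_of_ker_isPGroup S.2
    rw [QuotientGroup.ker_mk']
    exact hDp.of_equiv (Subgroup.subgroupOfEquivOfLe (Subgroup.le_normalizer)).symm
  have hleT : ∀ R : Sylow 23 H, (hR : (R : Subgroup H) ≤ N) → (R.subtype hR : Subgroup N) = T := by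
    intro R hR
    symm
    refine (R.subtype hR).3 hT ?_
    rw [← Subgroup.map_le_iff_le_comap]
    obtain ⟨S', hS'⟩ := IsPGroup.exists_le_sylow ((R.subtype hR).2.map (QuotientGroup.mk' D'))
    rwa [Subsingleton.elim S' S] at hS'
  apply Sylow.subtype_injective (hP := hPD) (hQ := hQD)
  apply Sylow.ext
  rw [hleT P hPD, hleT Q hQD]

theorem relIndex_mul {G : Type*} [Group G] (Q X : Subgroup G) :
    Q.relIndex X * Nat.card (X ⊓ Q : Subgroup G) = Nat.card X := by
  have h1 := (Q.subgroupOf X).card_mul_index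
  rw [← h1, mul_comm, Subgroup.relIndex, ← Subgroup.inf_subgroupOf_left]
  congr 1
  exact (Nat.card_congr (Subgroup.subgroupOfEquivOfLe inf_le_left).toEquiv).symm

theorem group552 {K : Type*} [Group K] [Finite K] (hK : Nat.card K = 552) :
    Subsingleton (Sylow 23 K) := by
  classical
  by_contra hns
  have hc : ∀ S : Sylow 23 K, Nat.card (S : Subgroup K) = 23 := by
    intro S
    have := card_sylow_of S (m := 24) (n := 1) (by rw [hK]; norm_num) (by norm_num)
    simpa using this
  obtain ⟨S, S', hne⟩ := not_subsingleton_iff_nontrivial.1 hns |>.exists_pair_ne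
  have hn : Nat.card (Sylow 23 K) = 24 := by
    have h1 : Nat.card (Sylow 23 K) % 23 = 1 := card_sylow_modEq_one 23 K
    have h2 : Nat.card (Sylow 23 K) ∣ 24 := by
      refine S.card_dvd_index.trans ?_
      have := (S : Subgroup K).card_mul_index
      rw [hc, hK] at this
      have : (S : Subgroup K).index = 24 := by omega
      rw [this]
    have h3 : Nat.card (Sylow 23 K) ≠ 1 := by
      intro h
      exact hns (Nat.card_eq_one_iff_unique.1 h).1
    have h4 : Nat.card (Sylow 23 K) ≤ 24 := Nat.le_of_dvd (by norm_num) h2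
    omega
  have hself : normalizer (S : Set K) = S := by
    symm
    apply Subgroup.eq_of_le_of_card_ge Subgroup.le_normalizer
    have h1 := S.card_eq_index_normalizer
    have h2 := (normalizer (S : Set K)).card_mul_index
    rw [← h1, hn, hK] at h2
    rw [hc S]; change Nat.card (normalizer (S : Set K)) ≤ 23; omega
  -- conj action on elements of order r
  have hr : ∀ r : ℕ, r.Prime → r ∣ 24 → 23 ≤ ({x : K | orderOf x = r}).ncard := by
    intro r hrp hr24
    haveI : Fact r.Prime := ⟨hrp⟩
    obtain ⟨t, ht⟩ := exists_prime_orderOf_dvd_card' (G := K) r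
      (by rw [hK]; exact hr24.trans (by norm_num))
    have hr23 : r ≠ 23 := by rintro rfl; norm_num at hr24
    let act : MulAction S K := 
      { smul := fun s x => s * x * (s : K)⁻¹
        one_smul := fun x => by change (1:K) * x * 1⁻¹ = x; simp
        mul_smul := fun s s' x => by
          change ((s:K) * s') * x * ((s:K)*s')⁻¹ = s * (s' * x * (s':K)⁻¹) * (s:K)⁻¹; group }
    have hd : 23 ∣ ({x : K | orderOf x = r}).ncard := by
      apply dvd_of_orbits (X := S)
      · intro s x hx
        change orderOf ((s:K) * x * (s:K)⁻¹) = r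
        rw [← MulAut.conj_apply, MulEquiv.orderOf_eq]; exact hx
      · intro x hx
        rw [← MulAction.index_stabilizer]
        have : stabilizer S x = ⊥ := by
          by_contra hb
          have htop : stabilizer S x = ⊤ := by
            have hpr : Nat.Prime (Nat.card S) := by
              have := hc S; change Nat.card S = 23 at this; rw [this]; norm_num
            rcases (Nat.dvd_prime hpr).1 (Subgroup.card_subgroup_dvd_card (stabilizer S x)) with h1 | h1
            · exact absurd (Subgroup.card_eq_one.1 h1) hb
            · exact Subgroup.eq_top_of_card_eq _ h1
          have hxS : x ∈ (S : Subgroup K) := by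
            have : x ∈ normalizer (S : Set K) := by
              refine (Subgroup.centralizer_le_normalizer _) ?_
              rw [Subgroup.mem_centralizer_iff]
              intro s hs
              have h1 : (⟨s, hs⟩ : S) ∈ stabilizer S x := by rw [htop]; trivial
              have h2 : s * x * s⁻¹ = x := h1
              exact mul_inv_eq_iff_eq_mul.1 h2
            rw [hself] at this; exact this
          have h3 := orderOf_dvd_natCard (⟨x, hxS⟩ : (S : Subgroup K))
          rw [hc, Subgroup.orderOf_mk] at h3
          rw [Set.mem_setOf_eq] at hx
          rw [hx] at h3
          exact hr23 ((Nat.prime_dvd_prime_iff_eq hrp (by norm_num)).1 h3)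
        rw [this, Subgroup.index_bot]
        exact (hc S).symm.dvd
    refine Nat.le_of_dvd ?_ hd
    rw [Set.ncard_pos]
    exact ⟨t, ht⟩
  have h2 := hr 2 (by norm_num) (by norm_num)
  have h3 := hr 3 (by norm_num) (by norm_num)
  have h23 : 24 * 22 ≤ ({x : K | orderOf x = 23}).ncard := by
    haveI := Fintype.ofFinite (Sylow 23 K)
    haveI := Fintype.ofFinite K
    have hsub : (Finset.univ.biUnion fun Q : Sylow 23 K => ((Q : Set K) \ {1}).toFinset) ⊆
        ({x : K | orderOf x = 23}).toFinset := by
      intro x hx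
      simp only [Finset.mem_biUnion, Finset.mem_univ, true_and, Set.mem_toFinset] at hx
      obtain ⟨Q, hxQ, hx1⟩ := hx
      rw [Set.mem_toFinset, Set.mem_setOf_eq]
      have h3 := orderOf_dvd_natCard (⟨x, hxQ⟩ : (Q : Subgroup K))
      rw [hc, Subgroup.orderOf_mk] at h3
      rcases (Nat.dvd_prime (by norm_num)).1 h3 with h | h
      · exact absurd (orderOf_eq_one_iff.1 h) hx1
      · exact h
    rw [Set.ncard_eq_toFinset_card']
    refine le_trans (le_of_eq ?_) (Finset.card_le_card hsub)
    rw [Finset.card_biUnion]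
    · rw [Finset.sum_congr rfl (g := fun _ => 22)]
      · simp [← Nat.card_eq_fintype_card, hn]
      · intro Q _
        rw [← Set.ncard_eq_toFinset_card', Set.ncard_diff_singleton_of_mem (one_mem Q)]
        have := hc Q
        change Nat.card Q - 1 = 22
        change Nat.card Q = 23 at this
        omega
    · intro Q _ Q' _ hij
      rw [Function.onFun, Finset.disjoint_left]
      intro x hx hy
      simp only [Set.mem_toFinset] at hx hy
      have hxb : x ∈ ((Q : Subgroup K) ⊓ Q' : Subgroup K) := ⟨hx.1, hy.1⟩
      have hd : Nat.card ((Q : Subgroup K) ⊓ Q' : Subgroup K) ∣ 23 := by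
        exact (Subgroup.card_dvd_of_le inf_le_left).trans (hc Q).dvd
      rcases (Nat.dvd_prime (by norm_num)).1 hd with h | h
      · rw [Subgroup.card_eq_one] at h
        rw [h] at hxb
        exact hx.2 hxb
      · apply hij
        apply Sylow.ext
        have e1 := Subgroup.eq_of_le_of_card_ge (inf_le_left : (Q : Subgroup K) ⊓ Q' ≤ Q) (by rw [h, hc])
        have e2 := Subgroup.eq_of_le_of_card_ge (inf_le_right : (Q : Subgroup K) ⊓ Q' ≤ Q') (by rw [h, hc])
        rw [← e1]; exact e2
  have hu : ({x : K | orderOf x = 23} ∪ ({x : K | orderOf x = 2} ∪ {x : K | orderOf x = 3})).ncard ≤ 552 := by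
    rw [← hK, ← Set.ncard_univ]
    exact Set.ncard_le_ncard (Set.subset_univ _)
  rw [Set.ncard_union_eq, Set.ncard_union_eq] at hu
  · omega
  · rw [Set.disjoint_left]; intro x hx hy; simp only [Set.mem_setOf_eq] at hx hy; omega
  · rw [Set.disjoint_left]; intro x hx hy; simp only [Set.mem_setOf_eq, Set.mem_union] at hx hy; omega

section main
variable {G : Type*} [Group G] [Finite G]

theorem card_pow (h : Hyp G) {P : Sylow 23 G} {X : Subgroup G} (hX : X ≤ P) : ∃ k ≤ 3, Nat.card X = 23 ^ k := by
  have := Subgroup.card_dvd_of_le hX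
  rw [cardP h] at this
  exact (Nat.dvd_prime_pow (by norm_num)).1 this

theorem card_lt (h : Hyp G) {P : Sylow 23 G} {X : Subgroup G} (hX : X ≤ P) (hne : X ≠ P) : Nat.card X ≤ 529 := by
  obtain ⟨k, hk, hc⟩ := card_pow h hX
  have : k ≠ 3 := by
    rintro rfl
    exact hne (Subgroup.eq_of_le_of_card_ge hX (by rw [hc, cardP h]))
  rw [hc]
  calc 23 ^ k ≤ 23 ^ 2 := Nat.pow_le_pow_right (by norm_num) (by omega)
    _ = 529 := by norm_num

theorem comm529 (h : Hyp G) {V : Subgroup G} (hV : Nat.card V = 529) {x y : G} (hx : x ∈ V) (hy : y ∈ V) :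
    x * y = y * x := by
  have hcomm := IsPGroup.commutative_of_card_eq_prime_sq (p := 23) (G := V) (by rw [hV]; norm_num)
  exact congrArg Subtype.val (hcomm ⟨x, hx⟩ ⟨y, hy⟩)

theorem Zs_le_of (h : Hyp G) {P : Sylow 23 G} {V : Subgroup G} (hVP : V ≤ P) (hV : Nat.card V = 529) :
    Zs (P : Subgroup G) ≤ V := by
  by_contra hn
  have hle : V ⊔ Zs (P : Subgroup G) ≤ P := sup_le hVP (Zs_le _)
  have htop : V ⊔ Zs (P : Subgroup G) = P := by
    by_contra hne
    have h1 := card_lt h hle hne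
    have := Subgroup.eq_of_le_of_card_ge (le_sup_left : V ≤ V ⊔ Zs (P : Subgroup G)) (by rw [hV]; exact h1)
    apply hn
    rw [this]
    exact le_sup_right
  have hVZ : V ≤ Zs (P : Subgroup G) := by
    intro v hv
    have : (P : Subgroup G) ≤ centralizer {v} := by
      rw [← htop]
      apply sup_le
      · intro w hw
        rw [Subgroup.mem_centralizer_singleton_iff]
        exact comm529 h hV hw hv
      · intro w hw
        rw [Subgroup.mem_centralizer_singleton_iff]
        exact ((mem_Zs.1 hw).2 v (hVP hv)).symm
    rw [mem_Zs]
    exact ⟨hVP hv, fun y hy => Subgroup.mem_centralizer_singleton_iff.1 (this hy)⟩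
  have := Subgroup.card_le_of_le hVZ
  rw [hV, cardZs h] at this
  norm_num at this

theorem le_normalizer529 (h : Hyp G) {P : Sylow 23 G} {V : Subgroup G} (hVP : V ≤ P) (hV : Nat.card V = 529) :
    (P : Subgroup G) ≤ normalizer (V : Set G) := by
  refine (Subgroup.normal_subgroupOf_iff_le_normalizer hVP).1 ?_
  apply Subgroup.normal_of_index_eq_minFac_card
  have h1 := relIndex_mul V (P : Subgroup G)
  rw [inf_eq_right.2 hVP, hV, cardP h, Subgroup.relIndex] at h1
  rw [cardP h, Nat.Prime.pow_minFac (by norm_num) (by norm_num)]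
  omega

theorem inf_eq529 (h : Hyp G) {P Q : Sylow 23 G} (hne : P ≠ Q) {V : Subgroup G} (hVP : V ≤ P) (hVQ : V ≤ Q)
    (hV : Nat.card V = 529) : (P : Subgroup G) ⊓ Q = V := by
  symm
  apply Subgroup.eq_of_le_of_card_ge (le_inf hVP hVQ)
  rw [hV]
  refine card_lt h (P := P) inf_le_left ?_
  intro he
  exact hne (Sylow.ext (P.is_maximal' Q.2 (inf_eq_left.1 he)).symm)

/-- Sylow 23-subgroups containing `V`. -/
theorem S_conj_mem (h : Hyp G) {V : Subgroup G} {g : G} (hg : g ∈ normalizer (V : Set G)) {Q : Sylow 23 G}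
    (hQ : V ≤ Q) : V ≤ ((g • Q : Sylow 23 G) : Subgroup G) := by
  rw [coe_smul_sylow, ← cj_eq_self.2 hg]
  exact cj_mono hQ

theorem smul_ne_of (h : Hyp G) {P Q : Sylow 23 G} (hne : Q ≠ P) {x : G} (hx : x ∈ P) : x • Q ≠ P := by
  intro hxQ
  apply hne
  have : x⁻¹ • (x • Q) = x⁻¹ • P := by rw [hxQ]
  rw [inv_smul_smul] at this
  rw [this]
  apply Sylow.smul_eq_iff_mem_normalizer.2
  exact Subgroup.le_normalizer (inv_mem hx)

theorem S_card (h : Hyp G) {P Q : Sylow 23 G} (hne : P ≠ Q) {V : Subgroup G} (hVP : V ≤ P) (hVQ : V ≤ Q)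
    (hV : Nat.card V = 529) : ({R | V ≤ R} : Set (Sylow 23 G)).ncard = 24 := by
  have hle : ({R | V ≤ R} : Set (Sylow 23 G)).ncard ≤ 24 := by
    have := (packing (ι := {R : Sylow 23 G // V ≤ R}) (fun R => Zs (R.1 : Subgroup G)) V ⊥ 23
      (fun R => cardZs h _) (fun R => Zs_le_of h R.2 hV) (fun R => bot_le) (by
        intro R R' hne' x hx
        by_contra hx1
        exact hne' (Subtype.ext (Zs_inj h hx.1 hx.2 hx1))) bot_le).1
    rw [hV, Subgroup.card_bot] at this
    have h2 : Nat.card {R : Sylow 23 G // V ≤ R} = ({R | V ≤ R} : Set (Sylow 23 G)).ncard := rfl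
    omega
  have hdvd : 23 ∣ ({R | V ≤ R ∧ R ≠ P} : Set (Sylow 23 G)).ncard := by
    apply dvd_of_orbits (X := (P : Subgroup G))
    · rintro x R ⟨hR, hRP⟩
      exact ⟨S_conj_mem h (le_normalizer529 h hVP hV x.2) hR, smul_ne_of h hRP x.2⟩
    · rintro R ⟨hR, hRP⟩
      rw [orbit_ncard P.2 R]
      have h1 := relIndex_mul (R : Subgroup G) (P : Subgroup G)
      rw [inf_eq529 h hRP.symm hVP hR hV, hV, cardP h] at h1
      omega
  have heq : ({R | V ≤ R} : Set (Sylow 23 G)) = insert P ({R | V ≤ R ∧ R ≠ P} : Set (Sylow 23 G)) := by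
    ext R
    simp only [Set.mem_setOf_eq, Set.mem_insert_iff]
    by_cases hR : R = P
    · subst hR; simp [hVP]
    · simp [hR]
  rw [heq, Set.ncard_insert_of_notMem (by simp)] at hle ⊢
  have hpos : 0 < ({R | V ≤ R ∧ R ≠ P} : Set (Sylow 23 G)).ncard := by
    rw [Set.ncard_pos]; exact ⟨Q, hVQ, hne.symm⟩
  have := Nat.le_of_dvd hpos hdvd
  omega

/-- Lemma T -/
theorem trans_S (h : Hyp G) {P Q Q' : Sylow 23 G} (hne : Q ≠ P) (hne' : Q' ≠ P) {V : Subgroup G} (hVP : V ≤ P)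
    (hVQ : V ≤ Q) (hVQ' : V ≤ Q') (hV : Nat.card V = 529) (X : Subgroup G) (hX : X ≤ P)
    (hXV : V.relIndex X = 23) : ∃ x ∈ X, x • Q = Q' := by
  have hsub : orbit X Q ⊆ {R | V ≤ R ∧ R ≠ P} := by
    rintro _ ⟨x, rfl⟩
    exact ⟨S_conj_mem h (le_normalizer529 h hVP hV (hX x.2)) hVQ, smul_ne_of h hne (hX x.2)⟩
  have hXp : IsPGroup 23 X := P.2.to_le hX
  have hcard : (orbit X Q).ncard = 23 := by
    rw [orbit_ncard hXp Q]
    refine Eq.trans ?_ hXV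
    rw [← Subgroup.inf_relIndex_left, ← Subgroup.inf_relIndex_left (H := X) (K := V)]
    congr 1
    rw [← inf_eq529 h hne.symm hVP hVQ hV, ← inf_assoc, inf_eq_left.2 hX]
  have heq : ({R | V ≤ R} : Set (Sylow 23 G)) = insert P ({R | V ≤ R ∧ R ≠ P} : Set (Sylow 23 G)) := by
    ext R
    simp only [Set.mem_setOf_eq, Set.mem_insert_iff]
    by_cases hR : R = P
    · subst hR; simp [hVP]
    · simp [hR]
  have h24 := S_card h hne.symm hVP hVQ hV
  rw [heq, Set.ncard_insert_of_notMem (by simp)] at h24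
  have := Set.eq_of_subset_of_ncard_le hsub (by omega) (Set.toFinite _)
  have hQ' : Q' ∈ ({R | V ≤ R ∧ R ≠ P} : Set (Sylow 23 G)) := ⟨hVQ', hne'⟩
  rw [← this] at hQ'
  obtain ⟨x, hx⟩ := hQ'
  exact ⟨x, x.2, hx⟩

theorem n23_eq (h : Hyp G) : Nat.card (Sylow 23 G) = 13272 := by
  refine (n23_cases h).resolve_right ?_
  intro hn
  have hself : ∀ P : Sylow 23 G, normalizer (P : Set G) = P := by
    intro P
    symm
    apply Subgroup.eq_of_le_of_card_ge Subgroup.le_normalizer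
    have h1 := P.card_eq_index_normalizer
    have h2 := (normalizer (P : Set G)).card_mul_index
    rw [← h1, hn, h.card] at h2
    rw [cardP h]; change Nat.card (normalizer (P : Set G)) ≤ 23 ^ 3; omega
  obtain ⟨_, _, _, _, _, g, hg⟩ := h.a2
  set x := g ^ 2 with hxdef
  set i := g ^ 23 with hidef
  have hx : orderOf x = 23 := by
    rw [hxdef, orderOf_pow_of_dvd (by norm_num) (by rw [hg]; norm_num), hg]
  have hi : orderOf i = 2 := by
    rw [hidef, orderOf_pow_of_dvd (by norm_num) (by rw [hg]; norm_num), hg]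
  have hcomm : Commute x i := (Commute.refl g).pow_pow 2 23
  have himem : ∀ P : Sylow 23 G, i • P ≠ P := by
    intro P hP
    have h1 := Sylow.smul_eq_iff_mem_normalizer.1 hP
    rw [hself] at h1
    have h2 := orderOf_dvd_natCard (⟨i, h1⟩ : (P : Subgroup G))
    rw [cardP h, Subgroup.orderOf_mk, hi] at h2
    norm_num at h2
  obtain ⟨P, hP⟩ := IsPGroup.exists_le_sylow (IsPGroup.of_card (p := 23) (n := 1) (G := zpowers x)
      (by rw [Nat.card_zpowers, hx, pow_one]))
  have hxP : x ∈ (P : Subgroup G) := hP (mem_zpowers x)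
  haveI := cent_unique h (x := x) (by rw [hx])
  obtain ⟨U0⟩ : Nonempty (Sylow 23 (centralizer {x})) := inferInstance
  have hU0n : (U0 : Subgroup (centralizer {x})).Normal := U0.normal_of_subsingleton
  set U : Subgroup G := (U0 : Subgroup (centralizer {x})).map (centralizer {x}).subtype with hU
  have hUp : IsPGroup 23 U := U0.2.map _
  have hic : i ∈ centralizer {x} := by
    rw [Subgroup.mem_centralizer_singleton_iff]; exact hcomm.eq.symm
  have hiU : i ∈ normalizer (U : Set G) := by
    rw [← cj_eq_self]
    apply Subgroup.eq_of_le_of_card_ge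
    · intro y hy
      rw [mem_cj] at hy
      obtain ⟨z, hz, hze⟩ := hy
      have hy' : y = i * z * i⁻¹ := by
        rw [show (z : G) = i⁻¹ * y * i from hze]; group
      refine ⟨⟨i, hic⟩ * z * ⟨i, hic⟩⁻¹, hU0n.conj_mem z hz _, ?_⟩
      rw [hy']; rfl
    · rw [card_cj]
  -- centralizer of x in P is contained in U
  have hCP : (P : Subgroup G) ⊓ centralizer {x} ≤ U := by
    have hp : IsPGroup 23 (((P : Subgroup G) ⊓ centralizer {x}).subgroupOf (centralizer {x})) :=
      (P.2.to_le inf_le_left).of_equiv (Subgroup.subgroupOfEquivOfLe inf_le_right).symm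
    obtain ⟨S', hS'⟩ := IsPGroup.exists_le_sylow hp
    rw [Subsingleton.elim S' U0] at hS'
    intro y hy
    exact ⟨⟨y, hy.2⟩, hS' (show (⟨y, hy.2⟩ : centralizer {x}) ∈ _ from hy), rfl⟩
  have hCc : 529 ≤ Nat.card ((P : Subgroup G) ⊓ centralizer {x} : Subgroup G) := by
    obtain ⟨k, hk, hc⟩ := card_pow h (P := P) (X := (P : Subgroup G) ⊓ centralizer {x}) inf_le_left
    have hZC : Zs (P : Subgroup G) ≤ (P : Subgroup G) ⊓ centralizer {x} := by
      intro z hz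
      refine ⟨hz.1, ?_⟩
      refine Subgroup.mem_centralizer_singleton_iff.2 ?_
      exact ((mem_Zs.1 hz).2 x hxP).symm
    have hk1 : ¬ k ≤ 1 := by
      intro hk1
      have he := Subgroup.eq_of_le_of_card_ge hZC (by
        rw [hc, cardZs h]
        calc 23 ^ k ≤ 23 ^ 1 := Nat.pow_le_pow_right (by norm_num) hk1
          _ = 23 := by norm_num)
      have hxZ : x ∈ Zs (P : Subgroup G) := by
        rw [he]; exact ⟨hxP, Subgroup.mem_centralizer_singleton_iff.2 rfl⟩
      have : (P : Subgroup G) ≤ Zs (P : Subgroup G) := by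
        rw [he]
        intro y hy
        refine ⟨hy, ?_⟩
        refine Subgroup.mem_centralizer_singleton_iff.2 ?_
        exact (mem_Zs.1 hxZ).2 y hy
      exact nonabelian h P (le_antisymm (Zs_le _) this)
    rw [hc]
    calc 529 = 23 ^ 2 := by norm_num
      _ ≤ 23 ^ k := Nat.pow_le_pow_right (by norm_num) (by omega)
  obtain ⟨Q, hQ⟩ := hUp.exists_le_sylow
  have hUQ : U ≠ Q := by
    intro he
    apply himem Q
    apply Sylow.smul_eq_iff_mem_normalizer.2
    rw [← Sylow.coe_coe, ← he]; exact hiU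
  have hUc : Nat.card U ≤ 529 := card_lt h hQ hUQ
  have hUeq : (P : Subgroup G) ⊓ centralizer {x} = U :=
    Subgroup.eq_of_le_of_card_ge hCP (by omega)
  have hU529 : Nat.card U = 529 := by rw [hUeq] at hCc; omega
  have hUP : U ≤ P := by rw [← hUeq]; exact inf_le_left
  have hUiP : U ≤ ((i • P : Sylow 23 G) : Subgroup G) := S_conj_mem h hiU hUP
  have h24 := S_card h (himem P).symm hUP hUiP hU529
  have horb : orbit (normalizer (U : Set G)) P = ({R | U ≤ R} : Set (Sylow 23 G)) := by
    ext R
    constructor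
    · rintro ⟨y, rfl⟩
      exact S_conj_mem h y.2 hUP
    · intro hR
      by_cases hRP : R = P
      · rw [hRP]; exact mem_orbit_self _
      · have hrel : U.relIndex (P : Subgroup G) = 23 := by
          have h1 := relIndex_mul U (P : Subgroup G)
          rw [inf_eq_right.2 hUP, hU529, cardP h] at h1
          omega
        obtain ⟨y, hy, hyR⟩ := trans_S h (himem P) hRP hUP hUiP hR hU529 P le_rfl hrel
        refine ⟨⟨y, le_normalizer529 h hUP hU529 hy⟩ * ⟨i, hiU⟩, ?_⟩
        change (y * i) • P = R
        rw [mul_smul, hyR]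
  have hidx := MulAction.index_stabilizer (normalizer (U : Set G)) P
  rw [horb, h24] at hidx
  have hst : stabilizer (normalizer (U : Set G)) P = (P : Subgroup G).subgroupOf (normalizer (U : Set G)) := by
    ext y
    rw [mem_stabilizer_iff, Subgroup.mem_subgroupOf]
    have : (y • P = P) ↔ (y : G) ∈ normalizer (P : Set G) := Sylow.smul_eq_iff_mem_normalizer
    rw [this, hself]
  have hcN : Nat.card (normalizer (U : Set G)) = 24 * 23 ^ 3 := by
    have h1 := relIndex_mul (P : Subgroup G) (normalizer (U : Set G))
    rw [inf_eq_right.2 (le_normalizer529 h hUP hU529), cardP h, Subgroup.relIndex, ← hst, hidx] at h1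
    exact h1.symm
  have hq : Nat.card (normalizer (U : Set G) ⧸ U.subgroupOf (normalizer (U : Set G))) = 552 := by
    have h1 := Subgroup.card_eq_card_quotient_mul_card_subgroup (U.subgroupOf (normalizer (U : Set G)))
    rw [hcN, Nat.card_congr (Subgroup.subgroupOfEquivOfLe (Subgroup.le_normalizer)).toEquiv, hU529] at h1
    omega
  haveI : (U.subgroupOf (normalizer (U : Set G))).Normal := Subgroup.normal_in_normalizer
  haveI := group552 hq
  exact himem P (quot_unique U hUp P (i • P) (le_normalizer529 h hUP hU529)
    (le_normalizer529 h hUiP hU529)).symm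

end main
end OD

namespace OD
open Subgroup MulAction

theorem double_count {α β : Type*} [Finite α] [Finite β] (s : Set α) (t : Set β) (r : α → β → Prop)
    (m n : ℕ) (hm : ∀ a ∈ s, {b | b ∈ t ∧ r a b}.ncard = m) (hn : ∀ b ∈ t, {a | a ∈ s ∧ r a b}.ncard = n) :
    s.ncard * m = t.ncard * n := by
  classical
  haveI := Fintype.ofFinite α
  haveI := Fintype.ofFinite β
  have := Finset.card_mul_eq_card_mul (s := s.toFinset) (t := t.toFinset) r (m := m) (n := n) ?_ ?_
  · rwa [← Set.ncard_eq_toFinset_card', ← Set.ncard_eq_toFinset_card'] at this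
  · intro a ha
    rw [← hm a (by simpa using ha), Set.ncard_eq_toFinset_card']
    congr 1; ext b; simp [Finset.mem_bipartiteAbove]
  · intro b hb
    rw [← hn b (by simpa using hb), Set.ncard_eq_toFinset_card']
    congr 1; ext b; simp [Finset.mem_bipartiteBelow]

theorem double_count_eq {α β : Type*} [Finite α] [Finite β] (s : Set α) (t : Set β) (r : α → β → Prop)
    (m : ℕ) (hm : ∀ a ∈ s, {b | b ∈ t ∧ r a b}.ncard = m) (hn : ∀ b ∈ t, {a | a ∈ s ∧ r a b}.ncard ≤ m)
    (hst : s.ncard = t.ncard) : ∀ b ∈ t, {a | a ∈ s ∧ r a b}.ncard = m := by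
  classical
  haveI := Fintype.ofFinite α
  haveI := Fintype.ofFinite β
  have key := Finset.sum_card_bipartiteAbove_eq_sum_card_bipartiteBelow (s := s.toFinset) (t := t.toFinset) r
  have h1 : ∀ a ∈ s.toFinset, (Finset.bipartiteAbove r t.toFinset a).card = m := by
    intro a ha
    rw [← hm a (by simpa using ha), Set.ncard_eq_toFinset_card']
    congr 1; ext b; simp [Finset.mem_bipartiteAbove]
  have h2 : ∀ b, (Finset.bipartiteBelow r s.toFinset b).card = {a | a ∈ s ∧ r a b}.ncard := by
    intro b
    rw [Set.ncard_eq_toFinset_card']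
    congr 1; ext b; simp [Finset.mem_bipartiteBelow]
  rw [Finset.sum_congr rfl h1, Finset.sum_const, ← Set.ncard_eq_toFinset_card', hst, Set.ncard_eq_toFinset_card',
    ← Finset.sum_const, eq_comm, Finset.sum_eq_sum_iff_of_le] at key
  · intro b hb
    rw [← h2]; exact key b (by simpa using hb)
  · intro b hb
    rw [h2]; exact hn b (by simpa using hb)

/-- vertices -/
def IsV {G : Type*} [Group G] (V : Subgroup G) : Prop :=
  Nat.card V = 529 ∧ ∃ P Q : Sylow 23 G, P ≠ Q ∧ V ≤ P ∧ V ≤ Q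

def Adj {G : Type*} [Group G] (V W : Subgroup G) : Prop :=
  V ≠ W ∧ ∃ P : Sylow 23 G, V ≤ P ∧ W ≤ P

theorem Adj.symm' {G : Type*} [Group G] {V W : Subgroup G} (hh : Adj V W) : Adj W V :=
  ⟨hh.1.symm, hh.2.imp fun _ h => h.symm⟩

theorem IsV.cj {G : Type*} [Group G] {V : Subgroup G} (hV : IsV V) (g : G) : IsV (cj g V) := by
  obtain ⟨hc, P, Q, hne, hP, hQ⟩ := hV
  refine ⟨by rw [card_cj, hc], g • P, g • Q, ?_, ?_, ?_⟩
  · intro he; exact hne (smul_left_cancel g he)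
  · rw [coe_smul_sylow]; exact cj_mono hP
  · rw [coe_smul_sylow]; exact cj_mono hQ

theorem Adj.cj {G : Type*} [Group G] {V W : Subgroup G} (hh : Adj V W) (g : G) : Adj (cj g V) (cj g W) := by
  obtain ⟨hne, P, hP, hQ⟩ := hh
  refine ⟨fun he => hne (cj_inj.1 he), g • P, ?_, ?_⟩
  · rw [coe_smul_sylow]; exact cj_mono hP
  · rw [coe_smul_sylow]; exact cj_mono hQ

section main
variable {G : Type*} [Group G] [Finite G]

theorem inf_Zs (h : Hyp G) {P : Sylow 23 G} {V W : Subgroup G} (hV : Nat.card V = 529) (hW : Nat.card W = 529)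
    (hVP : V ≤ P) (hWP : W ≤ P) (hne : V ≠ W) : V ⊓ W = Zs (P : Subgroup G) := by
  symm
  apply Subgroup.eq_of_le_of_card_ge (le_inf (Zs_le_of h hVP hV) (Zs_le_of h hWP hW))
  obtain ⟨k, hk, hc⟩ := card_pow h (P := P) (X := V ⊓ W) (inf_le_left.trans hVP)
  rw [hc, cardZs h]
  have : k ≤ 1 := by
    by_contra hk1
    apply hne
    have h529 : 529 ≤ Nat.card (V ⊓ W : Subgroup G) := by
      rw [hc]
      calc 529 = 23 ^ 2 := by norm_num
        _ ≤ 23 ^ k := Nat.pow_le_pow_right (by norm_num) (by omega)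
    have e1 := Subgroup.eq_of_le_of_card_ge (inf_le_left : V ⊓ W ≤ V) (by omega)
    have e2 := Subgroup.eq_of_le_of_card_ge (inf_le_right : V ⊓ W ≤ W) (by omega)
    exact e1.symm.trans e2
  calc 23 ^ k ≤ 23 ^ 1 := Nat.pow_le_pow_right (by norm_num) this
    _ = 23 := by norm_num

theorem two_vertices (h : Hyp G) (P : Sylow 23 G) : {V : Subgroup G | IsV V ∧ V ≤ P}.ncard = 2 := by
  set T := {V : Subgroup G | IsV V ∧ V ≤ P} with hT
  have hle : T.ncard ≤ 24 := by
    have := (packing (ι := T) (fun V => V.1) (P : Subgroup G) (Zs (P : Subgroup G)) 529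
      (fun V => V.2.1.1) (fun V => V.2.2) (fun V => Zs_le_of h V.2.2 V.2.1.1) (by
        intro V W hne
        exact (inf_Zs h V.2.1.1 W.2.1.1 V.2.2 W.2.2 (fun he => hne (Subtype.ext he))).le) (Zs_le _)).1
    rw [cardP h, cardZs h] at this
    have h2 : Nat.card T = T.ncard := rfl
    omega
  set T1 : Set (Sylow 23 G) := {Q | Q ≠ P ∧ Nat.card ((P : Subgroup G) ⊓ Q : Subgroup G) = 529} with hT1
  set T2 : Set (Sylow 23 G) := {Q | Q ≠ P ∧ Nat.card ((P : Subgroup G) ⊓ Q : Subgroup G) ≠ 529} with hT2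
  have hc1 : T1.ncard * 1 = T.ncard * 23 := by
    refine double_count T1 T (fun Q V => V ≤ (Q : Subgroup G)) 1 23 ?_ ?_
    · rintro Q ⟨hQP, hc⟩
      rw [Set.ncard_eq_one]
      refine ⟨(P : Subgroup G) ⊓ Q, ?_⟩
      ext V
      simp only [Set.mem_setOf_eq, Set.mem_singleton_iff, hT]
      constructor
      · rintro ⟨⟨hV, hVP⟩, hVQ⟩
        exact (inf_eq529 h hQP.symm hVP hVQ hV.1).symm
      · rintro rfl
        exact ⟨⟨⟨hc, P, Q, hQP.symm, inf_le_left, inf_le_right⟩, inf_le_left⟩, inf_le_right⟩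
    · rintro V ⟨⟨hV, Q, Q', hne, hQ, hQ'⟩, hVP⟩
      have h24 := S_card h hne hQ hQ' hV
      have heq : ({R | V ≤ R} : Set (Sylow 23 G)) = insert P {Q | Q ∈ T1 ∧ V ≤ (Q : Subgroup G)} := by
        ext R
        simp only [Set.mem_setOf_eq, Set.mem_insert_iff, hT1]
        by_cases hR : R = P
        · subst hR; simp [hVP]
        · simp only [hR, false_or]
          constructor
          · intro hVR
            refine ⟨⟨hR, ?_⟩, hVR⟩
            rw [inf_eq529 h (Ne.symm hR) hVP hVR hV, hV]
          · exact fun hh => hh.2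
      rw [heq, Set.ncard_insert_of_notMem (by simp [hT1])] at h24
      omega
  have hc2 : 529 ∣ T2.ncard := by
    apply dvd_of_orbits (X := (P : Subgroup G))
    · rintro x R ⟨hR, hRP⟩
      refine ⟨smul_ne_of h hR x.2, ?_⟩
      have : ((P : Subgroup G) ⊓ ((x.1 • R : Sylow 23 G) : Subgroup G)) = cj x.1 ((P : Subgroup G) ⊓ R) := by
        rw [cj_inf, cj_eq_self_of_mem x.2, coe_smul_sylow]
      change Nat.card ((P : Subgroup G) ⊓ ((x.1 • R : Sylow 23 G) : Subgroup G) : Subgroup G) ≠ 529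
      rwa [this, card_cj]
    · rintro R ⟨hR, hRP⟩
      rw [orbit_ncard P.2 R]
      have h1 := relIndex_mul (R : Subgroup G) (P : Subgroup G)
      obtain ⟨k, hk, hc⟩ := card_pow h (P := P) (X := (P : Subgroup G) ⊓ R) inf_le_left
      rw [cardP h] at h1
      have h3 : k ≠ 3 := by
        rintro rfl
        have := Subgroup.eq_of_le_of_card_ge (inf_le_left : (P : Subgroup G) ⊓ R ≤ P) (by rw [hc, cardP h])
        exact hR (Sylow.ext (P.is_maximal' R.2 (inf_eq_left.1 this)))
      have h2 : k ≠ 2 := by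
        rintro rfl
        exact hRP (by rw [hc]; norm_num)
      rw [hc] at h1
      have : k = 0 ∨ k = 1 := by omega
      rcases this with rfl | rfl
      · exact ⟨23, by omega⟩
      · exact ⟨1, by omega⟩
  have htot : 13272 = 1 + (T1.ncard + T2.ncard) := by
    rw [← n23_eq h, ← Set.ncard_univ]
    have : (Set.univ : Set (Sylow 23 G)) = insert P (T1 ∪ T2) := by
      ext Q
      simp only [Set.mem_univ, true_iff, Set.mem_insert_iff, Set.mem_union, hT1, hT2, Set.mem_setOf_eq]
      tauto
    rw [this, Set.ncard_insert_of_notMem (by simp [hT1, hT2]), Set.ncard_union_eq, add_comm]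
    rw [Set.disjoint_left]
    rintro Q ⟨_, h1⟩ ⟨_, h2⟩
    exact h2 h1
  omega

/-- the Sylow containing two distinct vertices is unique -/
theorem syl_unique (h : Hyp G) {V W : Subgroup G} (hV : IsV V) (hW : IsV W) (hne : V ≠ W) {P Q : Sylow 23 G}
    (h1 : V ≤ P) (h2 : W ≤ P) (h3 : V ≤ Q) (h4 : W ≤ Q) : P = Q := by
  by_contra hPQ
  exact hne ((inf_eq529 h hPQ h1 h3 hV.1).symm.trans (inf_eq529 h hPQ h2 h4 hW.1))

theorem third (h : Hyp G) {P : Sylow 23 G} {V W X : Subgroup G} (hV : IsV V) (hW : IsV W) (hX : IsV X)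
    (h1 : V ≤ P) (h2 : W ≤ P) (h3 : X ≤ P) (hVW : V ≠ W) (hVX : V ≠ X) : W = X := by
  by_contra hWX
  have h2 := two_vertices h P
  have : ({V, W, X} : Set (Subgroup G)) ⊆ {V : Subgroup G | IsV V ∧ V ≤ P} := by
    rintro Y (rfl | rfl | rfl) <;> constructor <;> assumption
  have := Set.ncard_le_ncard this (Set.toFinite _)
  rw [Set.ncard_eq_three.2 ⟨V, W, X, hVW, hVX, hWX, rfl⟩] at this
  omega

theorem exists_other (h : Hyp G) {P : Sylow 23 G} {V : Subgroup G} (hV : IsV V) (hVP : V ≤ P) :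
    ∃ W, IsV W ∧ W ≤ P ∧ V ≠ W := by
  have h2 := two_vertices h P
  by_contra hcon
  push Not at hcon
  have : {V : Subgroup G | IsV V ∧ V ≤ P} ⊆ {V} := by
    rintro Y ⟨hY, hYP⟩
    exact (hcon Y hY hYP).symm
  have := Set.ncard_le_ncard this (Set.toFinite _)
  rw [Set.ncard_singleton] at this
  omega

theorem S24 (h : Hyp G) {V : Subgroup G} (hV : IsV V) : ({R | V ≤ R} : Set (Sylow 23 G)).ncard = 24 := by
  obtain ⟨hc, P, Q, hne, h1, h2⟩ := hV
  exact S_card h hne h1 h2 hc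

theorem card_V (h : Hyp G) : {V : Subgroup G | IsV V}.ncard = 1106 := by
  have := double_count {V : Subgroup G | IsV V} (Set.univ : Set (Sylow 23 G)) (fun V P => V ≤ (P : Subgroup G))
    24 2 ?_ ?_
  · rw [Set.ncard_univ, n23_eq h] at this
    omega
  · intro V hV
    simpa using S24 h hV
  · intro P _
    exact two_vertices h P

theorem nbr24 (h : Hyp G) {V : Subgroup G} (hV : IsV V) : {W : Subgroup G | IsV W ∧ Adj V W}.ncard = 24 := by
  have := double_count {W : Subgroup G | IsV W ∧ Adj V W} ({R | V ≤ R} : Set (Sylow 23 G))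
    (fun W P => W ≤ (P : Subgroup G)) 1 1 ?_ ?_
  · rw [S24 h hV] at this
    omega
  · rintro W ⟨hW, hne, P, h1, h2⟩
    rw [Set.ncard_eq_one]
    refine ⟨P, ?_⟩
    ext Q
    simp only [Set.mem_setOf_eq, Set.mem_singleton_iff]
    constructor
    · rintro ⟨h3, h4⟩
      exact syl_unique h hV hW hne h3 h4 h1 h2
    · rintro rfl; exact ⟨h1, h2⟩
  · intro P hVP
    obtain ⟨W, hW, hWP, hne⟩ := exists_other h hV hVP
    rw [Set.ncard_eq_one]
    refine ⟨W, ?_⟩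
    ext X
    simp only [Set.mem_setOf_eq, Set.mem_singleton_iff]
    constructor
    · rintro ⟨⟨hX, hVX⟩, hXP⟩
      exact (third h hV hW hX hVP hWP hXP hne hVX.1).symm
    · rintro rfl; exact ⟨⟨hW, hne, P, hVP, hWP⟩, hWP⟩

end main
end OD

namespace OD
open Subgroup MulAction

section main
variable {G : Type*} [Group G] [Finite G]

theorem sup529 (h : Hyp G) {P : Sylow 23 G} {V W : Subgroup G} (hV : Nat.card V = 529) (hW : Nat.card W = 529)
    (hVP : V ≤ P) (hWP : W ≤ P) (hne : V ≠ W) : V ⊔ W = P := by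
  by_contra hcon
  have h1 := card_lt h (sup_le hVP hWP) hcon
  have e1 := Subgroup.eq_of_le_of_card_ge (le_sup_left : V ≤ V ⊔ W) (by omega)
  have e2 := Subgroup.eq_of_le_of_card_ge (le_sup_right : W ≤ V ⊔ W) (by omega)
  exact hne (e1.trans e2.symm)

theorem Zs_ne (h : Hyp G) {P Q : Sylow 23 G} (hPQ : P ≠ Q) : ¬ Zs (P : Subgroup G) ≤ Zs (Q : Subgroup G) := by
  intro hle
  have hc := cardZs h P
  have hnt : Nontrivial (Zs (P : Subgroup G)) := by
    rw [← Finite.one_lt_card_iff_nontrivial, hc]; norm_num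
  obtain ⟨x, hx⟩ := exists_ne (1 : Zs (P : Subgroup G))
  exact hPQ (Zs_inj h x.2 (hle x.2) (fun he => hx (Subtype.ext he)))

theorem Zsup (h : Hyp G) {P Q : Sylow 23 G} {V : Subgroup G} (hV : Nat.card V = 529) (hVP : V ≤ P) (hVQ : V ≤ Q)
    (hPQ : P ≠ Q) : Zs (P : Subgroup G) ⊔ Zs (Q : Subgroup G) = V := by
  have hle := sup_le (Zs_le_of h hVP hV) (Zs_le_of h hVQ hV)
  apply Subgroup.eq_of_le_of_card_ge hle
  obtain ⟨k, hk, hc⟩ := card_pow h (hle.trans hVP)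
  rw [hV, hc]
  have : ¬ k ≤ 1 := by
    intro hk1
    have e1 := Subgroup.eq_of_le_of_card_ge (le_sup_left : Zs (P : Subgroup G) ≤ Zs (P : Subgroup G) ⊔ Zs (Q : Subgroup G)) (by
      rw [hc, cardZs h]
      calc 23 ^ k ≤ 23 ^ 1 := Nat.pow_le_pow_right (by norm_num) hk1
        _ = 23 := by norm_num)
    refine Zs_ne h hPQ.symm ?_
    rw [e1]; exact le_sup_right
  calc 529 = 23 ^ 2 := by norm_num
    _ ≤ 23 ^ k := Nat.pow_le_pow_right (by norm_num) (by omega)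

theorem no_tri (h : Hyp G) {A B C : Subgroup G} (hA : IsV A) (hB : IsV B) (hC : IsV C) (hAB : Adj A B) (hBC : Adj B C)
    (hAC : Adj A C) : False := by
  obtain ⟨nAB, P, PA, PB⟩ := hAB
  obtain ⟨nBC, Q, QB, QC⟩ := hBC
  obtain ⟨nAC, R, RA, RC⟩ := hAC
  have hPR : P ≠ R := by
    rintro rfl
    exact nBC (third h hA hB hC PA PB RC nAB nAC)
  have hPQ : P ≠ Q := by
    rintro rfl
    exact nBC (third h hA hB hC PA PB QC nAB nAC)
  refine Zs_ne h hPR.symm ?_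
  intro z hz
  have hzA : z ∈ A := Zs_le_of h RA hA.1 hz
  have hzC : z ∈ C := Zs_le_of h RC hC.1 hz
  refine mem_Zs.2 ⟨PA hzA, ?_⟩
  have hle : (P : Subgroup G) ≤ centralizer {z} := by
    rw [← sup529 h hA.1 hB.1 PA PB nAB, ← Zsup h hB.1 PB QB hPQ]
    refine sup_le ?_ (sup_le ?_ ?_)
    · intro y hy
      exact Subgroup.mem_centralizer_singleton_iff.2 (comm529 h hA.1 hy hzA)
    · intro y hy
      exact Subgroup.mem_centralizer_singleton_iff.2 (comm529 h hA.1 (Zs_le_of h PA hA.1 hy) hzA)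
    · intro y hy
      exact Subgroup.mem_centralizer_singleton_iff.2 (comm529 h hC.1 (Zs_le_of h QC hC.1 hy) hzC)
  intro y hy
  exact Subgroup.mem_centralizer_singleton_iff.1 (hle hy)

theorem path_lemma (h : Hyp G) {A B C D : Subgroup G} (hA : IsV A) (hB : IsV B) (hC : IsV C) (hD : IsV D)
    (nAB : A ≠ B) (nBC : B ≠ C) (nCD : C ≠ D) (nAC : A ≠ C) (nBD : B ≠ D) {P Q R : Sylow 23 G}
    (PA : A ≤ P) (PB : B ≤ P) (QB : B ≤ Q) (QC : C ≤ Q) (RC : C ≤ R) (RD : D ≤ R) :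
    (P : Subgroup G) ⊓ R = Zs (Q : Subgroup G) := by
  have hPR : P ≠ R := by
    rintro rfl
    exact nBC (third h hA hB hC PA PB RC nAB nAC)
  have hle : Zs (Q : Subgroup G) ≤ (P : Subgroup G) ⊓ R :=
    le_inf ((Zs_le_of h QB hB.1).trans PB) ((Zs_le_of h QC hC.1).trans RC)
  symm
  apply Subgroup.eq_of_le_of_card_ge hle
  obtain ⟨k, hk, hc⟩ := card_pow h (P := P) (X := (P : Subgroup G) ⊓ R) inf_le_left
  rw [hc, cardZs h]
  have h3 : k ≠ 3 := by
    rintro rfl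
    have := Subgroup.eq_of_le_of_card_ge (inf_le_left : (P : Subgroup G) ⊓ R ≤ P) (by rw [hc, cardP h])
    exact hPR (Sylow.ext (P.is_maximal' R.2 (inf_eq_left.1 this)).symm)
  have h2 : k ≠ 2 := by
    rintro rfl
    have hI : IsV ((P : Subgroup G) ⊓ R) := ⟨by rw [hc]; norm_num, P, R, hPR, inf_le_left, inf_le_right⟩
    by_cases hIA : A = (P : Subgroup G) ⊓ R
    · have hAR : A ≤ (R : Subgroup G) := by rw [hIA]; exact inf_le_right
      have hAD : A = D := third h hC hA hD RC hAR RD nAC.symm nCD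
      subst hAD
      exact no_tri h hA hB hC ⟨nAB, P, PA, PB⟩ ⟨nBC, Q, QB, QC⟩ ⟨nAC, R, hAR, RC⟩
    · have hIB := third h hA hB hI PA PB inf_le_left nAB hIA
      have hBR : B ≤ (R : Subgroup G) := by rw [hIB]; exact inf_le_right
      exact nBD (third h hC hB hD RC hBR RD nBC.symm nCD)
  have : k ≤ 1 := by omega
  calc 23 ^ k ≤ 23 ^ 1 := Nat.pow_le_pow_right (by norm_num) this
    _ = 23 := by norm_num

theorem no_quad (h : Hyp G) {A B C D : Subgroup G} (hA : IsV A) (hB : IsV B) (hC : IsV C) (hD : IsV D)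
    (hAB : Adj A B) (hBC : Adj B C) (hCD : Adj C D) (hDA : Adj D A) (nAC : A ≠ C) (nBD : B ≠ D) : False := by
  obtain ⟨nAB, P, PA, PB⟩ := hAB
  obtain ⟨nBC, Q, QB, QC⟩ := hBC
  obtain ⟨nCD, R, RC, RD⟩ := hCD
  obtain ⟨nDA, S, SD, SA⟩ := hDA
  have hp := path_lemma h hA hB hC hD nAB nBC nCD nAC nBD PA PB QB QC RC RD
  have hSQ : S ≠ Q := by
    rintro rfl
    exact nBC (third h hA hB hC SA QB QC nAB nAC)
  refine Zs_ne h hSQ ?_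
  rw [← hp]
  exact le_inf ((Zs_le_of h SA hA.1).trans PA) ((Zs_le_of h SD hD.1).trans RD)

theorem cj_fix (h : Hyp G) {P : Sylow 23 G} {V : Subgroup G} (hV : IsV V) (hVP : V ≤ P) {x : G} (hx : x ∈ (P : Subgroup G)) :
    cj x V = V := cj_eq_self.2 (le_normalizer529 h hVP hV.1 hx)

theorem relIndex_P (h : Hyp G) {P : Sylow 23 G} {V : Subgroup G} (hV : IsV V) (hVP : V ≤ P) :
    V.relIndex (P : Subgroup G) = 23 := by
  have h1 := relIndex_mul V (P : Subgroup G)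
  rw [inf_eq_right.2 hVP, hV.1, cardP h] at h1
  omega

/-- move along: x fixes V, sends Q to Q', hence other vertex of Q to other vertex of Q' -/
theorem move (h : Hyp G) {Q Q' : Sylow 23 G} {V W W' : Subgroup G} (hV : IsV V) (hW : IsV W) (hW' : IsV W')
    (hVQ : V ≤ Q) (hWQ : W ≤ Q) (hVQ' : V ≤ Q') (hWQ' : W' ≤ Q') (n1 : V ≠ W) (n2 : V ≠ W') {x : G}
    (hx : cj x V = V) (hQ : x • Q = Q') : cj x W = W' := by
  subst hQ
  refine third h hV (hW.cj x) hW' hVQ' ?_ hWQ' ?_ n2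
  · rw [coe_smul_sylow]; exact cj_mono hWQ
  · intro he
    rw [← hx] at he
    exact n1 (cj_inj.1 he)

theorem trans1 (h : Hyp G) {U A A' : Subgroup G} (hU : IsV U) (hA : IsV A) (hA' : IsV A') (h1 : Adj U A) (h2 : Adj U A') :
    ∃ g, cj g U = U ∧ cj g A = A' := by
  obtain ⟨n1, P, PU, PA⟩ := h1
  obtain ⟨n2, P', PU', PA'⟩ := h2
  have : ∃ R : Sylow 23 G, U ≤ R ∧ R ≠ P ∧ R ≠ P' := by
    by_contra hcon
    push Not at hcon
    have hs : ({R | U ≤ R} : Set (Sylow 23 G)) ⊆ {P, P'} := by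
      intro R hR
      by_cases hRP : R = P
      · simp [hRP]
      · simp [hcon R hR hRP]
    have := Set.ncard_le_ncard hs (Set.toFinite _)
    rw [S24 h hU] at this
    have := Set.ncard_insert_le P {P'}
    rw [Set.ncard_singleton] at this
    omega
  obtain ⟨R, RU, n3, n4⟩ := this
  obtain ⟨x, hx, hxP⟩ := trans_S h n3.symm n4.symm RU PU PU' hU.1 R le_rfl (relIndex_P h hU RU)
  have hxU := cj_fix h hU RU hx
  exact ⟨x, hxU, move h hU hA hA' PU PA PU' PA' n1 n2 hxU hxP⟩

theorem trans2 (h : Hyp G) {U A B B' : Subgroup G} (hU : IsV U) (hA : IsV A) (hB : IsV B) (hB' : IsV B')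
    (h1 : Adj U A) (h2 : Adj A B) (h3 : Adj A B') (nB : U ≠ B) (nB' : U ≠ B') :
    ∃ g, cj g U = U ∧ cj g A = A ∧ cj g B = B' := by
  obtain ⟨n1, P, PU, PA⟩ := h1
  obtain ⟨n2, Q, QA, QB⟩ := h2
  obtain ⟨n3, Q', QA', QB'⟩ := h3
  have e1 : Q ≠ P := by rintro rfl; exact nB (third h hA hU hB PA PU QB n1.symm n2)
  have e2 : Q' ≠ P := by rintro rfl; exact nB' (third h hA hU hB' PA PU QB' n1.symm n3)
  obtain ⟨x, hx, hxP⟩ := trans_S h e1 e2 PA QA QA' hA.1 P le_rfl (relIndex_P h hA PA)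
  have hxA := cj_fix h hA PA hx
  exact ⟨x, cj_fix h hU PU hx, hxA, move h hA hB hB' QA QB QA' QB' n2 n3 hxA hxP⟩

theorem trans3 (h : Hyp G) {U A B C C' : Subgroup G} (hU : IsV U) (hA : IsV A) (hB : IsV B) (hC : IsV C) (hC' : IsV C')
    (h1 : Adj U A) (h2 : Adj A B) (h3 : Adj B C) (h4 : Adj B C') (nC : A ≠ C) (nC' : A ≠ C') :
    ∃ g, cj g U = U ∧ cj g C = C' := by
  obtain ⟨n1, P, PU, PA⟩ := h1
  obtain ⟨n2, Q, QA, QB⟩ := h2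
  obtain ⟨n3, R, RB, RC⟩ := h3
  obtain ⟨n4, R', RB', RC'⟩ := h4
  have e1 : R ≠ Q := by rintro rfl; exact nC (third h hB hA hC QB QA RC n2.symm n3)
  have e2 : R' ≠ Q := by rintro rfl; exact nC' (third h hB hA hC' QB QA RC' n2.symm n4)
  have hrel : B.relIndex A = 23 := by
    have := relIndex_mul B A
    rw [inf_Zs h hA.1 hB.1 QA QB n2, cardZs h, hA.1] at this
    omega
  obtain ⟨x, hx, hxP⟩ := trans_S h e1 e2 QB RB RB' hB.1 A QA hrel
  have hxB := cj_fix h hB QB (QA hx)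
  exact ⟨x, cj_fix h hU PU (PA hx), move h hB hC hC' RB RC RB' RC' n3 n4 hxB hxP⟩

/-- transitivity on nonbacktracking 3-paths -/
theorem trans_path (h : Hyp G) {U A B C A' B' C' : Subgroup G} (hU : IsV U) (hA : IsV A) (hB : IsV B) (hC : IsV C)
    (hA' : IsV A') (hB' : IsV B') (hC' : IsV C') (h1 : Adj U A) (h2 : Adj A B) (h3 : Adj B C)
    (h1' : Adj U A') (h2' : Adj A' B') (h3' : Adj B' C') (n1 : U ≠ B) (n2 : A ≠ C) (n1' : U ≠ B') (n2' : A' ≠ C') :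
    ∃ g, cj g U = U ∧ cj g C = C' := by
  obtain ⟨x, xU, xA⟩ := trans1 h hU hA hA' h1 h1'
  subst xA
  have nB : U ≠ cj x B := by
    intro he; rw [← xU] at he; exact n1 (cj_inj.1 he)
  obtain ⟨y, yU, yA, yB⟩ := trans2 h hU hA' (hB.cj x) hB' h1' (h2.cj x) h2' nB n1'
  subst yB
  have h3y := (h3.cj x).cj y
  have nC : cj x A ≠ cj y (cj x C) := by
    intro he; rw [← yA] at he; exact n2 (cj_inj.1 (cj_inj.1 he))
  obtain ⟨z, zU, zC⟩ := trans3 h hU hA' hB' ((hC.cj x).cj y) hC' h1' h2' h3y h3' nC n2'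
  refine ⟨z * y * x, ?_, ?_⟩
  · rw [cj_mul, cj_mul, xU, yU, zU]
  · rw [cj_mul, cj_mul, zC]

end main
end OD

namespace OD
open Subgroup MulAction

section graph
variable {X : Type*} [Finite X] {A : X → X → Prop}

theorem ball_card (hs : ∀ x y, A x y → A y x)
    (hreg : ∀ x, {y | A x y}.ncard = 24)
    (hq : ∀ a b c d, A a b → A b c → A c d → A d a → a ≠ c → b ≠ d → False) (u : X) :
    {y | ∃ m, A u m ∧ A y m}.ncard = 553 := by
  have h1 : {y | y ≠ u ∧ ∃ m, A u m ∧ A y m}.ncard * 1 = {m | A u m}.ncard * 23 := by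
    refine double_count _ _ (fun y m => A y m) 1 23 ?_ ?_
    · rintro y ⟨hne, m, h1, h2⟩
      rw [Set.ncard_eq_one]
      refine ⟨m, ?_⟩
      ext m'
      simp only [Set.mem_setOf_eq, Set.mem_singleton_iff]
      constructor
      · rintro ⟨h3, h4⟩
        by_contra hmm
        exact hq u m y m' h1 (hs _ _ h2) h4 (hs _ _ h3) hne.symm (Ne.symm hmm)
      · rintro rfl; exact ⟨h1, h2⟩
    · intro m hm
      have h24 := hreg m
      have : {y | A m y} = insert u {y | y ∈ {y | y ≠ u ∧ ∃ m, A u m ∧ A y m} ∧ A y m} := by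
        ext y
        simp only [Set.mem_setOf_eq, Set.mem_insert_iff]
        constructor
        · intro hy
          by_cases hyu : y = u
          · exact Or.inl hyu
          · exact Or.inr ⟨⟨hyu, m, hm, hs _ _ hy⟩, hs _ _ hy⟩
        · rintro (rfl | hy)
          · exact hs _ _ hm
          · exact hs _ _ hy.2
      rw [this, Set.ncard_insert_of_notMem (by simp)] at h24
      omega
  have : {y | ∃ m, A u m ∧ A y m} = insert u {y | y ≠ u ∧ ∃ m, A u m ∧ A y m} := by
    ext y
    simp only [Set.mem_setOf_eq, Set.mem_insert_iff]
    by_cases hyu : y = u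
    · subst hyu
      have : {z | A y z}.Nonempty := by rw [← Set.ncard_pos, hreg]; norm_num
      obtain ⟨m, hm⟩ := this
      simp only [true_or, iff_true]
      exact ⟨m, hm, hm⟩
    · simp [hyu]
  rw [this, Set.ncard_insert_of_notMem (by simp)]
  rw [hreg] at h1
  omega

theorem graph_abstract (hX : Nat.card X = 1106) (hs : ∀ x y, A x y → A y x)
    (hreg : ∀ x, {y | A x y}.ncard = 24)
    (ht : ∀ a b c, A a b → A b c → A a c → False)
    (hq : ∀ a b c d, A a b → A b c → A c d → A d a → a ≠ c → b ≠ d → False)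
    (hp : ∀ u a b c a' b' c', A u a → A a b → A b c → A u a' → A a' b' → A b' c' → u ≠ b → a ≠ c → u ≠ b' →
      a' ≠ c' → (∃ m, A u m ∧ A c m) → ∃ m, A u m ∧ A c' m) :
    ∃ Pt : Set X, Pt.Nonempty ∧ (∀ x y, A x y → (x ∈ Pt ↔ y ∉ Pt)) ∧
      ∀ x y, (x ∈ Pt ↔ y ∈ Pt) → ∃ m, A x m ∧ A y m := by
  classical
  have hball := ball_card hs hreg hq
  have hEs : ∀ x y, (∃ m, A x m ∧ A y m) → ∃ m, A y m ∧ A x m := fun x y ⟨m, h1, h2⟩ => ⟨m, h2, h1⟩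
  -- no 5-cycle
  have h5 : ∀ u a b c, A u a → A a b → A b c → u ≠ b → a ≠ c → ¬ ∃ m, A u m ∧ A c m := by
    intro u a b c h1 h2 h3 n1 n2 hE
    set B : X → Set X := fun v => {m | A v m} ∪ {y | ∃ m, A v m ∧ A y m} with hB
    have hBc : ∀ v, (B v).ncard = 577 := by
      intro v
      rw [hB]
      simp only
      rw [Set.ncard_union_eq, hreg, hball]
      rw [Set.disjoint_left]
      rintro m hm ⟨m', h1, h2⟩
      exact ht _ _ _ hm h2 h1
    have hclosed : ∀ x ∈ B u, ∀ y, A x y → y ∈ B u := by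
      rintro x (hx | ⟨m, h4, h5⟩) y hxy
      · exact Or.inr ⟨x, hx, hs _ _ hxy⟩
      · by_cases hux : u = x
        · subst hux; exact Or.inl hxy
        · by_cases hmy : m = y
          · subst hmy; exact Or.inl h4
          · exact Or.inr (hp u a b c m x y h1 h2 h3 h4 (hs _ _ h5) hxy n1 n2 hux hmy hE)
    have hex : ∃ u', u' ∉ B u := by
      by_contra hcon
      push Not at hcon
      have : B u = Set.univ := Set.eq_univ_of_forall hcon
      have h1 := hBc u
      rw [this, Set.ncard_univ, hX] at h1
      omega
    obtain ⟨u', hu'⟩ := hex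
    have hmeetz : ∃ z, z ∈ B u ∧ z ∈ B u' := by
      by_contra hcon
      have hd : Disjoint (B u) (B u') := by
        rw [Set.disjoint_left]
        exact fun z h1 h2 => hcon ⟨z, h1, h2⟩
      have h1 := Set.ncard_union_eq hd
      have h2 := Set.ncard_le_ncard (Set.subset_univ (B u ∪ B u'))
      rw [Set.ncard_univ, hX, h1, hBc, hBc] at h2
      omega
    obtain ⟨z, hz, hz' | ⟨m, h4, h5⟩⟩ := hmeetz
    · exact hu' (hclosed z hz u' (hs _ _ hz'))
    · exact hu' (hclosed m (hclosed z hz m h5) u' (hs _ _ h4))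
  -- adjacency flips out
  have hflip1 : ∀ u x y, (∃ m, A u m ∧ A x m) → A x y → ¬ ∃ m, A u m ∧ A y m := by
    rintro u x y ⟨m, h1, h2⟩ hxy
    by_cases hux : u = x
    · subst hux
      rintro ⟨m', h3, h4⟩
      exact ht _ _ _ hxy h4 h3
    · by_cases hmy : m = y
      · subst hmy
        rintro ⟨m', h3, h4⟩
        exact ht _ _ _ h1 h4 h3
      · exact h5 u m x y h1 (hs _ _ h2) hxy hux hmy
  have hflip2 : ∀ u x y, (¬ ∃ m, A u m ∧ A x m) → A x y → ∃ m, A u m ∧ A y m := by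
    intro u x y hx hxy
    have hcc : ({y | ∃ m, A u m ∧ A y m}ᶜ : Set X).ncard = 553 := by
      have := Set.ncard_add_ncard_compl {y | ∃ m, A u m ∧ A y m}
      rw [hball, hX] at this
      omega
    have key := double_count_eq {y | ∃ m, A u m ∧ A y m} ({y | ∃ m, A u m ∧ A y m}ᶜ : Set X) A 24 ?_ ?_
      (by rw [hball, hcc]) x hx
    · have hsub : {a | a ∈ {y | ∃ m, A u m ∧ A y m} ∧ A a x} ⊆ {a | A x a} := fun a ha => hs _ _ ha.2
      have := Set.eq_of_subset_of_ncard_le hsub (by rw [key, hreg])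
      have hy : y ∈ {a | A x a} := hxy
      rw [← this] at hy
      exact hy.1
    · intro a ha
      rw [← hreg a]
      congr 1
      ext b
      simp only [Set.mem_setOf_eq, Set.mem_compl_iff, and_iff_right_iff_imp]
      intro hab
      exact hflip1 u a b ha hab
    · intro b _
      rw [← hreg b]
      exact Set.ncard_le_ncard fun a ha => hs _ _ ha.2
  obtain ⟨u⟩ : Nonempty X := (Nat.card_pos_iff.1 (by omega)).1
  set Pt : Set X := {y | ∃ m, A u m ∧ A y m} with hPt
  have hPc : Pt.ncard = 553 := hball u
  have hLc : Ptᶜ.ncard = 553 := by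
    have := Set.ncard_add_ncard_compl Pt
    rw [hPc, hX] at this
    omega
  have hflip : ∀ x y, A x y → (x ∈ Pt ↔ y ∉ Pt) := by
    intro x y hxy
    constructor
    · exact fun hx => hflip1 u x y hx hxy
    · exact fun hy => hflip2 u y x hy (hs _ _ hxy)
  refine ⟨Pt, by rw [← Set.ncard_pos, hPc]; norm_num, hflip, ?_⟩
  intro x y hxy
  have hE : ∀ z, (∃ m, A x m ∧ A z m) → (x ∈ Pt ↔ z ∈ Pt) := by
    rintro z ⟨m, h1, h2⟩
    rw [hflip x m h1, hflip z m h2]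
  by_cases hx : x ∈ Pt
  · have := Set.eq_of_subset_of_ncard_le (s := {z | ∃ m, A x m ∧ A z m}) (t := Pt)
      (fun z hz => (hE z hz).1 hx) (by rw [hPc, hball])
    have hy : y ∈ Pt := hxy.1 hx
    rw [← this] at hy
    exact hy
  · have := Set.eq_of_subset_of_ncard_le (s := {z | ∃ m, A x m ∧ A z m}) (t := Ptᶜ)
      (fun z hz hz' => hx ((hE z hz).2 hz')) (by rw [hLc, hball])
    have hy : y ∈ Ptᶜ := fun hy => hx (hxy.2 hy)
    rw [← this] at hy
    exact hy

end graph

/-- The vertex type -/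
abbrev Vx (G : Type*) [Group G] := {V : Subgroup G // IsV V}


instance {G : Type*} [Group G] : MulAction G (Vx G) where
  smul g V := ⟨cj g V.1, V.2.cj g⟩
  one_smul V := Subtype.ext (cj_one _)
  mul_smul g k V := Subtype.ext (cj_mul _ _ _)

theorem Vx_smul {G : Type*} [Group G] (g : G) (V : Vx G) : (g • V).1 = cj g V.1 := rfl

def AdV {G : Type*} [Group G] (V W : Vx G) : Prop := Adj V.1 W.1

section main
variable {G : Type*} [Group G] [Finite G]

theorem bipart (h : Hyp G) : ∃ Pt : Set (Vx G), Pt.Nonempty ∧ (∀ x y, AdV x y → (x ∈ Pt ↔ y ∉ Pt)) ∧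
      (∀ x y, (x ∈ Pt ↔ y ∈ Pt) → ∃ m, AdV x m ∧ AdV y m) ∧ ∀ (g : G) x, g • x ∈ Pt ↔ x ∈ Pt := by
  obtain ⟨Pt, hne, hflip, hE⟩ := graph_abstract (X := Vx G) (A := AdV) (card_V h) (fun x y hh => hh.symm')
    (fun x => by
      rw [← nbr24 h x.2, ← Set.ncard_image_of_injective _ Subtype.val_injective]
      congr 1
      ext V
      constructor
      · rintro ⟨W, hW, rfl⟩; exact ⟨W.2, hW⟩
      · rintro ⟨hV, hW⟩; exact ⟨⟨V, hV⟩, hW, rfl⟩)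
    (fun a b c h1 h2 h3 => no_tri h a.2 b.2 c.2 h1 h2 h3)
    (fun a b c d h1 h2 h3 h4 n1 n2 => no_quad h a.2 b.2 c.2 d.2 h1 h2 h3 h4
      (fun he => n1 (Subtype.ext he)) (fun he => n2 (Subtype.ext he)))
    (by
      rintro u a b c a' b' c' h1 h2 h3 h1' h2' h3' n1 n2 n3 n4 ⟨m, hm1, hm2⟩
      obtain ⟨g, hg1, hg2⟩ := trans_path h u.2 a.2 b.2 c.2 a'.2 b'.2 c'.2 h1 h2 h3 h1' h2' h3'
        (fun he => n1 (Subtype.ext he)) (fun he => n2 (Subtype.ext he))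
        (fun he => n3 (Subtype.ext he)) (fun he => n4 (Subtype.ext he))
      refine ⟨g • m, ?_, ?_⟩
      · have := Adj.cj hm1 g
        rw [hg1] at this
        exact this
      · have := Adj.cj hm2 g
        rw [hg2] at this
        exact this)
  refine ⟨Pt, hne, hflip, hE, ?_⟩
  have hsame : ∀ x y, (x ∈ Pt ↔ y ∈ Pt) ↔ ∃ m, AdV x m ∧ AdV y m := by
    intro x y
    refine ⟨hE x y, ?_⟩
    rintro ⟨m, h1, h2⟩
    rw [hflip x m h1, hflip y m h2]
  have hpres : ∀ (g : G) x y, (x ∈ Pt ↔ y ∈ Pt) → (g • x ∈ Pt ↔ g • y ∈ Pt) := by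
    intro g x y hxy
    obtain ⟨m, h1, h2⟩ := (hsame x y).1 hxy
    exact (hsame _ _).2 ⟨g • m, Adj.cj h1 g, Adj.cj h2 g⟩
  obtain ⟨x0, hx0⟩ := hne
  let H : Subgroup G :=
    { carrier := {g | ∀ x, g • x ∈ Pt ↔ x ∈ Pt}
      one_mem' := by intro x; rw [one_smul]
      mul_mem' := by
        intro a b ha hb x
        rw [mul_smul, ha, hb]
      inv_mem' := by
        intro a ha x
        rw [← ha, smul_inv_smul] }
  have hmem : ∀ g : G, g ∈ H ↔ g • x0 ∈ Pt := by
    intro g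
    constructor
    · intro hg; exact (hg x0).2 hx0
    · intro hg x
      by_cases hx : x ∈ Pt
      · exact ⟨fun _ => hx, fun _ => (hpres g x0 x ⟨fun _ => hx, fun _ => hx0⟩).1 hg⟩
      · obtain ⟨m, hm⟩ : ∃ m, AdV x m := by
          obtain ⟨m, h1, _⟩ := hE x x Iff.rfl
          exact ⟨m, h1⟩
        have hmP : m ∈ Pt := by
          by_contra hmP
          exact hx ((hflip x m hm).2 hmP)
        have hgm : g • m ∈ Pt := (hpres g x0 m ⟨fun _ => hmP, fun _ => hx0⟩).1 hg
        have := hflip (g • x) (g • m) (Adj.cj hm g)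
        tauto
  have hHtop : H = ⊤ := by
    by_contra hne
    obtain ⟨a, ha⟩ : ∃ a, a ∉ H := by
      by_contra hcon
      push Not at hcon
      exact hne (Subgroup.ext fun x => ⟨fun _ => mem_top _, fun _ => hcon x⟩)
    have hidx : H.index = 2 := by
      rw [Subgroup.index_eq_two_iff]
      refine ⟨a, fun b => ?_⟩
      have hx1 : a • x0 ∉ Pt := fun hh => ha ((hmem a).2 hh)
      by_cases hb : b ∈ H
      · refine Or.inr ⟨hb, ?_⟩
        rw [hmem, mul_smul]
        intro hh
        exact hx1 ((hb _).1 hh)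
      · refine Or.inl ⟨?_, hb⟩
        rw [hmem, mul_smul]
        by_contra hh
        -- neighbours
        obtain ⟨m, hm⟩ : ∃ m, AdV x0 m := by
          obtain ⟨m, h1, _⟩ := hE x0 x0 Iff.rfl
          exact ⟨m, h1⟩
        have hbx : b • x0 ∉ Pt := fun hh => hb ((hmem b).2 hh)
        have hmP : m ∉ Pt := (hflip _ _ hm).1 hx0
        have h1 := hpres b (a • x0) m (by tauto)
        have h2 := hflip (b • x0) (b • m) (Adj.cj hm b)
        tauto
    haveI := Subgroup.normal_of_index_eq_two hidx
    exact hne (h.lemN H inferInstance (by rw [hidx]; norm_num))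
  intro g x
  have : g ∈ H := by rw [hHtop]; exact mem_top _
  exact this x

end main
end OD

namespace OD
open Subgroup MulAction

/-- Abstract elation plane of order 23. -/
structure Plane (G X : Type*) [Group G] [MulAction G X] (I : X → X → Prop) (Pt : Set X)
    (E : X → Subgroup G) : Prop where
  symm : ∀ x y, I x y → I y x
  flip : ∀ x y, I x y → (x ∈ Pt ↔ y ∉ Pt)
  meet : ∀ x y, (x ∈ Pt ↔ y ∈ Pt) → ∃ m, I x m ∧ I y m
  uniq : ∀ a b c d, I a b → I b c → I c d → I d a → a ≠ c → b = d
  invI : ∀ (g : G) x y, I x y → I (g • x) (g • y)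
  invP : ∀ (g : G) x, g • x ∈ Pt ↔ x ∈ Pt
  comm : ∀ x, ∀ a ∈ E x, ∀ b ∈ E x, a * b = b * a
  cardE : ∀ x, Nat.card (E x) = 529
  fix : ∀ x y, I x y → ∀ w ∈ E x, w • y = y
  center : ∀ x, ∀ w ∈ E x, ∃ c, I c x ∧ w ∈ E c
  cardZ : ∀ x y, I x y → Nat.card (E x ⊓ E y : Subgroup G) = 23
  free : ∀ l p, (l ∉ Pt) → p ∈ Pt → ¬ I p l → ∀ w ∈ E l, w • p = p → w = 1
  reg : ∀ l p p', (l ∉ Pt) → p ∈ Pt → ¬ I p l → p' ∈ Pt → ¬ I p' l → ∃ w ∈ E l, w • p = p'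
  faith : ∀ g : G, (∀ p ∈ Pt, g • p = p) → g = 1
  gen : ∀ H : Subgroup G, (∀ l, l ∉ Pt → E l ≤ H) → H = ⊤
  exL : ∃ l, l ∉ Pt
  two : ∀ x, ∃ c c', c ≠ c' ∧ I c x ∧ I c' x
  off : ∀ l, l ∉ Pt → ∃ p, p ∈ Pt ∧ ¬ I p l

section main
variable {G : Type*} [Group G] [Finite G]

theorem AdV_reg (h : Hyp G) (x : Vx G) : {y | AdV x y}.ncard = 24 := by
  rw [← nbr24 h x.2, ← Set.ncard_image_of_injective _ Subtype.val_injective]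
  congr 1
  ext V
  constructor
  · rintro ⟨W, hW, rfl⟩; exact ⟨W.2, hW⟩
  · rintro ⟨hV, hW⟩; exact ⟨⟨V, hV⟩, hW, rfl⟩

theorem AdV_quad (h : Hyp G) (a b c d : Vx G) (h1 : AdV a b) (h2 : AdV b c) (h3 : AdV c d) (h4 : AdV d a)
    (n1 : a ≠ c) : b = d := by
  by_contra n2
  exact no_quad h a.2 b.2 c.2 d.2 h1 h2 h3 h4
      (fun he => n1 (Subtype.ext he)) (fun he => n2 (Subtype.ext he))

theorem AdV_fix (h : Hyp G) (x y : Vx G) (hxy : AdV x y) (w : G) (hw : w ∈ x.1) : w • y = y := by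
  obtain ⟨hne, P, hx, hy⟩ := hxy
  exact Subtype.ext (cj_fix h y.2 hy (hx hw))

theorem AdV_cardZ (h : Hyp G) (x y : Vx G) (hxy : AdV x y) : Nat.card (x.1 ⊓ y.1 : Subgroup G) = 23 := by
  obtain ⟨hne, P, hx, hy⟩ := hxy
  rw [inf_Zs h x.2.1 y.2.1 hx hy hne, cardZs h]

theorem AdV_center_unique (h : Hyp G) (x c c' : Vx G) (h1 : AdV c x) (h2 : AdV c' x) (w : G) (hx : w ∈ x.1)
    (hc : w ∈ c.1) (hc' : w ∈ c'.1) (hw : w ≠ 1) : c = c' := by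
  obtain ⟨n1, P, Pc, Px⟩ := h1
  obtain ⟨n2, Q, Qc, Qx⟩ := h2
  have e1 : w ∈ Zs (P : Subgroup G) := by
    rw [← inf_Zs h c.2.1 x.2.1 Pc Px n1]; exact ⟨hc, hx⟩
  have e2 : w ∈ Zs (Q : Subgroup G) := by
    rw [← inf_Zs h c'.2.1 x.2.1 Qc Qx n2]; exact ⟨hc', hx⟩
  have := Zs_inj h e1 e2 hw
  subst this
  exact Subtype.ext (third h x.2 c.2 c'.2 Px Pc Qc n1.symm n2.symm)

theorem AdV_center (h : Hyp G) (x : Vx G) (w : G) (hw : w ∈ x.1) : ∃ c, AdV c x ∧ w ∈ c.1 := by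
  have hp := packing (ι := {y | AdV x y}) (fun c => c.1.1 ⊓ x.1) x.1 ⊥ 23
    (fun c => AdV_cardZ h c.1 x (Adj.symm' c.2)) (fun c => inf_le_right) (fun _ => bot_le) (by
      intro c c' hne w hw
      by_contra hw1
      exact hne (Subtype.ext (AdV_center_unique h x c.1 c'.1 (Adj.symm' c.2) (Adj.symm' c'.2) w hw.1.2 hw.1.1 hw.2.1 hw1)))
    bot_le
  have h24 : Nat.card {y | AdV x y} = 24 := AdV_reg h x
  by_cases hw1 : w = 1
  · have hne : {y | AdV x y}.Nonempty := by rw [← Set.ncard_pos, AdV_reg h]; norm_num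
    obtain ⟨c, hc⟩ := hne
    exact ⟨c, Adj.symm' hc, hw1 ▸ one_mem _⟩
  · obtain ⟨c, hc⟩ := hp.2 (by rw [h24, x.2.1, Subgroup.card_bot]) w hw hw1
    exact ⟨c.1, Adj.symm' c.2, hc.1⟩

theorem pgroup529 (h : Hyp G) {V : Subgroup G} (hV : IsV V) : IsPGroup 23 V :=
  IsPGroup.of_card (p := 23) (n := 2) (by rw [hV.1]; norm_num)

theorem AdV_free (h : Hyp G) {Pt : Set (Vx G)} (flip : ∀ x y, AdV x y → (x ∈ Pt ↔ y ∉ Pt))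
    (meet : ∀ x y, (x ∈ Pt ↔ y ∈ Pt) → ∃ m, AdV x m ∧ AdV y m)
    (l p : Vx G) (hl : l ∉ Pt) (hp : p ∈ Pt) (hI : ¬ AdV p l) (w : G) (hw : w ∈ l.1) (hwp : w • p = p) : w = 1 := by
  by_contra hw1
  have hwn : w ∈ normalizer (p.1 : Set G) := cj_eq_self.1 (congrArg Subtype.val hwp)
  have hzp : IsPGroup 23 (zpowers w) := (pgroup529 h l.2).to_le (by rw [zpowers_le]; exact hw)
  obtain ⟨Q, hQ⟩ := (IsPGroup.to_sup_of_normal_right' hzp (pgroup529 h p.2) (by rwa [zpowers_le])).exists_le_sylow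
  have hwQ : w ∈ (Q : Subgroup G) := hQ (mem_sup_left (mem_zpowers w))
  have hpQ : p.1 ≤ (Q : Subgroup G) := le_sup_right.trans hQ
  obtain ⟨W, hW, hWQ, hne⟩ := exists_other h p.2 hpQ
  let m : Vx G := ⟨W, hW⟩
  have hpm : AdV p m := ⟨hne, Q, hpQ, hWQ⟩
  have hm : m ∉ Pt := (flip _ _ hpm).1 hp
  have hlm : l ≠ m := by rintro rfl; exact hI hpm
  obtain ⟨c, hc1, hc2⟩ := meet l m (by tauto)
  obtain ⟨n1, R, Rl, Rc⟩ := hc1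
  obtain ⟨n2, S, Sm, Sc⟩ := hc2
  have hcp : c ≠ p := by rintro rfl; exact hI (Adj.symm' ⟨n1, R, Rl, Rc⟩)
  have key := path_lemma h l.2 c.2 m.2 p.2 n1 (n2.symm) hne.symm (fun he => hlm (Subtype.ext he))
    (fun he => hcp (Subtype.ext he)) Rl Rc Sc Sm hWQ hpQ
  have hwS : w ∈ Zs (S : Subgroup G) := by
    rw [← key]; exact ⟨Rl hw, hwQ⟩
  have hwc : w ∈ c.1 := Zs_le_of h Sc c.2.1 hwS
  have hwR : w ∈ Zs (R : Subgroup G) := by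
    rw [← inf_Zs h l.2.1 c.2.1 Rl Rc n1]; exact ⟨hw, hwc⟩
  have := Zs_inj h hwR hwS hw1
  subst this
  exact hlm (Subtype.ext (third h c.2 l.2 m.2 Rc Rl Sm n1.symm n2.symm))

theorem Pt_card (h : Hyp G) {Pt : Set (Vx G)} (flip : ∀ x y, AdV x y → (x ∈ Pt ↔ y ∉ Pt))
    (meet : ∀ x y, (x ∈ Pt ↔ y ∈ Pt) → ∃ m, AdV x m ∧ AdV y m) (hne : Pt.Nonempty) : Pt.ncard = 553 := by
  obtain ⟨u, hu⟩ := hne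
  rw [← ball_card (A := AdV) (fun x y hh => Adj.symm' hh) (AdV_reg h)
    (fun a b c d h1 h2 h3 h4 n1 n2 => n2 (AdV_quad h a b c d h1 h2 h3 h4 n1)) u]
  congr 1
  ext y
  constructor
  · intro hy
    exact meet u y (by tauto)
  · rintro ⟨m, h1, h2⟩
    exact (flip y m h2).2 ((flip u m h1).1 hu)

theorem off_card (h : Hyp G) {Pt : Set (Vx G)} (flip : ∀ x y, AdV x y → (x ∈ Pt ↔ y ∉ Pt))
    (meet : ∀ x y, (x ∈ Pt ↔ y ∈ Pt) → ∃ m, AdV x m ∧ AdV y m) (hne : Pt.Nonempty)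
    (l : Vx G) (hl : l ∉ Pt) : {p | p ∈ Pt ∧ ¬ AdV p l}.ncard = 529 := by
  have h1 := Pt_card h flip meet hne
  have h2 := AdV_reg h l
  have : Pt = {y | AdV l y} ∪ {p | p ∈ Pt ∧ ¬ AdV p l} := by
    ext p
    simp only [Set.mem_union, Set.mem_setOf_eq]
    constructor
    · intro hp
      by_cases hI : AdV p l
      · exact Or.inl (Adj.symm' hI)
      · exact Or.inr ⟨hp, hI⟩
    · rintro (hp | hp)
      · exact (flip _ _ (Adj.symm' hp)).2 hl
      · exact hp.1
  rw [this, Set.ncard_union_eq, h2] at h1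
  · omega
  · rw [Set.disjoint_left]
    intro p hp hp'
    exact hp'.2 (Adj.symm' hp)

theorem AdV_regular (h : Hyp G) {Pt : Set (Vx G)} (flip : ∀ x y, AdV x y → (x ∈ Pt ↔ y ∉ Pt))
    (meet : ∀ x y, (x ∈ Pt ↔ y ∈ Pt) → ∃ m, AdV x m ∧ AdV y m) (hne : Pt.Nonempty)
    (inv : ∀ (g : G) x, g • x ∈ Pt ↔ x ∈ Pt)
    (l p p' : Vx G) (hl : l ∉ Pt) (hp : p ∈ Pt) (hI : ¬ AdV p l) (hp' : p' ∈ Pt) (hI' : ¬ AdV p' l) :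
    ∃ w ∈ l.1, w • p = p' := by
  have hfixl : ∀ w ∈ l.1, w • l = l := fun w hw => Subtype.ext (cj_eq_self_of_mem hw)
  have hsub : orbit l.1 p ⊆ {p | p ∈ Pt ∧ ¬ AdV p l} := by
    rintro _ ⟨w, rfl⟩
    refine ⟨(inv _ _).2 hp, ?_⟩
    intro hh
    have h2 := Adj.cj hh (w.1⁻¹)
    apply hI
    have e1 : w.1⁻¹ • (w.1 • p) = p := inv_smul_smul _ _
    have e2 : w.1⁻¹ • l = l := hfixl _ (inv_mem w.2)
    have h3 : AdV (w.1⁻¹ • (w.1 • p)) (w.1⁻¹ • l) := h2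
    rwa [e1, e2] at h3
  have hcard : (orbit l.1 p).ncard = 529 := by
    rw [← MulAction.index_stabilizer]
    have : stabilizer l.1 p = ⊥ := by
      rw [eq_bot_iff]
      intro w hw
      have := AdV_free h flip meet l p hl hp hI w.1 w.2 hw
      exact Subtype.ext this
    rw [this, Subgroup.index_bot, l.2.1]
  have := Set.eq_of_subset_of_ncard_le hsub (by rw [hcard, off_card h flip meet hne l hl])
  have hmem : p' ∈ {p | p ∈ Pt ∧ ¬ AdV p l} := ⟨hp', hI'⟩
  rw [← this] at hmem
  obtain ⟨w, hw⟩ := hmem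
  exact ⟨w.1, w.2, hw⟩

theorem AdV_gen (h : Hyp G) {Pt : Set (Vx G)} (flip : ∀ x y, AdV x y → (x ∈ Pt ↔ y ∉ Pt))
    (inv : ∀ (g : G) x, g • x ∈ Pt ↔ x ∈ Pt) (H : Subgroup G) (hH : ∀ l : Vx G, l ∉ Pt → l.1 ≤ H) : H = ⊤ := by
  set M : Subgroup G := ⨆ l : {l : Vx G // l ∉ Pt}, l.1.1 with hM
  have hMl : ∀ l : Vx G, l ∉ Pt → l.1 ≤ M := fun l hl => le_iSup (fun l : {l : Vx G // l ∉ Pt} => l.1.1) ⟨l, hl⟩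
  have hMH : M ≤ H := iSup_le fun l => hH l.1 l.2
  suffices hMt : M = ⊤ by rw [eq_top_iff, ← hMt]; exact hMH
  have hnorm : M.Normal := by
    refine ⟨fun n hn g => ?_⟩
    have : M ≤ cj g⁻¹ M := by
      apply iSup_le
      intro l x hx
      rw [mem_cj]
      apply hMl (g • l.1) (fun hh => l.2 ((inv _ _).1 hh))
      rw [Vx_smul, mem_cj]
      group
      exact hx
    have := this hn
    rw [mem_cj] at this
    simpa using this
  have hMv : ∀ x : Vx G, x.1 ≤ M := by
    intro x
    by_cases hx : x ∈ Pt
    · intro w hw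
      obtain ⟨c, hc, hwc⟩ := AdV_center h x w hw
      have : c ∉ Pt := fun hcP => (flip c x hc).1 hcP hx
      exact hMl c this hwc
    · exact hMl x hx
  have hMP : ∀ P : Sylow 23 G, (P : Subgroup G) ≤ M := by
    intro P
    have h2 := two_vertices h P
    obtain ⟨V, W, hne, hVW⟩ := Set.ncard_eq_two.1 h2
    have hV : IsV V ∧ V ≤ P := by
      change V ∈ {V : Subgroup G | IsV V ∧ V ≤ P}
      rw [hVW]; simp
    have hW : IsV W ∧ W ≤ P := by
      change W ∈ {V : Subgroup G | IsV V ∧ V ≤ P}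
      rw [hVW]; simp
    rw [← sup529 h hV.1.1 hW.1.1 hV.2 hW.2 hne]
    exact sup_le (hMv ⟨V, hV.1⟩) (hMv ⟨W, hW.1⟩)
  apply h.lemN M hnorm
  -- 13272 divides |M|
  obtain ⟨P⟩ : Nonempty (Sylow 23 G) := inferInstance
  have horb : orbit M P = Set.univ := by
    apply Set.eq_univ_of_forall
    intro Q
    obtain ⟨g, hg⟩ := MulAction.exists_smul_eq M (P.subtype (hMP P)) (Q.subtype (hMP Q))
    rw [Sylow.smul_subtype] at hg
    exact ⟨g, Sylow.subtype_injective hg⟩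
  have hidx := MulAction.index_stabilizer M P
  rw [horb, Set.ncard_univ, n23_eq h] at hidx
  have hd : 13272 ∣ Nat.card M := by rw [← hidx]; exact Subgroup.index_dvd_card _
  obtain ⟨k, hk⟩ := hd
  have hci := M.card_mul_index
  rw [h.card, hk] at hci
  have hd2 : M.index ∣ 2 ^ 2 * 11 ^ 2 * 23 ^ 3 := by
    refine ⟨k, ?_⟩
    have : 13272 * (M.index * k) = 13272 * (2 ^ 2 * 11 ^ 2 * 23 ^ 3) := by
      rw [show 13272 * (M.index * k) = 13272 * k * M.index by ring, hci]; norm_num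
    omega
  exact Nat.Coprime.coprime_dvd_left hd2 (by norm_num)

theorem AdV_faith (h : Hyp G) {Pt : Set (Vx G)} (flip : ∀ x y, AdV x y → (x ∈ Pt ↔ y ∉ Pt))
    (inv : ∀ (g : G) x, g • x ∈ Pt ↔ x ∈ Pt) (g : G) (hg : ∀ p ∈ Pt, g • p = p) : g = 1 := by
  let K : Subgroup G :=
    { carrier := {g | ∀ p ∈ Pt, g • p = p}
      one_mem' := fun p _ => one_smul _ _
      mul_mem' := by
        intro a b ha hb p hp
        rw [mul_smul, hb p hp, ha p hp]
      inv_mem' := by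
        intro a ha p hp
        rw [inv_smul_eq_iff, ha p hp] }
  have hKn : ∀ g : G, g ∈ normalizer (K : Set G) := by
    intro g
    rw [← cj_eq_self]
    symm
    apply Subgroup.eq_of_le_of_card_ge
    · intro k hk
      rw [mem_cj]
      intro p hp
      rw [mul_smul, mul_smul, hk _ ((inv g p).2 hp), inv_smul_smul]
    · rw [card_cj]
  have hall : ∀ k ∈ K, ∀ x : Vx G, k • x = x := by
    intro k hk x
    by_cases hx : x ∈ Pt
    · exact hk x hx
    · have h24 := AdV_reg h x
      obtain ⟨c, hc, c', hc', hne⟩ := (Set.one_lt_ncard (Set.toFinite _)).1 (by rw [h24]; norm_num : 1 < {y | AdV x y}.ncard)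
      have hcP : c ∈ Pt := (flip c x (Adj.symm' hc)).2 hx
      have hcP' : c' ∈ Pt := (flip c' x (Adj.symm' hc')).2 hx
      have e1 : AdV (k • x) (k • c) := Adj.cj hc k
      have e2 : AdV (k • x) (k • c') := Adj.cj hc' k
      rw [hk c hcP] at e1
      rw [hk c' hcP'] at e2
      exact AdV_quad h c (k • x) c' x (Adj.symm' e1) e2 (Adj.symm' hc') hc hne
  have hex : ∀ P : Sylow 23 G, ∃ V W : Vx G, V ≠ W ∧ V.1 ≤ P ∧ W.1 ≤ P := by
    intro P
    have h2 := two_vertices h P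
    obtain ⟨V, W, hne, hVW⟩ := Set.ncard_eq_two.1 h2
    have hV : IsV V ∧ V ≤ P := by
      change V ∈ {V : Subgroup G | IsV V ∧ V ≤ P}
      rw [hVW]; simp
    have hW : IsV W ∧ W ≤ P := by
      change W ∈ {V : Subgroup G | IsV V ∧ V ≤ P}
      rw [hVW]; simp
    exact ⟨⟨V, hV.1⟩, ⟨W, hW.1⟩, fun he => hne (congrArg Subtype.val he), hV.2, hW.2⟩
  have hKP : ∀ P : Sylow 23 G, K ≤ normalizer (P : Set G) := by
    intro P k hk
    obtain ⟨V, W, hne, hV, hW⟩ := hex P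
    apply Sylow.smul_eq_iff_mem_normalizer.1
    have e1 : cj k V.1 = V.1 := congrArg Subtype.val (hall k hk V)
    have e2 : cj k W.1 = W.1 := congrArg Subtype.val (hall k hk W)
    refine syl_unique h V.2 W.2 (fun he => hne (Subtype.ext he)) ?_ ?_ hV hW
    · rw [coe_smul_sylow, ← e1]; exact cj_mono hV
    · rw [coe_smul_sylow, ← e2]; exact cj_mono hW
  obtain ⟨P⟩ : Nonempty (Sylow 23 G) := inferInstance
  have h23 : ¬ 23 ∣ Nat.card K := by
    intro hd
    obtain ⟨x, hx⟩ := exists_prime_orderOf_dvd_card' (G := K) 23 hd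
    have hxo : orderOf x.1 = 23 := by rw [Subgroup.orderOf_coe, hx]
    have hx1 : x.1 ≠ 1 := by
      intro he; rw [he, orderOf_one] at hxo; norm_num at hxo
    have hzp : IsPGroup 23 (zpowers x.1) := IsPGroup.of_card (n := 1) (by rw [Nat.card_zpowers, hxo, pow_one])
    have hxP : ∀ Q : Sylow 23 G, x.1 ∈ (Q : Subgroup G) := by
      intro Q
      have h1 : x.1 ∈ zpowers x.1 ⊓ normalizer (Q : Set G) := ⟨mem_zpowers _, hKP Q x.2⟩
      have h2 := hzp.inf_normalizer_sylow Q
      rw [h2] at h1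
      exact h1.2
    have hxV : ∀ V : Vx G, x.1 ∈ V.1 := by
      intro V
      obtain ⟨hc, Q, R, hne, hQ, hR⟩ := V.2
      rw [← inf_eq529 h hne hQ hR hc]
      exact ⟨hxP Q, hxP R⟩
    have hxZ : ∀ Q : Sylow 23 G, x.1 ∈ Zs (Q : Subgroup G) := by
      intro Q
      obtain ⟨V, W, hne, hV, hW⟩ := hex Q
      rw [← inf_Zs h V.2.1 W.2.1 hV hW (fun he => hne (Subtype.ext he))]
      exact ⟨hxV V, hxV W⟩
    have : Nat.card (Sylow 23 G) ≤ 1 := by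
      rw [Finite.card_le_one_iff_subsingleton]
      exact ⟨fun Q R => Zs_inj h (hxZ Q) (hxZ R) hx1⟩
    rw [n23_eq h] at this
    omega
  have hK484 : Nat.card K ∣ 484 := by
    have h1 := Subgroup.card_dvd_of_le (hKP P)
    have h2 := P.card_eq_index_normalizer
    have h3 := (normalizer (P : Set G)).card_mul_index
    rw [← h2, n23_eq h, h.card] at h3
    have h4 : Nat.card (normalizer (P : Set G)) = 484 * 23 ^ 3 := by omega
    rw [h4] at h1
    have hcop : Nat.Coprime (Nat.card K) (23 ^ 3) :=
      Nat.Coprime.pow_right 3 ((Nat.Prime.coprime_iff_not_dvd (by norm_num)).2 h23).symm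
    exact hcop.dvd_of_dvd_mul_right h1
  have hcard : Nat.card K ≡ 1 [MOD 79] := by
    by_contra hcon
    obtain ⟨t, ht⟩ := exists_prime_orderOf_dvd_card' (G := G) 79 (by rw [h.card]; norm_num)
    obtain ⟨a, haK, ha1, hcom⟩ := fix_exists (by norm_num) K t ht (hKn t) hcon
    have hd : orderOf a ∣ 2 ^ 2 * 11 ^ 2 := by
      have := orderOf_dvd_natCard (⟨a, haK⟩ : K)
      rw [Subgroup.orderOf_mk] at this
      exact this.trans hK484
    obtain ⟨p, hp, hpa⟩ := Nat.exists_prime_and_dvd (n := orderOf a) (by rwa [Ne, orderOf_eq_one_iff])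
    have hpd := hpa.trans hd
    rcases (Nat.Prime.dvd_mul hp).1 hpd with hh | hh
    · have := (Nat.prime_dvd_prime_iff_eq hp (by norm_num)).1 (hp.dvd_of_dvd_pow hh)
      subst this
      exact h.n792 (adj_of_commute (by norm_num) (by norm_num) (by norm_num) (by rw [ht]) hpa hcom.symm)
    · have := (Nat.prime_dvd_prime_iff_eq hp (by norm_num)).1 (hp.dvd_of_dvd_pow hh)
      subst this
      exact h.n7911 (adj_of_commute (by norm_num) (by norm_num) (by norm_num) (by rw [ht]) hpa hcom.symm)
  have hK1 : Nat.card K = 1 := by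
    have hmem : Nat.card K ∈ Nat.divisors 484 := Nat.mem_divisors.2 ⟨hK484, by norm_num⟩
    have hdec : ∀ n ∈ Nat.divisors 484, n % 79 = 1 → n = 1 := by decide +kernel
    exact hdec _ hmem hcard
  have : K = ⊥ := Subgroup.card_eq_one.1 hK1
  have hgK : g ∈ K := hg
  rw [this] at hgK
  exact hgK

theorem plane_of_hyp (h : Hyp G) : ∃ Pt : Set (Vx G), Plane G (Vx G) AdV Pt (fun x => x.1) := by
  obtain ⟨Pt, hne, flip, meet, inv⟩ := bipart h
  refine ⟨Pt, ?_⟩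
  exact
  { symm := fun x y hh => Adj.symm' hh
    flip := flip
    meet := meet
    uniq := AdV_quad h
    invI := fun g x y hh => Adj.cj hh g
    invP := inv
    comm := fun x a ha b hb => comm529 h x.2.1 ha hb
    cardE := fun x => x.2.1
    fix := AdV_fix h
    center := AdV_center h
    cardZ := AdV_cardZ h
    free := AdV_free h flip meet
    reg := AdV_regular h flip meet hne inv
    faith := AdV_faith h flip inv
    gen := AdV_gen h flip inv
    exL := by
      obtain ⟨x, hx⟩ := hne
      obtain ⟨m, hm, _⟩ := meet x x Iff.rfl
      exact ⟨m, (flip x m hm).1 hx⟩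
    two := by
      intro x
      obtain ⟨c, hc, c', hc', hne⟩ := (Set.one_lt_ncard (Set.toFinite _)).1
        (by rw [AdV_reg h]; norm_num : 1 < {y | AdV x y}.ncard)
      exact ⟨c, c', hne, Adj.symm' hc, Adj.symm' hc'⟩
    off := by
      intro l hl
      have h1 := off_card h flip meet hne l hl
      have : {p | p ∈ Pt ∧ ¬ AdV p l}.Nonempty := by rw [← Set.ncard_pos, h1]; norm_num
      exact this }

end main
end OD

namespace OD
open Subgroup MulAction

abbrev F23 := ZMod 23

section plane
variable {G X : Type*} [Group G] [Finite G] [MulAction G X] {I : X → X → Prop} {Pt : Set X}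
  {E : X → Subgroup G}

theorem Plane.center_unique (h : Plane G X I Pt E) {l c c' : X} (hl : l ∉ Pt) (h1 : I c l) (h2 : I c' l) (hne : c ≠ c') {w : G}
    (hw : w ∈ E l) (hc : w ∈ E c) (hc' : w ∈ E c') : w = 1 := by
  obtain ⟨p, hp, hpl⟩ := h.off l hl
  have cP : c ∈ Pt := (h.flip _ _ h1).2 hl
  have cP' : c' ∈ Pt := (h.flip _ _ h2).2 hl
  obtain ⟨m, pm, cm⟩ := h.meet p c (by tauto)
  obtain ⟨m', pm', cm'⟩ := h.meet p c' (by tauto)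
  have e1 := h.fix _ _ cm w hc
  have e2 := h.fix _ _ cm' w hc'
  have hmm : m ≠ m' := by
    rintro rfl
    have := h.uniq c m c' l cm (h.symm _ _ cm') h2 (h.symm _ _ h1) hne
    subst this
    exact hpl pm
  have i1 := h.invI w _ _ pm
  have i2 := h.invI w _ _ pm'
  rw [e1] at i1
  rw [e2] at i2
  have := h.uniq m p m' (w • p) (h.symm _ _ pm) pm' (h.symm _ _ i2) i1 hmm
  exact h.free l p hl hp hpl w hw this.symm

theorem Plane.fix_self (h : Plane G X I Pt E) {l : X} {w : G} (hw : w ∈ E l) : w • l = l := by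
  obtain ⟨c, hc, hwc⟩ := h.center l w hw
  exact h.fix _ _ hc w hwc

theorem Plane.exists_ne_one (h : Plane G X I Pt E) {x y : X} (hxy : I x y) : ∃ w, w ∈ E x ∧ w ∈ E y ∧ w ≠ 1 := by
  have hnt : Nontrivial (E x ⊓ E y : Subgroup G) := by
    rw [← Finite.one_lt_card_iff_nontrivial, h.cardZ x y hxy]; norm_num
  obtain ⟨w, hw⟩ := exists_ne (1 : (E x ⊓ E y : Subgroup G))
  exact ⟨w.1, w.2.1, w.2.2, fun he => hw (Subtype.ext he)⟩

theorem Plane.order23 (h : Plane G X I Pt E) {x y : X} (hxy : I x y) {w : G} (h1 : w ∈ E x) (h2 : w ∈ E y) (hw : w ≠ 1) :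
    orderOf w = 23 := by
  have hm : w ∈ (E x ⊓ E y : Subgroup G) := ⟨h1, h2⟩
  have := orderOf_dvd_natCard (⟨w, hm⟩ : (E x ⊓ E y : Subgroup G))
  rw [Subgroup.orderOf_mk, h.cardZ x y hxy, Nat.dvd_prime (by norm_num), orderOf_eq_one_iff] at this
  exact this.resolve_left hw

theorem Plane.zpow23 (h : Plane G X I Pt E) {x y : X} (hxy : I x y) {w k : G} (h1 : w ∈ E x) (h2 : w ∈ E y) (hw : w ≠ 1)
    (k1 : k ∈ E x) (k2 : k ∈ E y) : ∃ n : ℕ, w ^ n = k := by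
  have hle : zpowers w ≤ E x ⊓ E y := by rw [zpowers_le]; exact ⟨h1, h2⟩
  have := Subgroup.eq_of_le_of_card_ge hle (by rw [Nat.card_zpowers, h.order23 hxy h1 h2 hw, h.cardZ x y hxy])
  have hk : k ∈ zpowers w := by rw [this]; exact ⟨k1, k2⟩
  exact (mem_powers_iff_mem_zpowers.2 hk)

theorem pow_val_add (h : Plane G X I Pt E) {a : G} (ha : orderOf a = 23) (x y : F23) : a ^ (x + y).val = a ^ x.val * a ^ y.val := by
  rw [← pow_add, ZMod.val_add]
  conv_rhs => rw [← pow_mod_orderOf, ha]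

theorem Plane.tau (h : Plane G X I Pt E) {l : X} (hl : l ∉ Pt) : ∃ τ : F23 → F23 → G,
    (∀ x y x' y', τ (x + x') (y + y') = τ x y * τ x' y') ∧ (∀ x y, τ x y ∈ E l) ∧
    (∀ x y, τ x y = 1 → x = 0 ∧ y = 0) ∧ ∀ w ∈ E l, ∃ x y, τ x y = w := by
  obtain ⟨c, c', hne, h1, h2⟩ := h.two l
  obtain ⟨a, ac, al, a1⟩ := h.exists_ne_one h1
  obtain ⟨b, bc, bl, b1⟩ := h.exists_ne_one h2
  have oa := h.order23 h1 ac al a1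
  have ob := h.order23 h2 bc bl b1
  have hcom := h.comm l a al b bl
  have hadd : ∀ x y x' y' : F23, a ^ (x + x').val * b ^ (y + y').val = a ^ x.val * b ^ y.val * (a ^ x'.val * b ^ y'.val) := by
    intro x y x' y'
    rw [pow_val_add h oa, pow_val_add h ob]
    have : Commute (a ^ x'.val) (b ^ y.val) := Commute.pow_pow hcom _ _
    rw [mul_assoc, ← mul_assoc (a ^ x'.val), this.eq, mul_assoc, mul_assoc]
  have hone : ∀ x y : F23, a ^ x.val * b ^ y.val = 1 → x = 0 ∧ y = 0 := by
    intro x y hxy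
    have hax : a ^ x.val = (b ^ y.val)⁻¹ := eq_inv_of_mul_eq_one_left hxy
    have hax1 : a ^ x.val = 1 := by
      refine h.center_unique hl h1 h2 hne (pow_mem al _) (pow_mem ac _) ?_
      rw [hax]; exact inv_mem (pow_mem bc _)
    have hby1 : b ^ y.val = 1 := by rw [hax1, one_mul] at hxy; exact hxy
    have key : ∀ (g : G) (z : F23), orderOf g = 23 → g ^ z.val = 1 → z = 0 := by
      intro g z og hz
      have := orderOf_dvd_of_pow_eq_one hz
      rw [og] at this
      have h3 := Nat.eq_zero_of_dvd_of_lt this (ZMod.val_lt z)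
      exact (ZMod.val_eq_zero z).1 h3
    exact ⟨key a x oa hax1, key b y ob hby1⟩
  have hmem : ∀ x y : F23, a ^ x.val * b ^ y.val ∈ E l := fun x y => mul_mem (pow_mem al _) (pow_mem bl _)
  refine ⟨fun x y => a ^ x.val * b ^ y.val, hadd, hmem, hone, ?_⟩
  let Φ : F23 × F23 → E l := fun z => ⟨a ^ z.1.val * b ^ z.2.val, hmem _ _⟩
  have hinj : Function.Injective Φ := by
    rintro ⟨x, y⟩ ⟨x', y'⟩ he
    have he' : a ^ x.val * b ^ y.val = a ^ x'.val * b ^ y'.val := congrArg Subtype.val he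
    have h3 := hadd (x - x') (y - y') x' y'
    rw [sub_add_cancel, sub_add_cancel, he'] at h3
    have h4 := hone _ _ (mul_eq_right.1 h3.symm)
    rw [Prod.mk.injEq]
    exact ⟨sub_eq_zero.1 h4.1, sub_eq_zero.1 h4.2⟩
  have hbij : Function.Bijective Φ := by
    apply hinj.bijective_of_nat_card_le
    rw [h.cardE]
    simp
  intro w hw
  obtain ⟨z, hz⟩ := hbij.2 ⟨w, hw⟩
  exact ⟨z.1, z.2, congrArg Subtype.val hz⟩

theorem Plane.coords (h : Plane G X I Pt E) : ∃ ψ : (Fin 3 → F23) → X, (∀ v, v ≠ 0 → ψ v ∈ Pt) ∧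
    (∀ p ∈ Pt, ∃ v, v ≠ 0 ∧ ψ v = p) ∧
    (∀ (t : F23) v, t ≠ 0 → v ≠ 0 → ψ (t • v) = ψ v) ∧
    (∀ l, l ∉ Pt → ∃ f : Fin 3 → F23, f ≠ 0 ∧ ∀ v, v ≠ 0 → (I (ψ v) l ↔ f ⬝ᵥ v = 0)) := by
  classical
  obtain ⟨l0, hl0⟩ := h.exL
  obtain ⟨τ, tadd, tmem, tone, tsurj⟩ := h.tau hl0
  obtain ⟨o, hoP, hol⟩ := h.off l0 hl0
  have hcen : ∀ x y, ∃ c, I c l0 ∧ τ x y ∈ E c := fun x y => h.center l0 _ (tmem x y)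
  choose cen cenI cenE using hcen
  have t00 : τ 0 0 = 1 := by
    have := tadd 0 0 0 0
    rw [add_zero] at this
    exact mul_eq_right.1 this.symm
  have tpow : ∀ (n : ℕ) p q, τ (n * p) (n * q) = τ p q ^ n := by
    intro n p q
    induction n with
    | zero => simp [t00]
    | succ n ih => rw [pow_succ, ← ih, ← tadd]; push_cast; congr 1 <;> ring
  have tinj : ∀ x y x' y', τ x y = τ x' y' → x = x' ∧ y = y' := by
    intro x y x' y' he
    have h3 := tadd (x - x') (y - y') x' y'
    rw [sub_add_cancel, sub_add_cancel, he] at h3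
    have h4 := tone _ _ (mul_eq_right.1 h3.symm)
    exact ⟨sub_eq_zero.1 h4.1, sub_eq_zero.1 h4.2⟩
  have cenU : ∀ x y c, ¬ (x = 0 ∧ y = 0) → I c l0 → τ x y ∈ E c → cen x y = c := by
    intro x y c hxy hc hE
    by_contra hne
    exact hxy (tone _ _ (h.center_unique hl0 (cenI x y) hc hne (tmem x y) (cenE x y) hE))
  -- membership in a center
  have tE : ∀ c p q, I c l0 → τ p q ∈ E c → ¬ (p = 0 ∧ q = 0) → ∀ x y, τ x y ∈ E c ↔ q * x = p * y := by
    intro c p q hc hE hpq x y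
    have hne : τ p q ≠ 1 := fun he => hpq (tone _ _ he)
    constructor
    · intro hxy
      obtain ⟨n, hn⟩ := h.zpow23 hc hE (tmem p q) hne hxy (tmem x y)
      rw [← tpow] at hn
      obtain ⟨h1, h2⟩ := tinj _ _ _ _ hn
      rw [← h1, ← h2]; ring
    · intro hxy
      have : ∃ t : F23, x = t * p ∧ y = t * q := by
        by_cases hp : p = 0
        · have hq : q ≠ 0 := fun hq => hpq ⟨hp, hq⟩
          refine ⟨y / q, ?_, ?_⟩
          · rw [hp, zero_mul] at hxy
            rw [hp, mul_zero]
            exact (mul_eq_zero.1 hxy).resolve_left hq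
          · field_simp
        · refine ⟨x / p, ?_, ?_⟩
          · field_simp
          · field_simp
            linear_combination -hxy
      obtain ⟨t, rfl, rfl⟩ := this
      have := tpow t.val p q
      rw [ZMod.natCast_zmod_val] at this
      rw [this]
      exact pow_mem hE _
  have toff : ∀ x y, ¬ I (τ x y • o) l0 := by
    intro x y hI
    have h1 := h.invI (τ x y)⁻¹ _ _ hI
    rw [inv_smul_smul, h.fix_self (inv_mem (tmem x y))] at h1
    exact hol h1
  refine ⟨fun v => if v 2 ≠ 0 then τ (v 0 / v 2) (v 1 / v 2) • o else cen (v 0) (v 1), ?_, ?_, ?_, ?_⟩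
  · intro v hv
    by_cases hz : v 2 = 0
    · simp only [hz, ne_eq, not_true_eq_false, if_false]
      exact (h.flip _ _ (cenI _ _)).2 hl0
    · simp only [ne_eq, hz, not_false_eq_true, if_true]
      exact (h.invP _ _).2 hoP
  · intro p hp
    by_cases hpl : I p l0
    · obtain ⟨w, wp, wl, w1⟩ := h.exists_ne_one hpl
      obtain ⟨x, y, rfl⟩ := tsurj w wl
      have hxy : ¬ (x = 0 ∧ y = 0) := by
        rintro ⟨rfl, rfl⟩
        exact w1 t00
      refine ⟨![x, y, 0], ?_, ?_⟩
      · intro he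
        exact hxy ⟨congrFun he 0, congrFun he 1⟩
      · simpa using cenU x y p hxy hpl wp
    · obtain ⟨w, wl, hw⟩ := h.reg l0 o p hl0 hoP hol hp hpl
      obtain ⟨x, y, rfl⟩ := tsurj w wl
      refine ⟨![x, y, 1], ?_, ?_⟩
      · intro he
        exact one_ne_zero (congrFun he 2)
      · simpa using hw
  · intro t v ht hv
    by_cases hz : v 2 = 0
    · have hxy : ¬ (v 0 = 0 ∧ v 1 = 0) := by
        rintro ⟨e0, e1⟩
        apply hv
        ext i
        fin_cases i <;> simp [e0, e1, hz]
      simp only [Pi.smul_apply, smul_eq_mul, hz, mul_zero, ne_eq, not_true_eq_false, if_false]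
      refine cenU _ _ _ ?_ (cenI _ _) ?_
      · rintro ⟨e0, e1⟩
        exact hxy ⟨(mul_eq_zero.1 e0).resolve_left ht, (mul_eq_zero.1 e1).resolve_left ht⟩
      · refine (tE _ (v 0) (v 1) (cenI _ _) (cenE _ _) hxy _ _).2 ?_
        ring
    · have hz' : t * v 2 ≠ 0 := mul_ne_zero ht hz
      simp only [Pi.smul_apply, smul_eq_mul, ne_eq, hz, hz', not_false_eq_true, if_true]
      rw [mul_div_mul_left _ _ ht, mul_div_mul_left _ _ ht]
  · intro l hl
    by_cases hll : l = l0
    · subst hll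
      refine ⟨![0, 0, 1], fun he => one_ne_zero (congrFun he 2), ?_⟩
      intro v hv
      rw [Matrix.vec3_dotProduct]
      by_cases hz : v 2 = 0
      · simp [hz, cenI]
      · simp [hz, toff]
    · obtain ⟨c, lc, l0c⟩ := h.meet l l0 (by tauto)
      have cl0 := h.symm _ _ l0c
      have cl := h.symm _ _ lc
      obtain ⟨w, wc, wl, w1⟩ := h.exists_ne_one cl0
      obtain ⟨p, q, rfl⟩ := tsurj w wl
      have hpq : ¬ (p = 0 ∧ q = 0) := by
        rintro ⟨rfl, rfl⟩
        exact w1 t00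
      have tEc := tE c p q cl0 wc hpq
      have hmeetU : ∀ d, I d l → I d l0 → d = c := by
        intro d d1 d2
        exact h.uniq l d l0 c (h.symm _ _ d1) d2 l0c cl hll
      have hbase : ∃ d, I d l ∧ ¬ I d l0 := by
        obtain ⟨d, d', hne, d1, d2⟩ := h.two l
        by_cases e1 : I d l0
        · refine ⟨d', d2, fun e2 => hne ?_⟩
          rw [hmeetU d d1 e1, hmeetU d' d2 e2]
        · exact ⟨d, d1, e1⟩
      obtain ⟨d, dl, dl0⟩ := hbase
      have dP : d ∈ Pt := (h.flip _ _ dl).2 hl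
      obtain ⟨w, wl', hw⟩ := h.reg l0 o d hl0 hoP hol dP dl0
      obtain ⟨r, s, rfl⟩ := tsurj w wl'
      have hk : ∀ k ∈ E l0, I (k • d) l → k ∈ E c := by
        intro k hk0 hkl
        by_cases hk1 : k = 1
        · rw [hk1]; exact one_mem _
        obtain ⟨c', c'l0, kc'⟩ := h.center l0 k hk0
        have c'P : c' ∈ Pt := (h.flip _ _ c'l0).2 hl0
        obtain ⟨m, dm, c'm⟩ := h.meet d c' (by tauto)
        have km := h.fix _ _ c'm k kc'
        have i1 := h.invI k _ _ dm
        rw [km] at i1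
        have hdk : d ≠ k • d := fun he => hk1 (h.free l0 d hl0 dP dl0 k hk0 he.symm)
        have := h.uniq d l (k • d) m dl (h.symm _ _ hkl) i1 (h.symm _ _ dm) hdk
        subst this
        rw [← hmeetU c' c'm c'l0]
        exact kc'
      refine ⟨![q, -p, p * s - q * r], ?_, ?_⟩
      · intro he
        have e0 : q = 0 := congrFun he 0
        have e1 : -p = 0 := congrFun he 1
        exact hpq ⟨neg_eq_zero.1 e1, e0⟩
      intro v hv
      have hfv : (![q, -p, p * s - q * r] : Fin 3 → F23) ⬝ᵥ v = q * v 0 - p * v 1 + (p * s - q * r) * v 2 := by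
        rw [Matrix.vec3_dotProduct]; simp; ring
      rw [hfv]
      by_cases hz : v 2 = 0
      · have hxy : ¬ (v 0 = 0 ∧ v 1 = 0) := by
          rintro ⟨e0, e1⟩
          apply hv
          ext i
          fin_cases i <;> simp [e0, e1, hz]
        simp only [hz, ne_eq, not_true_eq_false, if_false, mul_zero, add_zero]
        rw [sub_eq_zero, ← tEc]
        constructor
        · intro hh
          rw [← hmeetU _ hh (cenI _ _)]
          exact cenE _ _
        · intro hh
          rw [cenU _ _ c hxy cl0 hh]
          exact cl
      · simp only [ne_eq, hz, not_false_eq_true, if_true]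
        have hsplit : τ (v 0 / v 2) (v 1 / v 2) • o = τ (v 0 / v 2 - r) (v 1 / v 2 - s) • d := by
          rw [← hw, ← mul_smul, ← tadd, sub_add_cancel, sub_add_cancel]
        rw [hsplit]
        have : I (τ (v 0 / v 2 - r) (v 1 / v 2 - s) • d) l ↔ τ (v 0 / v 2 - r) (v 1 / v 2 - s) ∈ E c := by
          constructor
          · exact hk _ (tmem _ _)
          · intro hh
            have i1 := h.invI (τ (v 0 / v 2 - r) (v 1 / v 2 - s)) _ _ dl
            rwa [h.fix _ _ cl _ hh] at i1
        rw [this, tEc]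
        constructor
        · intro hh
          field_simp at hh
          linear_combination hh
        · intro hh
          field_simp
          linear_combination hh

end plane
end OD

namespace OD
open Subgroup MulAction

abbrev V3 := Fin 3 → F23

def dot3 (f v : V3) : F23 := f 0 * v 0 + f 1 * v 1 + f 2 * v 2

def det3 (u v p : V3) : F23 :=
  u 0 * (v 1 * p 2 - v 2 * p 1) - u 1 * (v 0 * p 2 - v 2 * p 0) + u 2 * (v 0 * p 1 - v 1 * p 0)

theorem dot3_eq (f v : V3) : f ⬝ᵥ v = dot3 f v := Matrix.vec3_dotProduct f v

theorem dot3_add (f v w : V3) : dot3 f (v + w) = dot3 f v + dot3 f w := by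
  simp only [dot3, Pi.add_apply]; ring
theorem dot3_smul (f v : V3) (t : F23) : dot3 f (t • v) = t * dot3 f v := by
  simp only [dot3, Pi.smul_apply, smul_eq_mul]; ring
theorem dot3_sub (f v w : V3) : dot3 f (v - w) = dot3 f v - dot3 f w := by
  simp only [dot3, Pi.sub_apply]; ring
theorem dot3_zero (f : V3) : dot3 f 0 = 0 := by simp [dot3]

theorem vec_zero {v : V3} (h0 : v 0 = 0) (h1 : v 1 = 0) (h2 : v 2 = 0) : v = 0 := by
  funext i; fin_cases i <;> assumption

theorem LA {f u v p : V3} (hd : det3 u v p ≠ 0) (h1 : dot3 f u = 0) (h2 : dot3 f v = 0)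
    (h3 : dot3 f p = 0) : f = 0 := by
  unfold dot3 at *
  have e0 : det3 u v p * f 0 = 0 := by
    unfold det3
    linear_combination (v 1 * p 2 - v 2 * p 1) * h1 - (u 1 * p 2 - u 2 * p 1) * h2
      + (u 1 * v 2 - u 2 * v 1) * h3
  have e1 : det3 u v p * f 1 = 0 := by
    unfold det3
    linear_combination -(v 0 * p 2 - v 2 * p 0) * h1 + (u 0 * p 2 - u 2 * p 0) * h2
      - (u 0 * v 2 - u 2 * v 0) * h3
  have e2 : det3 u v p * f 2 = 0 := by
    unfold det3
    linear_combination (v 0 * p 1 - v 1 * p 0) * h1 - (u 0 * p 1 - u 1 * p 0) * h2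
      + (u 0 * v 1 - u 1 * v 0) * h3
  exact vec_zero ((mul_eq_zero.1 e0).resolve_left hd) ((mul_eq_zero.1 e1).resolve_left hd)
    ((mul_eq_zero.1 e2).resolve_left hd)

theorem LB {g u v p : V3} (hd : det3 u v p = 0) (h1 : dot3 g u = 0) (h2 : dot3 g v ≠ 0)
    (hu : u ≠ 0) : ∃ a b : F23, p = a • v + b • u := by
  obtain ⟨a, ha⟩ : ∃ a, a = dot3 g p / dot3 g v := ⟨_, rfl⟩
  obtain ⟨q, hq⟩ : ∃ q, q = p - a • v := ⟨_, rfl⟩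
  have hgq : dot3 g q = 0 := by
    rw [hq, dot3_sub, dot3_smul, ha]; field_simp; ring
  have hdq : det3 u v q = 0 := by
    rw [← hd, hq]; simp only [det3, Pi.sub_apply, Pi.smul_apply, smul_eq_mul]; ring
  have c0 : u 1 * q 2 - u 2 * q 1 = 0 := by
    refine (mul_eq_zero.1 ?_).resolve_left h2
    unfold dot3 det3 at *
    linear_combination (v 1 * q 2 - v 2 * q 1) * h1 - (v 1 * u 2 - v 2 * u 1) * hgq - g 0 * hdq
  have c1 : u 2 * q 0 - u 0 * q 2 = 0 := by
    refine (mul_eq_zero.1 ?_).resolve_left h2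
    unfold dot3 det3 at *
    linear_combination (v 2 * q 0 - v 0 * q 2) * h1 - (v 2 * u 0 - v 0 * u 2) * hgq - g 1 * hdq
  have c2 : u 0 * q 1 - u 1 * q 0 = 0 := by
    refine (mul_eq_zero.1 ?_).resolve_left h2
    unfold dot3 det3 at *
    linear_combination (v 0 * q 1 - v 1 * q 0) * h1 - (v 0 * u 1 - v 1 * u 0) * hgq - g 2 * hdq
  have key : ∃ b : F23, q = b • u := by
    by_cases u0 : u 0 = 0
    · by_cases u1 : u 1 = 0
      · by_cases u2 : u 2 = 0
        · exact absurd (vec_zero u0 u1 u2) hu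
        · refine ⟨q 2 / u 2, ?_⟩
          funext i; fin_cases i <;> simp <;> field_simp
          · linear_combination c1
          · linear_combination -c0
      · refine ⟨q 1 / u 1, ?_⟩
        funext i; fin_cases i <;> simp <;> field_simp
        · linear_combination -c2
        · linear_combination c0
    · refine ⟨q 0 / u 0, ?_⟩
      funext i; fin_cases i <;> simp <;> field_simp
      · linear_combination c2
      · linear_combination -c1
  obtain ⟨b, hb⟩ := key
  exact ⟨a, b, by rw [← hb, hq]; abel⟩

theorem exists_det3 {f u v : V3} (hu : u ≠ 0) (h1 : dot3 f u = 0) (h2 : dot3 f v ≠ 0) :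
    ∃ p, dot3 f p ≠ 0 ∧ det3 u v p ≠ 0 := by
  have : ∃ p, det3 u v p ≠ 0 := by
    by_contra hc
    push Not at hc
    have d0 := hc ![1, 0, 0]
    have d1 := hc ![0, 1, 0]
    have d2 := hc ![0, 0, 1]
    simp [det3] at d0 d1 d2
    apply hu
    unfold dot3 at *
    refine vec_zero ?_ ?_ ?_ <;> refine (mul_eq_zero.1 ?_).resolve_left h2
    · linear_combination v 0 * h1 + f 1 * d2 - f 2 * d1
    · linear_combination v 1 * h1 - f 0 * d2 + f 2 * d0
    · linear_combination v 2 * h1 + f 0 * d1 - f 1 * d0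
  obtain ⟨p, hp⟩ := this
  by_cases hf : dot3 f p = 0
  · refine ⟨p + v, by rw [dot3_add, hf, zero_add]; exact h2, ?_⟩
    intro hz; apply hp; rw [← hz]; simp only [det3, Pi.add_apply]; ring
  · exact ⟨p, hf, hp⟩

structure Co {X : Type*} (I : X → X → Prop) (Pt : Set X) (ψ : V3 → X) : Prop where
  mem : ∀ v, v ≠ 0 → ψ v ∈ Pt
  surj : ∀ p ∈ Pt, ∃ v, v ≠ 0 ∧ ψ v = p
  scale : ∀ (t : F23) v, t ≠ 0 → v ≠ 0 → ψ (t • v) = ψ v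
  line : ∀ l, l ∉ Pt → ∃ f : V3, f ≠ 0 ∧ ∀ v, v ≠ 0 → (I (ψ v) l ↔ dot3 f v = 0)

section plane
variable {G X : Type*} [Group G] [Finite G] [MulAction G X] {I : X → X → Prop} {Pt : Set X}
  {E : X → Subgroup G}

theorem join (h : Plane G X I Pt E) {ψ : V3 → X} (k : Co I Pt ψ) {a b : V3} (ha : a ≠ 0) (hb : b ≠ 0) : ∃ m g, m ∉ Pt ∧ g ≠ 0 ∧ I (ψ a) m ∧ I (ψ b) m ∧
    dot3 g a = 0 ∧ dot3 g b = 0 ∧ ∀ v, v ≠ 0 → (I (ψ v) m ↔ dot3 g v = 0) := by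
  have m1 := k.mem a ha
  have m2 := k.mem b hb
  obtain ⟨m, i1, i2⟩ := h.meet (ψ a) (ψ b) (by tauto)
  have hm : m ∉ Pt := (h.flip _ _ i1).1 m1
  obtain ⟨g, hg, hI⟩ := k.line m hm
  exact ⟨m, g, hm, hg, i1, i2, (hI a ha).1 i1, (hI b hb).1 i2, hI⟩

theorem C1 (h : Plane G X I Pt E) {ψ : V3 → X} (k : Co I Pt ψ) {l : X} {w : G} {u f v p : V3} {γ : F23} (hl : l ∉ Pt) (hw : w ∈ E l)
    (hu : u ≠ 0) (hfu : dot3 f u = 0) (hI : ∀ v, v ≠ 0 → (I (ψ v) l ↔ dot3 f v = 0))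
    (hwu : w ∈ E (ψ u)) (hfv : dot3 f v ≠ 0)
    (hv : ψ (v + (γ * dot3 f v) • u) = w • ψ v)
    (hfp : dot3 f p ≠ 0) (hd : det3 u v p ≠ 0) :
    ψ (p + (γ * dot3 f p) • u) = w • ψ p := by
  have nz : ∀ {x : V3}, dot3 f x ≠ 0 → x ≠ 0 := by
    rintro x hx rfl; exact hx (dot3_zero f)
  have hM : ∀ x, dot3 f (x + (γ * dot3 f x) • u) = dot3 f x := by
    intro x; rw [dot3_add, dot3_smul, hfu]; ring
  have hv0 := nz hfv
  have hp0 := nz hfp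
  have hMp0 : p + (γ * dot3 f p) • u ≠ 0 := nz (by rwa [hM])
  have hMv0 : v + (γ * dot3 f v) • u ≠ 0 := nz (by rwa [hM])
  obtain ⟨L1, f1, L1P, f10, iu1, ip1, du1, dp1, I1⟩ := join h k hu hp0
  have w1 : w • L1 = L1 := h.fix _ _ iu1 w hwu
  -- the point δ on l
  obtain ⟨δ, hδ⟩ : ∃ δ, δ = dot3 f v • p - dot3 f p • v := ⟨_, rfl⟩
  have fδ : dot3 f δ = 0 := by rw [hδ, dot3_sub, dot3_smul, dot3_smul]; ring
  have δ0 : δ ≠ 0 := by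
    intro h0
    have : det3 u v δ = dot3 f v * det3 u v p := by
      rw [hδ]; simp only [det3, Pi.sub_apply, Pi.smul_apply, smul_eq_mul]; ring
    rw [h0] at this
    have hz : det3 u v 0 = 0 := by simp [det3]
    rw [hz] at this
    exact (mul_ne_zero hfv hd) this.symm
  have wδ : w • ψ δ = ψ δ := h.fix _ _ (h.symm _ _ ((hI δ δ0).2 fδ)) w hw
  obtain ⟨L3, f3, L3P, f30, iv3, iδ3, dv3, dδ3, I3⟩ := join h k hv0 δ0
  have ip3 : I (ψ p) L3 := by
    rw [I3 p hp0]
    rw [hδ, dot3_sub, dot3_smul, dot3_smul, dv3, mul_zero, sub_zero] at dδ3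
    exact (mul_eq_zero.1 dδ3).resolve_left hfv
  have L2P : w • L3 ∉ Pt := fun hc => L3P ((h.invP _ _).1 hc)
  obtain ⟨f2, f20, I2⟩ := k.line (w • L3) L2P
  have j1 := h.invI w _ _ ip3
  have j2 := h.invI w _ _ iv3
  have j3 := h.invI w _ _ iδ3
  rw [wδ, I2 δ δ0] at j3
  rw [← hv, I2 _ hMv0] at j2
  have j4 : I (ψ (p + (γ * dot3 f p) • u)) (w • L3) := by
    rw [I2 _ hMp0]
    refine (mul_eq_zero.1 ?_).resolve_left hfv
    rw [hδ, dot3_sub, dot3_smul, dot3_smul] at j3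
    rw [dot3_add, dot3_smul] at j2 ⊢
    linear_combination j3 + dot3 f p * j2
  have j5 : I (ψ (p + (γ * dot3 f p) • u)) L1 := by
    rw [I1 _ hMp0, dot3_add, dot3_smul, dp1, du1]; ring
  have j6 : I (w • ψ p) L1 := by
    have := h.invI w _ _ ip1; rwa [w1] at this
  have hne : L1 ≠ w • L3 := by
    intro he
    have : L3 = L1 := by
      apply MulAction.injective w; simp only; rw [← he, w1]
    rw [this, I1 v hv0] at iv3
    exact f10 (LA hd du1 iv3 dp1)
  exact h.uniq L1 _ (w • L3) _ (h.symm _ _ j5) j4 (h.symm _ _ j1) j6 hne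

theorem elation (h : Plane G X I Pt E) {ψ : V3 → X} (k : Co I Pt ψ) {l : X} {w : G} (hl : l ∉ Pt) (hw : w ∈ E l) : ∃ u f γ, dot3 f u = 0 ∧
    ∀ p, p ≠ 0 → ψ (p + (γ * dot3 f p) • u) = w • ψ p := by
  obtain ⟨c, icl, hwc⟩ := h.center l w hw
  have cP : c ∈ Pt := (h.flip _ _ icl).2 hl
  obtain ⟨u, hu, rfl⟩ := k.surj c cP
  obtain ⟨f, f0, hI⟩ := k.line l hl
  have hfu := (hI u hu).1 icl
  obtain ⟨x, xP, xl⟩ := h.off l hl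
  obtain ⟨v, hv0, rfl⟩ := k.surj x xP
  have hfv : dot3 f v ≠ 0 := fun hc => xl ((hI v hv0).2 hc)
  obtain ⟨v', hv'0, hv'⟩ := k.surj (w • ψ v) ((h.invP _ _).2 xP)
  obtain ⟨m, g, mP, g0, ium, ivm, dum, dvm, Im⟩ := join h k hu hv0
  have wm : w • m = m := h.fix _ _ ium w hwc
  have iv'm : I (ψ v') m := by
    have := h.invI w _ _ ivm; rwa [wm, ← hv'] at this
  have hd : det3 u v v' = 0 := by
    by_contra hd
    exact g0 (LA hd dum dvm ((Im v' hv'0).1 iv'm))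
  obtain ⟨a, b, hab⟩ := LB hd hfu hfv hu
  have ha : a ≠ 0 := by
    rintro rfl
    have : dot3 f v' = 0 := by rw [hab, dot3_add, dot3_smul, dot3_smul, hfu]; ring
    have i1 := (hI v' hv'0).2 this
    rw [hv'] at i1
    have i2 := h.invI w⁻¹ _ _ i1
    have wl := h.fix_self hw
    rw [inv_smul_smul] at i2
    have : w⁻¹ • l = l := by rw [inv_smul_eq_iff, wl]
    rw [this] at i2
    exact xl i2
  obtain ⟨γ, hγ⟩ : ∃ γ, γ = b / (a * dot3 f v) := ⟨_, rfl⟩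
  have nz : ∀ {x : V3}, dot3 f x ≠ 0 → x ≠ 0 := by
    rintro x hx rfl; exact hx (dot3_zero f)
  have hM : ∀ x, dot3 f (x + (γ * dot3 f x) • u) = dot3 f x := by
    intro x; rw [dot3_add, dot3_smul, hfu]; ring
  have hv : ψ (v + (γ * dot3 f v) • u) = w • ψ v := by
    rw [← hv', hab, ← k.scale a (v + (γ * dot3 f v) • u) ha (nz (by rwa [hM]))]
    congr 1
    rw [smul_add, smul_smul]
    congr 2
    rw [hγ]; field_simp
  refine ⟨u, f, γ, hfu, fun p hp0 => ?_⟩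
  by_cases hfp : dot3 f p = 0
  · rw [hfp, mul_zero, zero_smul, add_zero]
    exact (h.fix _ _ (h.symm _ _ ((hI p hp0).2 hfp)) w hw).symm
  by_cases hd' : det3 u v p = 0
  · obtain ⟨p', hfp', hdp'⟩ := exists_det3 (v := v) hu hfu hfv
    have := C1 h k hl hw hu hfu hI hwc hfv hv hfp' hdp'
    refine C1 h k hl hw hu hfu hI hwc hfp' this hfp ?_
    obtain ⟨a', b', hab'⟩ := LB hd' hfu hfv hu
    have ha' : a' ≠ 0 := by
      rintro rfl
      apply hfp; rw [hab', dot3_add, dot3_smul, dot3_smul, hfu]; ring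
    have : det3 u p' p = -a' * det3 u v p' := by
      rw [hab']; simp only [det3, Pi.add_apply, Pi.smul_apply, smul_eq_mul]; ring
    rw [this]
    exact mul_ne_zero (neg_ne_zero.2 ha') hdp'
  · exact C1 h k hl hw hu hfu hI hwc hfv hv hfp hd'

end plane
end OD

namespace OD
open Subgroup MulAction

abbrev SL3 := Matrix.SpecialLinearGroup (Fin 3) F23

theorem card_SL3 : Nat.card SL3 = 2 ^ 5 * 3 * 7 * 11 ^ 2 * 23 ^ 3 * 79 := by
  have h1 : Nat.card (Matrix.GeneralLinearGroup (Fin 3) F23) = 22 * (2 ^ 5 * 3 * 7 * 11 ^ 2 * 23 ^ 3 * 79) := by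
    rw [Matrix.card_GL_field]
    simp [Fin.prod_univ_three, ZMod.card]
  let φ : Matrix.GeneralLinearGroup (Fin 3) F23 →* F23ˣ := Matrix.GeneralLinearGroup.det
  have hs : Function.Surjective φ := by
    intro a
    refine ⟨Matrix.GeneralLinearGroup.mk' (Matrix.diagonal ![(a : F23), 1, 1])
      (invertibleOfNonzero (by simp [Matrix.det_diagonal, Fin.prod_univ_three])), ?_⟩
    apply Units.ext
    show (Matrix.diagonal ![(a : F23), 1, 1]).det = a
    simp [Matrix.det_diagonal, Fin.prod_univ_three]
  have hk : Nat.card φ.ker = Nat.card SL3 := by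
    symm
    refine Nat.card_congr (Equiv.ofBijective (fun A => ⟨(A : Matrix.GeneralLinearGroup (Fin 3) F23), ?_⟩) ⟨?_, ?_⟩)
    · rw [MonoidHom.mem_ker]; ext; simp [φ]
    · intro A B hAB
      have := congrArg (fun x => ((x.1 : Matrix.GeneralLinearGroup (Fin 3) F23) : Matrix (Fin 3) (Fin 3) F23)) hAB
      exact Subtype.ext this
    · rintro ⟨A, hA⟩
      rw [MonoidHom.mem_ker] at hA
      have hd : (A : Matrix (Fin 3) (Fin 3) F23).det = 1 := congrArg Units.val hA
      refine ⟨⟨A, hd⟩, ?_⟩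
      apply Subtype.ext; apply Units.ext; rfl
  have hc := Subgroup.card_mul_index φ.ker
  rw [Subgroup.index_ker, MonoidHom.range_eq_top.2 hs, Subgroup.card_top, hk, h1] at hc
  have h22 : Nat.card F23ˣ = 22 := by
    rw [Nat.card_eq_fintype_card, ZMod.card_units_eq_totient, Nat.totient_prime (by norm_num)]
  rw [h22] at hc
  omega

theorem center_SL3 : Subgroup.center SL3 = ⊥ := by
  rw [eq_bot_iff]
  intro A hA
  rw [Matrix.SpecialLinearGroup.mem_center_iff] at hA
  obtain ⟨r, hr, hA⟩ := hA
  rw [Fintype.card_fin] at hr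
  have : ∀ r : F23, r ^ 3 = 1 → r = 1 := by decide +kernel
  rw [this r hr] at hA
  rw [Subgroup.mem_bot]
  apply Subtype.ext
  rw [← hA]; simp

theorem SL3_equiv_PSL : Nonempty (SL3 ≃* Matrix.ProjectiveSpecialLinearGroup (Fin 3) (ZMod 23)) := by
  refine ⟨MulEquiv.ofBijective (QuotientGroup.mk' (Subgroup.center SL3)) ⟨?_, QuotientGroup.mk'_surjective _⟩⟩
  rw [← MonoidHom.ker_eq_bot_iff, QuotientGroup.ker_mk', center_SL3]

theorem mulVec_ne {A : SL3} {v : V3} (hv : v ≠ 0) : (A : Matrix (Fin 3) (Fin 3) F23).mulVec v ≠ 0 := by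
  intro hz
  apply hv
  have : ((A⁻¹ : SL3) : Matrix (Fin 3) (Fin 3) F23).mulVec ((A : Matrix (Fin 3) (Fin 3) F23).mulVec v) = v := by
    rw [Matrix.mulVec_mulVec, ← Matrix.SpecialLinearGroup.coe_mul, inv_mul_cancel]; simp
  rw [← this, hz, Matrix.mulVec_zero]

def elMat (u f : V3) (γ : F23) (hfu : dot3 f u = 0) : SL3 :=
  ⟨Matrix.of fun i j => (if i = j then 1 else 0) + γ * u i * f j, by
    unfold dot3 at hfu
    rw [Matrix.det_fin_three]
    simp
    linear_combination γ * hfu⟩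

theorem elMat_mulVec (u f p : V3) (γ : F23) (hfu : dot3 f u = 0) :
    (elMat u f γ hfu : Matrix (Fin 3) (Fin 3) F23).mulVec p = p + (γ * dot3 f p) • u := by
  funext i
  simp only [elMat, Matrix.mulVec, dotProduct, Fin.sum_univ_three, Matrix.of_apply, dot3, Pi.add_apply, Pi.smul_apply, smul_eq_mul]
  fin_cases i <;> simp <;> ring

def HH (G : Type*) {X : Type*} [Group G] [MulAction G X] (ψ : V3 → X) : Subgroup (SL3 × G) where
  carrier := {x | ∀ v : V3, v ≠ 0 → ψ ((x.1 : Matrix (Fin 3) (Fin 3) F23).mulVec v) = x.2 • ψ v}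
  one_mem' := by intro v hv; simp
  mul_mem' := by
    intro a b ha hb v hv
    simp only [Prod.fst_mul, Prod.snd_mul, Matrix.SpecialLinearGroup.coe_mul]
    rw [← Matrix.mulVec_mulVec, ha _ (mulVec_ne hv), hb v hv, mul_smul]
  inv_mem' := by
    intro a ha v hv
    have := ha (((a⁻¹).1 : Matrix (Fin 3) (Fin 3) F23).mulVec v) (mulVec_ne hv)
    rw [Matrix.mulVec_mulVec, ← Matrix.SpecialLinearGroup.coe_mul, ← Prod.fst_mul, mul_inv_cancel] at this
    simp only [Prod.fst_one, Matrix.SpecialLinearGroup.coe_one, Matrix.one_mulVec] at this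
    rw [this, Prod.snd_inv, inv_smul_smul]

theorem plane_equiv {G X : Type*} [Group G] [Finite G] [MulAction G X] {I : X → X → Prop} {Pt : Set X}
    {E : X → Subgroup G} (h : Plane G X I Pt E)
    (hcard : Nat.card G = 2 ^ 5 * 3 * 7 * 11 ^ 2 * 23 ^ 3 * 79) :
    Nonempty (G ≃* Matrix.ProjectiveSpecialLinearGroup (Fin 3) (ZMod 23)) := by
  obtain ⟨ψ, k1, k2, k3, k4⟩ := h.coords
  have k : Co I Pt ψ := ⟨k1, k2, k3, fun l hl => by
    obtain ⟨f, hf, hI⟩ := k4 l hl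
    exact ⟨f, hf, fun v hv => by rw [hI v hv, dot3_eq]⟩⟩
  let π₂ : HH G ψ →* G := (MonoidHom.snd SL3 G).comp (HH G ψ).subtype
  let π₁ : HH G ψ →* SL3 := (MonoidHom.fst SL3 G).comp (HH G ψ).subtype
  have s2 : Function.Surjective π₂ := by
    rw [← MonoidHom.range_eq_top]
    apply h.gen
    intro l hl w hw
    obtain ⟨u, f, γ, hfu, hψ⟩ := elation h k hl hw
    refine ⟨⟨(elMat u f γ hfu, w), ?_⟩, rfl⟩
    intro v hv
    show ψ ((elMat u f γ hfu : Matrix (Fin 3) (Fin 3) F23).mulVec v) = w • ψ v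
    rw [elMat_mulVec, hψ v hv]
  have i1 : Function.Injective π₁ := by
    rw [injective_iff_map_eq_one]
    rintro ⟨⟨A, g⟩, hA⟩ h1
    have hA1 : A = 1 := h1
    subst hA1
    have : g = 1 := by
      apply h.faith
      intro p hp
      obtain ⟨v, hv, rfl⟩ := k.surj p hp
      have := hA v hv
      simp only [Matrix.SpecialLinearGroup.coe_one, Matrix.one_mulVec] at this
      exact this.symm
    subst this
    rfl
  have c1 : Nat.card (HH G ψ) ≤ Nat.card SL3 := Nat.card_le_card_of_injective _ i1
  have c2 : Nat.card G ≤ Nat.card (HH G ψ) := Nat.card_le_card_of_surjective _ s2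
  have cc : Nat.card SL3 = Nat.card G := by rw [card_SL3, hcard]
  have b1 : Function.Bijective π₁ := Function.Injective.bijective_of_nat_card_le i1 (by omega)
  have b2 : Function.Bijective π₂ := Function.Surjective.bijective_of_nat_card_le s2 (by omega)
  obtain ⟨e⟩ := SL3_equiv_PSL
  exact ⟨(MulEquiv.ofBijective π₂ b2).symm.trans ((MulEquiv.ofBijective π₁ b1).trans e)⟩

end OD

theorem L3_23_OD_characterizable (G : Type*) [Group G] [Finite G]
    (hcard : Nat.card G = 2 ^ 5 * 3 * 7 * 11 ^ 2 * 23 ^ 3 * 79)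
    (hdeg2 : primeGraphDeg G 2 = 3)
    (hdeg3 : primeGraphDeg G 3 = 2)
    (hdeg7 : primeGraphDeg G 7 = 1)
    (hdeg11 : primeGraphDeg G 11 = 3)
    (hdeg23 : primeGraphDeg G 23 = 2)
    (hdeg79 : primeGraphDeg G 79 = 1) :
    Nonempty (G ≃* PSL(3, ZMod 23)) := by
  obtain ⟨g1, g2, g3, g4, g5, g6⟩ := OD.graph_info hcard hdeg2 hdeg3 hdeg7 hdeg11 hdeg23 hdeg79
  have hy : OD.Hyp G := ⟨hcard, g1, g2, g3, g4, g5, g6,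
    fun M hM hi => by haveI := hM; exact OD.lemmaN hcard hdeg79 M hi⟩
  obtain ⟨Pt, hP⟩ := OD.plane_of_hyp hy
  exact OD.plane_equiv hP hcard
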